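/- There exists a non-separable complex Banach space X such that for every bounded linear operator T on X and every non-zero vector x ∈ X, the J-set J_T(x) has empty interior. In particular, there exists no J-class operator on X. -/

import Mathlib

open Filter Topology

/-- The J-set of `x` under the operator `T`. -/
def JSet {𝕜 X : Type*} [NontriviallyNormedField 𝕜] [NormedAddCommGroup X] [NormedSpace 𝕜 X]
    (T : X →L[𝕜] X) (x : X) : Set X :=
  {y | ∃ k : ℕ → ℕ, StrictMono k ∧ ∃ u : ℕ → X,
    Tendsto u atTop (𝓝 x) ∧ Tendsto (fun n => (T ^ k n) (u n)) atTop (𝓝 y)}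

/-- A bounded operator is strictly singular if it is bounded below by no positive constant
on any infinite-dimensional subspace. -/
def StrictlySingular {𝕜 X : Type*} [NontriviallyNormedField 𝕜] [NormedAddCommGroup X]
    [NormedSpace 𝕜 X] (S : X →L[𝕜] X) : Prop :=
  ∀ M : Submodule 𝕜 X, ¬ FiniteDimensional 𝕜 M →
    ¬ ∃ c : ℝ, 0 < c ∧ ∀ x ∈ M, c * ‖x‖ ≤ ‖S x‖

set_option linter.unusedSectionVars false
set_option linter.unusedVariables false

/-! ### Part 1: combinatorics -/

lemma hk_rec {Ω β : Type} [LinearOrder Ω] [WellFoundedLT Ω] [Nonempty β]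
    (P : Ω → (Ω → β) → β → Prop)
    (hloc : ∀ r f f' b, (∀ s < r, f s = f' s) → P r f b → P r f' b)
    (hex : ∀ r f, (∀ s < r, P s f (f s)) → ∃ b, P r f b) :
    ∃ f : Ω → β, ∀ r, P r f (f r) := by
  classical
  let d : β := Classical.arbitrary β
  let F : ∀ r : Ω, (∀ s, s < r → β) → β := fun r g =>
    if h : ∃ b, P r (fun s => if hs : s < r then g s hs else d) b then h.choose else d
  let f : Ω → β := (wellFounded_lt (α := Ω)).fix F
  refine ⟨f, fun r => ?_⟩
  induction r using (wellFounded_lt (α := Ω)).induction with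
  | _ r ih =>
    have hf : f r = F r (fun s _ => f s) := (wellFounded_lt (α := Ω)).fix_eq F r
    have h1 : ∃ b, P r (fun s => if hs : s < r then f s else d) b := by
      obtain ⟨b, hb⟩ := hex r f ih
      exact ⟨b, hloc r f _ b (fun s hs => by simp [hs]) hb⟩
    have h2 : f r = h1.choose := by
      rw [hf]; simp only [F]; rw [dif_pos h1]
    rw [h2]
    exact hloc r _ _ _ (fun s hs => by simp [hs]) h1.choose_spec

/-- generators -/
def hkGen {Ω : Type} (B : Ω → Set ℕ) : ℕ ⊕ Ω → Set ℕ
  | Sum.inl m => {m}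
  | Sum.inr s => B s

/-- the algebra generated by singletons and `B s`, `s ∈ D`. -/
def hkAlg {Ω : Type} (B : Ω → Set ℕ) (D : Set Ω) : Set (Set ℕ) :=
  {A | ∃ F : Finset (ℕ ⊕ Ω), (∀ s, Sum.inr s ∈ F → s ∈ D) ∧
    ∀ n n', (∀ s ∈ F, n ∈ hkGen B s ↔ n' ∈ hkGen B s) → (n ∈ A ↔ n' ∈ A)}

lemma hkAlg_congr {Ω : Type} {B B' : Ω → Set ℕ} {D : Set Ω} (h : ∀ s ∈ D, B s = B' s) :
    hkAlg B D = hkAlg B' D := by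
  have key : ∀ {B B' : Ω → Set ℕ}, (∀ s ∈ D, B s = B' s) → hkAlg B D ⊆ hkAlg B' D := by
    rintro B B' h A ⟨F, hF, hA⟩
    refine ⟨F, hF, fun n n' hn => hA n n' fun s hs => ?_⟩
    have := hn s hs
    rcases s with m | s
    · exact this
    · simp only [hkGen] at this ⊢
      rw [h s (hF s hs)]; exact this
  exact Set.Subset.antisymm (key h) (key fun s hs => (h s hs).symm)

lemma hkAlg_mono {Ω : Type} {B : Ω → Set ℕ} {D D' : Set Ω} (h : D ⊆ D') :
    hkAlg B D ⊆ hkAlg B D' := by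
  rintro A ⟨F, hF, hA⟩
  exact ⟨F, fun s hs => h (hF s hs), hA⟩

lemma hkAlg_gen {Ω : Type} (B : Ω → Set ℕ) (D : Set Ω) (s : Ω) (hs : s ∈ D) :
    B s ∈ hkAlg B D :=
  ⟨{Sum.inr s}, by simp [hs], fun n n' h => h (Sum.inr s) (by simp)⟩

lemma hkAlg_sing {Ω : Type} (B : Ω → Set ℕ) (D : Set Ω) (m : ℕ) :
    {m} ∈ hkAlg B D :=
  ⟨{Sum.inl m}, by simp, fun n n' h => h (Sum.inl m) (by simp)⟩

lemma hkAlg_empty {Ω : Type} (B : Ω → Set ℕ) (D : Set Ω) : ∅ ∈ hkAlg B D :=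
  ⟨∅, by simp, by simp⟩

lemma hkAlg_union {Ω : Type} {B : Ω → Set ℕ} {D : Set Ω} {A A' : Set ℕ}
    (h : A ∈ hkAlg B D) (h' : A' ∈ hkAlg B D) : A ∪ A' ∈ hkAlg B D := by
  classical
  obtain ⟨F, hF, hA⟩ := h
  obtain ⟨F', hF', hA'⟩ := h'
  refine ⟨F ∪ F', ?_, fun n n' h => ?_⟩
  · intro s hs
    rcases Finset.mem_union.1 hs with h | h
    exacts [hF s h, hF' s h]
  · have h1 := hA n n' fun s hs => h s (Finset.mem_union_left _ hs)
    have h2 := hA' n n' fun s hs => h s (Finset.mem_union_right _ hs)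
    simp only [Set.mem_union, h1, h2]

lemma hkAlg_compl {Ω : Type} {B : Ω → Set ℕ} {D : Set Ω} {A : Set ℕ}
    (h : A ∈ hkAlg B D) : Aᶜ ∈ hkAlg B D := by
  obtain ⟨F, hF, hA⟩ := h
  exact ⟨F, hF, fun n n' h => by simp [hA n n' h]⟩

lemma hkAlg_inter {Ω : Type} {B : Ω → Set ℕ} {D : Set Ω} {A A' : Set ℕ}
    (h : A ∈ hkAlg B D) (h' : A' ∈ hkAlg B D) : A ∩ A' ∈ hkAlg B D := by
  have := hkAlg_compl (hkAlg_union (hkAlg_compl h) (hkAlg_compl h'))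
  simpa [Set.compl_union] using this

lemma hkAlg_diff {Ω : Type} {B : Ω → Set ℕ} {D : Set Ω} {A A' : Set ℕ}
    (h : A ∈ hkAlg B D) (h' : A' ∈ hkAlg B D) : A \ A' ∈ hkAlg B D :=
  hkAlg_inter h (hkAlg_compl h')

lemma hkAlg_biUnion {Ω : Type} {B : Ω → Set ℕ} {D : Set Ω} {A : ℕ → Set ℕ}
    (h : ∀ k, A k ∈ hkAlg B D) (F : Set ℕ) (hF : F.Finite) : (⋃ k ∈ F, A k) ∈ hkAlg B D := by
  induction F, hF using Set.Finite.induction_on with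
  | empty => simpa using hkAlg_empty B D
  | insert _ _ ih => rw [Set.biUnion_insert]; exact hkAlg_union (h _) ih

lemma hkAlg_step {Ω : Type} [LinearOrder Ω] {B : Ω → Set ℕ} {t : Ω} {A : Set ℕ}
    (h : A ∈ hkAlg B (Set.Iic t)) :
    ∃ C ∈ hkAlg B (Set.Iio t), ∃ D ∈ hkAlg B (Set.Iio t), A = (C ∩ B t) ∪ (D \ B t) := by
  classical
  obtain ⟨F, hF, hA⟩ := h
  let F' := F.erase (Sum.inr t)
  have hF' : ∀ s, Sum.inr s ∈ F' → s ∈ Set.Iio t := by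
    intro s hs
    have h1 := Finset.mem_erase.1 hs
    exact lt_of_le_of_ne (hF s h1.2) fun h => h1.1 (by rw [h])
  refine ⟨{n | ∃ n' ∈ A, n' ∈ B t ∧ ∀ s ∈ F', n ∈ hkGen B s ↔ n' ∈ hkGen B s},
    ⟨F', hF', ?_⟩, {n | ∃ n' ∈ A, n' ∉ B t ∧ ∀ s ∈ F', n ∈ hkGen B s ↔ n' ∈ hkGen B s},
    ⟨F', hF', ?_⟩, ?_⟩
  · intro n n' hn
    constructor
    · rintro ⟨m, hm, hm', h⟩; exact ⟨m, hm, hm', fun s hs => (hn s hs).symm.trans (h s hs)⟩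
    · rintro ⟨m, hm, hm', h⟩; exact ⟨m, hm, hm', fun s hs => (hn s hs).trans (h s hs)⟩
  · intro n n' hn
    constructor
    · rintro ⟨m, hm, hm', h⟩; exact ⟨m, hm, hm', fun s hs => (hn s hs).symm.trans (h s hs)⟩
    · rintro ⟨m, hm, hm', h⟩; exact ⟨m, hm, hm', fun s hs => (hn s hs).trans (h s hs)⟩
  · have key : ∀ n n', (n ∈ B t ↔ n' ∈ B t) →
        (∀ s ∈ F', n ∈ hkGen B s ↔ n' ∈ hkGen B s) → n' ∈ A → n ∈ A := by
      intro n n' h1 h2 h3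
      refine (hA n n' fun s hs => ?_).2 h3
      by_cases hst : s = Sum.inr t
      · subst hst; exact h1
      · exact h2 s (Finset.mem_erase.2 ⟨hst, hs⟩)
    ext n
    constructor
    · intro hn
      by_cases hb : n ∈ B t
      · exact Or.inl ⟨⟨n, hn, hb, fun _ _ => Iff.rfl⟩, hb⟩
      · exact Or.inr ⟨⟨n, hn, hb, fun _ _ => Iff.rfl⟩, hb⟩
    · rintro (⟨⟨n', h1, h2, h3⟩, hb⟩ | ⟨⟨n', h1, h2, h3⟩, hb⟩)
      · exact key n n' (by simp [hb, h2]) h3 h1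
      · exact key n n' (by simp [hb, h2]) h3 h1

open Cardinal in
lemma hkAlg_card {Ω : Type} (B : Ω → Set ℕ) (D : Set Ω) (hD : #D < 𝔠) :
    #(hkAlg B D) < 𝔠 := by
  classical
  let S := ℕ ⊕ D
  let emb : S → ℕ ⊕ Ω := Sum.map id Subtype.val
  let m : Finset S × Finset (Finset S) → Set ℕ := fun p =>
    {n | p.1.filter (fun s => n ∈ hkGen B (emb s)) ∈ p.2}
  have hsub : hkAlg B D ⊆ Set.range m := by
    rintro A ⟨F, hF, hA⟩
    let F' : Finset S := F.preimage emb (by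
      refine Function.Injective.injOn ?_
      exact Sum.map_injective.2 ⟨fun _ _ h => h, Subtype.val_injective⟩)
    refine ⟨(F', F'.powerset.filter (fun Q => ∃ n ∈ A, Q = F'.filter (fun s => n ∈ hkGen B (emb s)))), ?_⟩
    ext n
    simp only [m, Set.mem_ofPred_eq, Finset.mem_filter, Finset.mem_powerset]
    constructor
    · rintro ⟨-, n', hn', h⟩
      refine (hA n n' fun s hs => ?_).2 hn'
      obtain ⟨s', rfl⟩ : ∃ s', emb s' = s := by
        rcases s with k | s
        · exact ⟨Sum.inl k, rfl⟩
        · exact ⟨Sum.inr ⟨s, hF s hs⟩, rfl⟩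
      have hs' : s' ∈ F' := by simpa [F'] using hs
      have := Finset.ext_iff.1 h s'
      simpa [hs'] using this
    · intro hn
      exact ⟨Finset.filter_subset _ _, n, hn, rfl⟩
  calc #(hkAlg B D) ≤ #(Set.range m) := mk_le_mk_of_subset hsub
    _ ≤ #(Finset S × Finset (Finset S)) := mk_range_le
    _ = #S := by
      have : ℵ₀ ≤ #S := aleph0_le_mk _
      simp [mk_finset_of_infinite, mul_eq_self this]
    _ < 𝔠 := by
      simp only [S, mk_sum, lift_id, mk_nat]
      exact add_lt_of_lt aleph0_le_continuum aleph0_lt_continuum hD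

open Cardinal in
lemma hk_ad : ∃ 𝓘 : Set (Set ℕ), #𝓘 = 𝔠 ∧ (∀ I ∈ 𝓘, I.Infinite) ∧
    ∀ I ∈ 𝓘, ∀ J ∈ 𝓘, I ≠ J → (I ∩ J).Finite := by
  let e : (ℕ → Bool) → ℕ → ℕ := fun x n => Encodable.encode ((List.range n).map x)
  have he : ∀ x y m n, e x m = e y n → m = n ∧ ∀ i < m, x i = y i := by
    intro x y m n h
    have h1 := Encodable.encode_injective h
    have h2 : m = n := by simpa using congrArg List.length h1
    subst h2
    refine ⟨rfl, fun i hi => ?_⟩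
    have := congrArg (fun l => l[i]?) h1
    simpa [hi] using this
  let I : (ℕ → Bool) → Set ℕ := fun x => Set.range (e x)
  have hinf : ∀ x, (I x).Infinite := fun x =>
    Set.infinite_range_of_injective fun m n h => (he x x m n h).1
  have had : ∀ x y, x ≠ y → (I x ∩ I y).Finite := by
    intro x y hxy
    obtain ⟨i, hi⟩ := Function.ne_iff.1 hxy
    refine ((Set.finite_Iic i).image (e x)).subset ?_
    rintro _ ⟨⟨m, rfl⟩, ⟨n, hn⟩⟩
    refine ⟨m, ?_, rfl⟩
    by_contra hm
    exact hi ((he y x n m hn).2 i (by rw [(he y x n m hn).1]; simpa using hm)).symm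
  have hinj : Function.Injective I := by
    intro x y h
    by_contra hxy
    have := had x y hxy
    rw [h, Set.inter_self] at this
    exact hinf y this
  refine ⟨Set.range I, ?_, ?_, ?_⟩
  · rw [mk_range_eq I hinj]; simp
  · rintro _ ⟨x, rfl⟩; exact hinf x
  · rintro _ ⟨x, rfl⟩ _ ⟨y, rfl⟩ h
    exact had x y fun hxy => h (by rw [hxy])

abbrev HKReq := (ℕ → Set ℕ) × (ℕ → ℕ)

/-- the union of `A k`, `k ∈ I`. -/
def hkU (A : ℕ → Set ℕ) (I : Set ℕ) : Set ℕ := ⋃ k ∈ I, A k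

/-- validity of a request. -/
def hkValid (𝔄 : Set (Set ℕ)) (q : HKReq) : Prop :=
  (∀ k, q.1 k ∈ 𝔄) ∧ (∀ j k, j ≠ k → Disjoint (q.1 j) (q.1 k)) ∧ ∀ j k, q.2 k ∉ q.1 j

/-- trace -/
def hkTr (n : ℕ → ℕ) (D : Set ℕ) : Set ℕ := {k | n k ∈ D}

/-- mixture -/
def hkMix (C D B : Set ℕ) : Set ℕ := (C ∩ B) ∪ (D \ B)

/-- the recursion property -/
def hkP {Ω : Type} [LinearOrder Ω] (lab : Ω → HKReq) (𝓘 : Set (Set ℕ)) (r : Ω)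
    (I : Ω → Set ℕ) (b : Set ℕ) : Prop :=
  let 𝔄 := hkAlg (fun s => hkU (lab s).1 (I s)) (Set.Iio r)
  (¬ hkValid 𝔄 (lab r) → b = ∅) ∧
  (hkValid 𝔄 (lab r) → b ∈ 𝓘 ∧ (∀ s < r, I s ≠ b) ∧
    (∀ D ∈ 𝔄, hkTr (lab r).2 D ≠ b)) ∧
    ∀ s < r, I s ∈ 𝓘 → ∀ C ∈ 𝔄, ∀ D ∈ 𝔄, hkTr (lab s).2 (hkMix C D (hkU (lab r).1 b)) ≠ I s

lemma hkP_loc {Ω : Type} [LinearOrder Ω] (lab : Ω → HKReq) (𝓘 : Set (Set ℕ)) (r : Ω)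
    (I I' : Ω → Set ℕ) (b : Set ℕ) (h : ∀ s < r, I s = I' s) (hP : hkP lab 𝓘 r I b) :
    hkP lab 𝓘 r I' b := by
  have e : hkAlg (fun s => hkU (lab s).1 (I s)) (Set.Iio r) =
      hkAlg (fun s => hkU (lab s).1 (I' s)) (Set.Iio r) :=
    hkAlg_congr fun s hs => by rw [h s hs]
  unfold hkP at hP ⊢
  simp only [e] at hP
  refine ⟨hP.1, fun hv => ?_, fun s hs hI => ?_⟩
  · obtain ⟨h1, h2, h3⟩ := hP.2.1 hv
    exact ⟨h1, fun s hs => h s hs ▸ h2 s hs, h3⟩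
  · rw [← h s hs] at hI ⊢
    exact hP.2.2 s hs hI

/-- promises are kept -/
lemma hkP_promise {Ω : Type} [LinearOrder Ω] (lab : Ω → HKReq) (𝓘 : Set (Set ℕ))
    (h0 : ∅ ∉ 𝓘) (I : Ω → Set ℕ) (s t : Ω) (hst : s ≤ t) (hs : I s ∈ 𝓘)
    (hPs : hkP lab 𝓘 s I (I s)) (hPt : hkP lab 𝓘 t I (I t))
    (D : Set ℕ) (hD : D ∈ hkAlg (fun s => hkU (lab s).1 (I s)) (Set.Iic t)) :
    hkTr (lab s).2 D ≠ I s := by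
  obtain ⟨C, hC, E, hE, rfl⟩ := hkAlg_step hD
  rcases hst.eq_or_lt with rfl | hlt
  · have hsv : hkValid (hkAlg (fun s => hkU (lab s).1 (I s)) (Set.Iio s)) (lab s) := by
      by_contra hv
      rw [hPs.1 hv] at hs
      exact h0 hs
    have hv := hPs.2.1 hsv
    have : hkTr (lab s).2 (C ∩ hkU (lab s).1 (I s) ∪ E \ hkU (lab s).1 (I s)) =
        hkTr (lab s).2 E := by
      ext k
      have : (lab s).2 k ∉ hkU (lab s).1 (I s) := by
        simp only [hkU, Set.mem_iUnion, not_exists]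
        exact fun j _ => hsv.2.2 j k
      simp [hkTr, this]
    rw [this]
    exact hv.2.2 E hE
  · exact hPt.2.2 s hlt hs C hC E hE

lemma hkAlg_lt_exists {Ω : Type} [LinearOrder Ω] (B : Ω → Set ℕ) (U : Set Ω) (s : Ω) (hs : s ∈ U)
    (D : Set ℕ) (hD : D ∈ hkAlg B U) : ∃ t ∈ U, s ≤ t ∧ D ∈ hkAlg B (Set.Iic t) := by
  classical
  obtain ⟨F, hF, hA⟩ := hD
  let Q : Finset Ω := insert s (F.preimage Sum.inr Sum.inr_injective.injOn)
  have hQ : Q.Nonempty := ⟨s, by simp [Q]⟩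
  refine ⟨Q.max' hQ, ?_, Q.le_max' s (by simp [Q]), F, fun s hs => Q.le_max' s (by simp [Q, hs]), hA⟩
  have := Q.max'_mem hQ
  simp only [Q, Finset.mem_insert, Finset.mem_preimage] at this
  rcases this with h | h
  · rw [show Q.max' hQ = s from h]; exact hs
  · exact hF _ h

open Cardinal in
lemma hkP_ex {Ω : Type} [LinearOrder Ω] (hΩ : ∀ r : Ω, #(Set.Iio r) < 𝔠)
    (lab : Ω → HKReq) (𝓘 : Set (Set ℕ)) (hc : #𝓘 = 𝔠) (hinf : ∀ I ∈ 𝓘, I.Infinite)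
    (had : ∀ I ∈ 𝓘, ∀ J ∈ 𝓘, I ≠ J → (I ∩ J).Finite) (r : Ω) (I : Ω → Set ℕ)
    (hI : ∀ s < r, hkP lab 𝓘 s I (I s)) : ∃ b, hkP lab 𝓘 r I b := by
  classical
  have h0 : ∅ ∉ 𝓘 := fun h => hinf _ h Set.finite_empty
  set 𝔄 := hkAlg (fun s => hkU (lab s).1 (I s)) (Set.Iio r) with h𝔄
  have hprom : ∀ s < r, I s ∈ 𝓘 → ∀ D ∈ 𝔄, hkTr (lab s).2 D ≠ I s := by
    intro s hs hIs D hD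
    obtain ⟨t, ht, hst, hDt⟩ := hkAlg_lt_exists _ _ s hs D hD
    exact hkP_promise lab 𝓘 h0 I s t hst hIs (hI s hs) (hI t ht) D hDt
  by_cases hv : hkValid 𝔄 (lab r)
  swap
  · refine ⟨∅, fun _ => rfl, fun h => absurd h hv, fun s hs hIs C hC D hD => ?_⟩
    have : hkMix C D (hkU (lab r).1 ∅) = D := by simp [hkMix, hkU]
    rw [this]; exact hprom s hs hIs D hD
  have h𝔄c : #𝔄 < 𝔠 := hkAlg_card _ _ (hΩ r)
  let bad1 : Set (Set ℕ) := Set.range fun s : Set.Iio r => I s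
  let bad2 : Set (Set ℕ) := Set.range fun D : 𝔄 => hkTr (lab r).2 D
  let Br : (Set.Iio r × 𝔄 × 𝔄) → Set ℕ → Prop := fun p b =>
    b ∈ 𝓘 ∧ I p.1 ∈ 𝓘 ∧ hkTr (lab p.1).2 (hkMix p.2.1 p.2.2 (hkU (lab r).1 b)) = I p.1
  let bad3 : Set (Set ℕ) := Set.range fun p : Set.Iio r × 𝔄 × 𝔄 =>
    if h : ∃ b, Br p b then h.choose else ∅
  have huniq : ∀ p b b', Br p b → Br p b' → b = b' := by
    rintro ⟨⟨s, hs⟩, ⟨C, hC⟩, ⟨D, hD⟩⟩ b b' ⟨h1, h2, h3⟩ ⟨h1', -, h3'⟩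
    by_contra hbb
    have hfin := had b h1 b' h1' hbb
    have hW : hkU (lab r).1 (b ∩ b') ∈ 𝔄 := hkAlg_biUnion hv.1 _ hfin
    have hWeq : ∀ x, x ∈ hkU (lab r).1 (b ∩ b') ↔ x ∈ hkU (lab r).1 b ∧ x ∈ hkU (lab r).1 b' := by
      intro x
      simp only [hkU, Set.mem_iUnion]
      constructor
      · rintro ⟨k, hk, hx⟩; exact ⟨⟨k, hk.1, hx⟩, ⟨k, hk.2, hx⟩⟩
      · rintro ⟨⟨k, hk, hx⟩, ⟨j, hj, hx'⟩⟩
        have : j = k := by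
          by_contra hjk
          exact Set.disjoint_left.1 (hv.2.1 j k hjk) hx' hx
        subst this
        exact ⟨j, ⟨hk, hj⟩, hx⟩
    have hmix : hkMix C D (hkU (lab r).1 (b ∩ b')) ∈ 𝔄 :=
      hkAlg_union (hkAlg_inter hC hW) (hkAlg_diff hD hW)
    apply hprom s hs h2 _ hmix
    ext k
    have e1 := Set.ext_iff.1 h3 k
    have e2 := Set.ext_iff.1 h3' k
    simp only [hkTr, hkMix, Set.mem_ofPred_eq, Set.mem_union, Set.mem_inter_iff, Set.mem_sdiff] at e1 e2 ⊢
    rw [hWeq]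
    tauto
  have hb : ∃ b ∈ 𝓘, b ∉ bad1 ∪ bad2 ∪ bad3 := by
    by_contra hcon
    push Not at hcon
    have h1 : #𝓘 ≤ #(bad1 ∪ bad2 ∪ bad3 : Set (Set ℕ)) := mk_le_mk_of_subset hcon
    have h2 : #(bad1 ∪ bad2 ∪ bad3 : Set (Set ℕ)) < 𝔠 := by
      refine (mk_union_le _ _).trans_lt (add_lt_of_lt aleph0_le_continuum
        ((mk_union_le _ _).trans_lt (add_lt_of_lt aleph0_le_continuum ?_ ?_)) ?_)
      · exact mk_range_le.trans_lt (hΩ r)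
      · exact mk_range_le.trans_lt h𝔄c
      · refine mk_range_le.trans_lt ?_
        simp only [mk_prod, lift_id]
        exact mul_lt_of_lt aleph0_le_continuum (hΩ r)
          (mul_lt_of_lt aleph0_le_continuum h𝔄c h𝔄c)
    rw [hc] at h1
    exact absurd h1 (not_le.2 h2)
  obtain ⟨b, hb𝓘, hb⟩ := hb
  simp only [Set.mem_union, not_or] at hb
  refine ⟨b, fun h => absurd hv h, fun _ => ⟨hb𝓘, fun s hs h => hb.1.1 ⟨⟨s, hs⟩, h⟩,
    fun D hD h => hb.1.2 ⟨⟨D, hD⟩, h⟩⟩, fun s hs hIs C hC D hD h => hb.2 ?_⟩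
  have hB : Br ⟨⟨s, hs⟩, ⟨C, hC⟩, ⟨D, hD⟩⟩ b := ⟨hb𝓘, hIs, h⟩
  have hB' : ∃ b, Br ⟨⟨s, hs⟩, ⟨C, hC⟩, ⟨D, hD⟩⟩ b := ⟨b, hB⟩
  refine ⟨⟨⟨s, hs⟩, ⟨C, hC⟩, ⟨D, hD⟩⟩, ?_⟩
  simp only [dif_pos hB']
  exact huniq _ _ _ hB'.choose_spec hB

open Cardinal in
theorem hk_comb_aux {Ω : Type} [LinearOrder Ω] [WellFoundedLT Ω] (hΩc : #Ω = 𝔠)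
    (hΩ : ∀ r : Ω, #(Set.Iio r) < 𝔠) (lab : Ω → HKReq)
    (hlab : ∀ q, 𝔠 ≤ #{r : Ω | lab r = q}) (hne : Nonempty Ω) :
    ∃ (B : Ω → Set ℕ), ∀ (A : ℕ → Set ℕ) (n : ℕ → ℕ),
    (∀ k, A k ∈ hkAlg B Set.univ) → (∀ j k, j ≠ k → Disjoint (A j) (A k)) →
    (∀ j k, n k ∉ A j) →
    ∃ 𝒥 : Set (Set ℕ), ¬ 𝒥.Countable ∧ (∀ I ∈ 𝒥, I.Infinite) ∧
      (∀ I ∈ 𝒥, ∀ J ∈ 𝒥, I ≠ J → (I ∩ J).Finite) ∧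
      ∀ I ∈ 𝒥, (⋃ k ∈ I, A k) ∈ hkAlg B Set.univ ∧
        ∀ D ∈ hkAlg B Set.univ, {k | n k ∈ D} ≠ I := by
  classical
  obtain ⟨𝓘, hc, hinf, had⟩ := hk_ad
  have h0 : ∅ ∉ 𝓘 := fun h => hinf _ h Set.finite_empty
  obtain ⟨I, hI⟩ := hk_rec (hkP lab 𝓘) (fun r f f' b => hkP_loc lab 𝓘 r f f' b)
    (fun r f => hkP_ex hΩ lab 𝓘 hc hinf had r f)
  refine ⟨fun s => hkU (lab s).1 (I s), ?_⟩
  set B : Ω → Set ℕ := fun s => hkU (lab s).1 (I s) with hB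
  intro A n hA hdis hn
  obtain ⟨r0, hr0⟩ : ∃ r0 : Ω, ∀ k, A k ∈ hkAlg B (Set.Iio r0) := by
    obtain ⟨s0⟩ := hne
    choose t _ _ ht using fun k => hkAlg_lt_exists B Set.univ s0 trivial (A k) (hA k)
    by_contra hcon
    push Not at hcon
    have hcov : (Set.univ : Set Ω) ⊆ ⋃ k, Set.Iic (t k) := by
      intro r _
      obtain ⟨k, hk⟩ := hcon r
      rw [Set.mem_iUnion]
      refine ⟨k, ?_⟩
      by_contra hlt
      exact hk (hkAlg_mono (fun s hs => lt_of_le_of_lt hs (not_le.1 hlt)) (ht k))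
    have hIic : ∀ r : Ω, #(Set.Iic r) < 𝔠 := by
      intro r
      rw [← Set.Iio_insert]
      refine (mk_insert_le).trans_lt (add_lt_of_lt aleph0_le_continuum (hΩ r) ?_)
      exact nat_lt_continuum 1 |> fun h => by simpa using h
    have h1 : 𝔠 ≤ Cardinal.sum fun k => #(Set.Iic (t k)) := by
      rw [← hΩc, ← mk_univ]
      exact (mk_le_mk_of_subset hcov).trans mk_iUnion_le_sum_mk
    have h2 := Cardinal.sum_lt_prod (fun k => #(Set.Iic (t k))) (fun _ : ℕ => 𝔠) fun k => hIic _
    simp at h2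
    exact absurd h1 (not_le.2 h2)
  let R : Set Ω := {r | lab r = (A, n) ∧ r0 ≤ r}
  have hvalid : ∀ r ∈ R, hkValid (hkAlg B (Set.Iio r)) (lab r) := by
    rintro r ⟨h1, h2⟩
    rw [h1]
    exact ⟨fun k => hkAlg_mono (Set.Iio_subset_Iio h2) (hr0 k), hdis, hn⟩
  have hRI : ∀ r ∈ R, I r ∈ 𝓘 := fun r hr => ((hI r).2.1 (hvalid r hr)).1
  have hinj : Set.InjOn I R := by
    intro r hr s hs h
    rcases lt_trichotomy r s with hlt | rfl | hlt
    · exact absurd h (((hI s).2.1 (hvalid s hs)).2.1 r hlt)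
    · rfl
    · exact absurd h.symm (((hI r).2.1 (hvalid r hr)).2.1 s hlt)
  refine ⟨I '' R, ?_, ?_, ?_, ?_⟩
  · intro hcount
    have hRc : R.Countable := Set.countable_of_injective_of_countable_image hinj hcount
    have h1 : {r : Ω | lab r = (A, n)} ⊆ R ∪ Set.Iio r0 := by
      intro r hr
      rcases le_or_gt r0 r with h | h
      exacts [Or.inl ⟨hr, h⟩, Or.inr h]
    have h2 := hlab (A, n)
    have h3 : #(R ∪ Set.Iio r0 : Set Ω) < 𝔠 :=
      (mk_union_le _ _).trans_lt (add_lt_of_lt aleph0_le_continuum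
        ((le_aleph0_iff_set_countable.2 hRc).trans_lt aleph0_lt_continuum) (hΩ r0))
    exact absurd (h2.trans (mk_le_mk_of_subset h1)) (not_le.2 h3)
  · rintro _ ⟨r, hr, rfl⟩; exact hinf _ (hRI r hr)
  · rintro _ ⟨r, hr, rfl⟩ _ ⟨s, hs, rfl⟩ h; exact had _ (hRI r hr) _ (hRI s hs) h
  · rintro _ ⟨r, hr, rfl⟩
    constructor
    · have := hkAlg_gen B Set.univ r trivial
      have h2 : B r = ⋃ k ∈ I r, A k := by simp only [hB, hkU, hr.1]
      rwa [← h2]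
    · intro D hD
      obtain ⟨t, -, hrt, hDt⟩ := hkAlg_lt_exists B Set.univ r trivial D hD
      have := hkP_promise lab 𝓘 h0 I r t hrt (hRI r hr) (hI r) (hI t) D hDt
      rw [hr.1] at this
      exact this

open Cardinal in
theorem hk_comb : ∃ (Ω : Type) (B : Ω → Set ℕ), ∀ (A : ℕ → Set ℕ) (n : ℕ → ℕ),
    (∀ k, A k ∈ hkAlg B Set.univ) → (∀ j k, j ≠ k → Disjoint (A j) (A k)) →
    (∀ j k, n k ∉ A j) →
    ∃ 𝒥 : Set (Set ℕ), ¬ 𝒥.Countable ∧ (∀ I ∈ 𝒥, I.Infinite) ∧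
      (∀ I ∈ 𝒥, ∀ J ∈ 𝒥, I ≠ J → (I ∩ J).Finite) ∧
      ∀ I ∈ 𝒥, (⋃ k ∈ I, A k) ∈ hkAlg B Set.univ ∧
        ∀ D ∈ hkAlg B Set.univ, {k | n k ∈ D} ≠ I := by
  have hreq : #HKReq = 𝔠 := by simp [HKReq]
  have hset : #(Set ℕ) = 𝔠 := by simp
  have hΩc : #(HKReq × Set ℕ) = 𝔠 := by
    simp only [mk_prod, lift_id, hreq, hset, continuum_mul_self]
  have hfib : ∃ lab : (HKReq × Set ℕ) → HKReq, ∀ q, 𝔠 ≤ #{r | lab r = q} := by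
    refine ⟨Prod.fst, fun q => ?_⟩
    rw [← hset]
    exact mk_le_of_injective (f := fun S : Set ℕ => (⟨(q, S), rfl⟩ : {r : HKReq × Set ℕ | r.1 = q}))
        (fun S S' h => by simpa using h)
  have hne : Nonempty (HKReq × Set ℕ) := ⟨((fun _ => ∅, fun _ => 0), ∅)⟩
  refine ⟨HKReq × Set ℕ, ?_⟩
  generalize (HKReq × Set ℕ) = Ω at *
  obtain ⟨_, _, hty⟩ := Cardinal.exists_ord_eq_type_lt Ω
  obtain ⟨lab, hlab⟩ := hfib
  exact hk_comb_aux hΩc (fun r => hΩc ▸ mk_Iio_lt r hty) lab hlab hne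

/-! ### Part 1b: the compact space -/

structure HKSpace (K : Type) [TopologicalSpace K] (ι : ℕ → K) : Prop where
  inj : Function.Injective ι
  iso : ∀ n, IsOpen {ι n}
  dense : DenseRange ι
  k3 : ∀ (A : ℕ → Set K) (n : ℕ → ℕ), (∀ k, IsClopen (A k)) →
    (∀ j k, j ≠ k → Disjoint (A j) (A k)) → (∀ j k, ι (n k) ∉ A j) →
    ∃ 𝒥 : Set (Set ℕ), ¬ 𝒥.Countable ∧ (∀ I ∈ 𝒥, I.Infinite) ∧
      (∀ I ∈ 𝒥, ∀ J ∈ 𝒥, I ≠ J → (I ∩ J).Finite) ∧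
      ∀ I ∈ 𝒥, (∃ B : Set K, IsClopen B ∧ ∀ m, ι m ∈ B ↔ ∃ k ∈ I, ι m ∈ A k) ∧
        ∀ D : Set K, IsClopen D → {k | ι (n k) ∈ D} ≠ I

theorem hk_space : ∃ (K : Type) (_ : TopologicalSpace K) (_ : CompactSpace K) (_ : T2Space K)
    (_ : TotallyDisconnectedSpace K) (ι : ℕ → K), HKSpace K ι := by
  classical
  obtain ⟨Ω, B, hB⟩ := hk_comb
  let ι0 : ℕ → (ℕ ⊕ Ω → Bool) := fun n s => decide (n ∈ hkGen B s)
  let K := closure (Set.range ι0)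
  have hcl : IsClosed (closure (Set.range ι0)) := isClosed_closure
  have hK : CompactSpace K := isCompact_iff_compactSpace.1 hcl.isCompact
  let ι : ℕ → K := fun n => ⟨ι0 n, subset_closure ⟨n, rfl⟩⟩
  have hιs : ∀ n s, (ι n).1 s = decide (n ∈ hkGen B s) := fun n s => rfl
  have hdense : DenseRange ι := by
    intro x
    rw [closure_subtype]
    have : Subtype.val '' Set.range ι = Set.range ι0 := by
      rw [← Set.range_comp]; rfl
    rw [this]
    exact x.2
  -- cylinders
  have hcyl : ∀ (F : Finset (ℕ ⊕ Ω)) (P : (F → Bool) → Prop),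
      IsClopen {x : K | P (fun s => x.1 s)} := by
    intro F P
    have hc : Continuous (fun x : K => (fun s : F => x.1 s)) :=
      continuous_pi fun s => (continuous_apply (s : ℕ ⊕ Ω)).comp continuous_subtype_val
    exact (isClopen_discrete {y | P y}).preimage hc
  have hto : ∀ A ∈ hkAlg B Set.univ, ∃ U : Set K, IsClopen U ∧ ∀ m, ι m ∈ U ↔ m ∈ A := by
    rintro A ⟨F, -, hA⟩
    refine ⟨_, hcyl F (fun y => ∃ n ∈ A, y = fun s : F => (ι n).1 s), fun m => ?_⟩
    constructor
    · rintro ⟨n, hn, h⟩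
      refine (hA m n fun s hs => ?_).2 hn
      have := congrFun h ⟨s, hs⟩
      simpa [hιs] using this
    · intro hm
      exact ⟨m, hm, rfl⟩
  have hfrom : ∀ U : Set K, IsClopen U → {m | ι m ∈ U} ∈ hkAlg B Set.univ := by
    intro U hU
    have hUc : IsCompact U := hU.isClosed.isCompact
    have : ∃ W : Set K, U ⊆ W ∧ W ⊆ U ∧ {m | ι m ∈ W} ∈ hkAlg B Set.univ := by
      refine hUc.induction_on (p := fun S => ∃ W : Set K, S ⊆ W ∧ W ⊆ U ∧
        {m | ι m ∈ W} ∈ hkAlg B Set.univ) ?_ ?_ ?_ ?_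
      · exact ⟨∅, subset_rfl, Set.empty_subset _, by simpa using hkAlg_empty B _⟩
      · rintro s t hst ⟨W, h1, h2, h3⟩
        exact ⟨W, hst.trans h1, h2, h3⟩
      · rintro s t ⟨W, h1, h2, h3⟩ ⟨W', h1', h2', h3'⟩
        exact ⟨W ∪ W', Set.union_subset_union h1 h1', Set.union_subset h2 h2', hkAlg_union h3 h3'⟩
      · intro x hx
        obtain ⟨V, hV, hVU⟩ := isOpen_induced_iff.1 hU.isOpen
        have hxV : x.1 ∈ V := by rw [← hVU] at hx; exact hx
        obtain ⟨F, u, hu, huV⟩ := isOpen_pi_iff.1 hV x.1 hxV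
        let W : Set K := {y | ∀ s ∈ F, y.1 s = x.1 s}
        have hWo : IsOpen W := by
          have := (hcyl F (fun y => ∀ s, y s = x.1 s)).isOpen
          convert this using 1
          ext y; simp [W]
        refine ⟨W, mem_nhdsWithin_of_mem_nhds (hWo.mem_nhds fun s _ => rfl), W, subset_rfl, ?_, ?_⟩
        · intro y hy
          rw [← hVU]
          apply huV
          intro s hs
          rw [hy s hs]
          exact (hu s hs).2
        · refine ⟨F, by simp, fun n n' h => ?_⟩
          have : ∀ s ∈ F, (ι n).1 s = (ι n').1 s := fun s hs => by
            rw [hιs, hιs, decide_eq_decide]; exact h s hs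
          constructor
          · intro hn s hs; rw [← this s hs]; exact hn s hs
          · intro hn s hs; rw [this s hs]; exact hn s hs
    obtain ⟨W, h1, h2, h3⟩ := this
    rwa [Set.Subset.antisymm h1 h2]
  have hinj : Function.Injective ι := by
    intro m n h
    have := congrArg (fun x : K => x.1 (Sum.inl n)) h
    simpa [hιs, hkGen] using this
  refine ⟨K, inferInstance, hK, inferInstance, inferInstance, ι, hinj, ?_, hdense, ?_⟩
  · intro n
    obtain ⟨U, hU, hUn⟩ := hto {n} (hkAlg_sing B _ n)
    have : U = {ι n} := by
      apply Set.Subset.antisymm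
      · have h1 : U ⊆ closure (U ∩ Set.range ι) := hdense.open_subset_closure_inter hU.isOpen
        refine h1.trans (closure_minimal ?_ isClosed_singleton)
        rintro _ ⟨hx, m, rfl⟩
        rw [(hUn m).1 hx]; rfl
      · rintro _ rfl; exact (hUn n).2 rfl
    rw [← this]; exact hU.isOpen
  · intro A n hA hd hn
    obtain ⟨𝒥, h1, h2, h3, h4⟩ := hB (fun k => {m | ι m ∈ A k}) n (fun k => hfrom _ (hA k))
      (fun j k hjk => Set.disjoint_left.2 fun m hm hm' => Set.disjoint_left.1 (hd j k hjk) hm hm') hn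
    refine ⟨𝒥, h1, h2, h3, fun I hI => ⟨?_, fun D hD => (h4 I hI).2 _ (hfrom D hD)⟩⟩
    obtain ⟨U, hU, hUm⟩ := hto _ (h4 I hI).1
    exact ⟨U, hU, fun m => by rw [hUm]; simp⟩

/-! ### Part 2: tools for `C(K, ℂ)` -/

section tools
variable {K : Type} [TopologicalSpace K] [CompactSpace K] [T2Space K] [TotallyDisconnectedSpace K]

open Classical in
/-- indicator function of a clopen set -/
noncomputable def chi (A : Set K) : C(K, ℂ) :=
  if h : IsClopen A then ⟨A.indicator 1, (continuous_const (y := (1 : ℂ))).indicator (fun x hx => by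
    rw [h.frontier_eq] at hx; exact absurd hx (Set.notMem_empty x))⟩ else 0

open Classical in
lemma chi_apply {A : Set K} (h : IsClopen A) (x : K) : chi A x = if x ∈ A then 1 else 0 := by
  simp only [chi, dif_pos h, ContinuousMap.coe_mk, Set.indicator_apply, Pi.one_apply]

lemma chi_mem {A : Set K} (h : IsClopen A) {x : K} (hx : x ∈ A) : chi A x = 1 := by
  simp [chi_apply h, hx]

lemma chi_notMem {A : Set K} (h : IsClopen A) {x : K} (hx : x ∉ A) : chi A x = 0 := by
  simp [chi_apply h, hx]

lemma chi_norm_le (A : Set K) : ‖chi A‖ ≤ 1 := by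
  by_cases h : IsClopen A
  · rw [ContinuousMap.norm_le _ zero_le_one]
    intro x
    rw [chi_apply h]; split_ifs <;> simp
  · simp [chi, h]

/-- disjointly supported sequences in the unit ball -/
structure DisjSeq (A : ℕ → Set K) (f : ℕ → C(K, ℂ)) : Prop where
  clopen : ∀ k, IsClopen (A k)
  disj : ∀ j k, j ≠ k → Disjoint (A j) (A k)
  supp : ∀ k, ∀ x, x ∉ A k → f k x = 0
  norm : ∀ k, ‖f k‖ ≤ 1

lemma DisjSeq.comp {A : ℕ → Set K} {f : ℕ → C(K, ℂ)} (h : DisjSeq A f) {σ : ℕ → ℕ}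
    (hσ : Function.Injective σ) : DisjSeq (A ∘ σ) (f ∘ σ) :=
  ⟨fun k => h.clopen _, fun j k hjk => h.disj _ _ (hσ.ne hjk), fun k => h.supp _, fun k => h.norm _⟩

lemma DisjSeq.chi {A : ℕ → Set K} (h : ∀ k, IsClopen (A k))
    (hd : ∀ j k, j ≠ k → Disjoint (A j) (A k)) : DisjSeq A (fun k => chi (A k)) :=
  ⟨h, hd, fun k _ hx => chi_notMem (h k) hx, fun _ => chi_norm_le _⟩

/-- norm of a sum of disjointly supported functions. -/
lemma norm_sum_disj_le {J : Type} (s : Finset J) (A : J → Set K) (f : J → C(K, ℂ))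
    (hd : ∀ j ∈ s, ∀ k ∈ s, j ≠ k → Disjoint (A j) (A k))
    (hs : ∀ k ∈ s, ∀ x, x ∉ A k → f k x = 0) {c : ℝ} (hc : 0 ≤ c) (hn : ∀ k ∈ s, ‖f k‖ ≤ c) :
    ‖∑ k ∈ s, f k‖ ≤ c := by
  classical
  rw [ContinuousMap.norm_le _ hc]
  intro x
  rw [ContinuousMap.sum_apply]
  by_cases hx : ∃ k ∈ s, x ∈ A k
  · obtain ⟨k, hk, hxk⟩ := hx
    rw [Finset.sum_eq_single_of_mem k hk]
    · exact ((f k).norm_coe_le_norm x).trans (hn k hk)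
    · intro j hj hjk
      exact hs j hj x fun hxj => Set.disjoint_left.1 (hd j hj k hk hjk) hxj hxk
  · push Not at hx
    rw [Finset.sum_eq_zero fun k hk => hs k hk x (hx k hk)]
    simpa using hc

/-- ℓ¹ bound -/
lemma sum_norm_disj_le {J : Type} (φ : C(K, ℂ) →L[ℂ] ℂ) (s : Finset J) (A : J → Set K)
    (f : J → C(K, ℂ)) (hd : ∀ j ∈ s, ∀ k ∈ s, j ≠ k → Disjoint (A j) (A k))
    (hs : ∀ k ∈ s, ∀ x, x ∉ A k → f k x = 0) (hn : ∀ k ∈ s, ‖f k‖ ≤ 1) :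
    ∑ k ∈ s, ‖φ (f k)‖ ≤ ‖φ‖ := by
  have hc : ∀ z : ℂ, ∃ c : ℂ, ‖c‖ ≤ 1 ∧ c * z = (‖z‖ : ℂ) := by
    intro z
    by_cases hz : z = 0
    · exact ⟨0, by simp, by simp [hz]⟩
    · refine ⟨(‖z‖ : ℂ) / z, ?_, by field_simp⟩
      simp [hz]
  choose c hc1 hc2 using hc
  have h1 : ‖∑ k ∈ s, c (φ (f k)) • f k‖ ≤ 1 := by
    refine norm_sum_disj_le s A _ hd ?_ zero_le_one ?_
    · intro k hk x hx
      simp [hs k hk x hx]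
    · intro k hk
      rw [norm_smul]
      exact mul_le_one₀ (hc1 _) (norm_nonneg _) (hn k hk)
  have h2 : φ (∑ k ∈ s, c (φ (f k)) • f k) = ((∑ k ∈ s, ‖φ (f k)‖ : ℝ) : ℂ) := by
    rw [map_sum]
    push_cast
    refine Finset.sum_congr rfl fun k _ => ?_
    rw [map_smul, smul_eq_mul, hc2]
  have h3 := φ.le_opNorm (∑ k ∈ s, c (φ (f k)) • f k)
  rw [h2, Complex.norm_real, Real.norm_of_nonneg (by positivity)] at h3
  exact h3.trans (mul_le_of_le_one_right (norm_nonneg _) h1)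

lemma DisjSeq.sum_le {A : ℕ → Set K} {f : ℕ → C(K, ℂ)} (h : DisjSeq A f)
    (φ : C(K, ℂ) →L[ℂ] ℂ) (s : Finset ℕ) : ∑ k ∈ s, ‖φ (f k)‖ ≤ ‖φ‖ :=
  sum_norm_disj_le φ s A f (fun j _ k _ => h.disj j k) (fun k _ => h.supp k) (fun k _ => h.norm k)

/-- a clopen set separating a closed and an open set. -/
lemma exists_clopen_between {F U : Set K} (hF : IsClosed F) (hU : IsOpen U) (hFU : F ⊆ U) :
    ∃ W, IsClopen W ∧ F ⊆ W ∧ W ⊆ U := by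
  obtain ⟨W, h1, h2, h3⟩ := exists_clopen_of_closed_subset_open hF hU hFU
  exact ⟨W, h1, h2, h3⟩

lemma exists_clopen_sep {g : K → ℝ} (hg : Continuous g) {s t : ℝ} (hst : s < t) :
    ∃ W, IsClopen W ∧ (∀ x, t ≤ g x → x ∈ W) ∧ (∀ x, x ∈ W → s < g x) := by
  obtain ⟨W, h1, h2, h3⟩ := exists_clopen_between (F := {x | t ≤ g x}) (U := {x | s < g x})
    (isClosed_le continuous_const hg) (isOpen_lt continuous_const hg)
    (fun x hx => lt_of_lt_of_le hst hx)
  exact ⟨W, h1, fun x hx => h2 hx, fun x hx => h3 hx⟩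

/-- simple function approximation with a bounded number of terms. -/
lemma simple_approx {δ : ℝ} (hδ : 0 < δ) : ∃ m : ℕ, ∀ (A : Set K) (f : C(K, ℂ)), IsClopen A →
    (∀ x, x ∉ A → f x = 0) → ‖f‖ ≤ 1 → ∃ (E : Fin m → Set K) (c : Fin m → ℂ),
      (∀ i, IsClopen (E i)) ∧ (∀ i, E i ⊆ A) ∧ (∀ i, ‖c i‖ ≤ 1) ∧
      ‖f - ∑ i, c i • chi (E i)‖ ≤ δ := by
  classical
  obtain ⟨t, ht, htf, hcov⟩ := (isCompact_closedBall (0 : ℂ) 1).finite_cover_balls (half_pos hδ)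
  obtain ⟨m, c, hc⟩ : ∃ (m : ℕ) (c : Fin m → ℂ), Set.range c = t := by
    have := htf.fin_param
    obtain ⟨m, c, -, hc⟩ := this
    exact ⟨m, c, hc⟩
  refine ⟨m, fun A f hA hf hn => ?_⟩
  choose W hW1 hW2 hW3 using fun i : Fin m => exists_clopen_sep (g := fun x => -‖f x - c i‖)
    (by fun_prop) (show -δ < -(δ / 2) by linarith)
  let E : Fin m → Set K := fun i => (A ∩ W i) \ ⋃ j ∈ Set.Iio i, W j
  have hE : ∀ i, IsClopen (E i) := fun i =>
    (hA.inter (hW1 i)).diff ((Set.toFinite _).isClopen_biUnion fun j _ => hW1 j)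
  refine ⟨E, c, hE, fun i x hx => hx.1.1, fun i => ?_, ?_⟩
  · have := ht (hc ▸ Set.mem_range_self i)
    simpa using this
  · rw [ContinuousMap.norm_le _ hδ.le]
    intro x
    simp only [ContinuousMap.sub_apply, ContinuousMap.sum_apply, ContinuousMap.smul_apply,
      smul_eq_mul]
    by_cases hx : x ∈ A
    · have hex : ∃ i, x ∈ W i := by
        have h1 : f x ∈ Metric.closedBall (0 : ℂ) 1 := by
          simpa using (f.norm_coe_le_norm x).trans hn
        have h2 := hcov h1
        simp only [Set.mem_iUnion] at h2
        obtain ⟨y, hy, hxy⟩ := h2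
        rw [← hc] at hy
        obtain ⟨i, rfl⟩ := hy
        refine ⟨i, hW2 i x ?_⟩
        rw [Metric.mem_ball, dist_eq_norm] at hxy
        linarith
      obtain ⟨i, hi, hmin⟩ : ∃ i, x ∈ W i ∧ ∀ j < i, x ∉ W j := by
        have hne : (Finset.univ.filter fun i => x ∈ W i).Nonempty := by
          obtain ⟨i, hi⟩ := hex; exact ⟨i, by simp [hi]⟩
        refine ⟨_, (Finset.mem_filter.1 (Finset.min'_mem _ hne)).2, fun j hj hjW => ?_⟩
        exact absurd (Finset.min'_le _ j (by simp [hjW])) (not_le.2 hj)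
      have hiE : x ∈ E i := ⟨⟨hx, hi⟩, by simpa using hmin⟩
      rw [Finset.sum_eq_single i]
      · rw [chi_mem (hE i) hiE, mul_one]
        have := hW3 i x hi
        linarith
      · intro j _ hji
        rw [chi_notMem (hE j), mul_zero]
        intro hjE
        rcases lt_or_gt_of_ne hji with h | h
        · exact hmin j h hjE.1.2
        · exact hjE.2 (Set.mem_biUnion h hi)
      · simp
    · rw [hf x hx, Finset.sum_eq_zero]
      · simpa using hδ.le
      · intro i _
        rw [chi_notMem (hE i) fun h => hx h.1.1, mul_zero]

lemma reduce_chi {C ε : ℝ} (hε : 0 < ε) : ∃ ε' > 0, ∀ (φ : C(K, ℂ) →L[ℂ] ℂ) (A : Set K)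
    (f : C(K, ℂ)), ‖φ‖ ≤ C → IsClopen A → (∀ x, x ∉ A → f x = 0) → ‖f‖ ≤ 1 → ε ≤ ‖φ f‖ →
    ∃ A', IsClopen A' ∧ A' ⊆ A ∧ ε' ≤ ‖φ (chi A')‖ := by
  have hC : 0 < |C| + 1 := by positivity
  obtain ⟨m, hm⟩ := simple_approx (K := K) (δ := ε / (2 * (|C| + 1))) (by positivity)
  refine ⟨ε / (2 * (m + 1)), by positivity, fun φ A f hφ hA hf hn hφf => ?_⟩
  obtain ⟨E, c, hE, hEA, hc, happ⟩ := hm A f hA hf hn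
  by_contra hcon
  push Not at hcon
  have h1 : ‖φ f‖ ≤ ‖φ (f - ∑ i, c i • chi (E i))‖ + ‖φ (∑ i, c i • chi (E i))‖ := by
    rw [map_sub]
    exact norm_le_norm_sub_add _ _
  have h2 : ‖φ (f - ∑ i, c i • chi (E i))‖ ≤ ε / 2 := by
    refine (φ.le_opNorm _).trans ?_
    calc ‖φ‖ * _ ≤ (|C| + 1) * (ε / (2 * (|C| + 1))) := by
          gcongr
          exact hφ.trans ((le_abs_self C).trans (by linarith))
      _ = ε / 2 := by field_simp
  have h3 : ‖φ (∑ i, c i • chi (E i))‖ ≤ m * (ε / (2 * (m + 1))) := by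
    rw [map_sum]
    refine (norm_sum_le _ _).trans ((Finset.sum_le_card_nsmul _ _ (ε / (2 * (m + 1))) ?_).trans ?_)
    · intro i _
      rw [map_smul, norm_smul]
      have := (hcon (E i) (hE i) (hEA i)).le
      calc ‖c i‖ * ‖φ (chi (E i))‖ ≤ 1 * (ε / (2 * (m + 1))) := by
            gcongr
            exact hc i
        _ = _ := one_mul _
    · simp
  have h4 : (m : ℝ) * (ε / (2 * (m + 1))) < ε / 2 := by
    have : (m : ℝ) * (ε / (2 * (m + 1))) = (ε / 2) * (m / (m + 1)) := by field_simp
    rw [this]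
    have h5 : (m : ℝ) / (m + 1) < 1 := by rw [div_lt_one (by positivity)]; linarith
    nlinarith
  linarith

end tools

/-- Rosenthal-type thinning -/
lemma thinning_aux (ε : ℝ) (hε : 0 < ε) (N : ℕ) : ∀ a : ℕ → ℕ → ℝ, (∀ k j, 0 ≤ a k j) →
    (∀ k (s : Finset ℕ), k ∉ s → ∑ j ∈ s, a k j ≤ N * ε) →
    ∃ σ : ℕ → ℕ, Function.Injective σ ∧
      ∀ k (s : Finset ℕ), k ∉ s → ∑ j ∈ s, a (σ k) (σ j) ≤ ε := by
  classical
  induction N with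
  | zero =>
    intro a _ h
    exact ⟨id, fun _ _ h => h, fun k s hs => (h k s hs).trans (by simpa using hε.le)⟩
  | succ N ih =>
    intro a ha h
    by_cases hp : ∃ p, ∀ k (s : Finset ℕ), k ∉ s →
        ∑ j ∈ s, a (Nat.pair p k) (Nat.pair p j) ≤ ε
    · obtain ⟨p, hp⟩ := hp
      exact ⟨fun k => Nat.pair p k, fun j k hjk => (Nat.pair_eq_pair.1 hjk).2, hp⟩
    · push Not at hp
      choose k s hks hs using hp
      have hinj : Function.Injective fun p => Nat.pair p (k p) :=
        fun p q hpq => (Nat.pair_eq_pair.1 hpq).1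
      obtain ⟨σ, hσ, h'⟩ := ih (fun p q => a (Nat.pair p (k p)) (Nat.pair q (k q)))
        (fun _ _ => ha _ _) (by
          intro p t hpt
          have e := h (Nat.pair p (k p)) (t.image (fun q => Nat.pair q (k q)) ∪
            (s p).image (fun j => Nat.pair p j)) (by
              intro hmem
              rcases Finset.mem_union.1 hmem with hm | hm
              · obtain ⟨q, hq, he⟩ := Finset.mem_image.1 hm
                rw [(Nat.pair_eq_pair.1 he).1] at hq
                exact hpt hq
              · obtain ⟨j, hj, he⟩ := Finset.mem_image.1 hm
                rw [(Nat.pair_eq_pair.1 he).2] at hj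
                exact hks p hj)
          rw [Finset.sum_union, Finset.sum_image (fun x _ y _ hxy => hinj hxy),
            Finset.sum_image (fun x _ y _ hxy => (Nat.pair_eq_pair.1 hxy).2)] at e
          · have := hs p
            push_cast at e
            linarith
          · rw [Finset.disjoint_left]
            intro x hx hx'
            obtain ⟨q, hq, rfl⟩ := Finset.mem_image.1 hx
            obtain ⟨j, hj, he⟩ := Finset.mem_image.1 hx'
            rw [← (Nat.pair_eq_pair.1 he).1] at hq
            exact hpt hq)
      exact ⟨fun p => Nat.pair (σ p) (k (σ p)), hinj.comp hσ, h'⟩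

lemma thinning {ε C : ℝ} (hε : 0 < ε) (a : ℕ → ℕ → ℝ) (ha : ∀ k j, 0 ≤ a k j)
    (h : ∀ k (s : Finset ℕ), ∑ j ∈ s, a k j ≤ C) :
    ∃ σ : ℕ → ℕ, Function.Injective σ ∧
      ∀ k (s : Finset ℕ), k ∉ s → ∑ j ∈ s, a (σ k) (σ j) ≤ ε := by
  obtain ⟨N, hN⟩ := exists_nat_ge (C / ε)
  refine thinning_aux ε hε N a ha fun k s _ => (h k s).trans ?_
  rwa [div_le_iff₀ hε] at hN

section stepB
variable {K : Type} [TopologicalSpace K] [CompactSpace K] [T2Space K] [TotallyDisconnectedSpace K]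
  {ι : ℕ → K}

/-- evaluation at a point after an operator -/
noncomputable def row (T : C(K, ℂ) →L[ℂ] C(K, ℂ)) (x : K) : C(K, ℂ) →L[ℂ] ℂ :=
  (ContinuousMap.evalCLM ℂ x).comp T

@[simp] lemma row_apply (T : C(K, ℂ) →L[ℂ] C(K, ℂ)) (x : K) (f : C(K, ℂ)) : row T x f = T f x := rfl

lemma row_norm_le (T : C(K, ℂ) →L[ℂ] C(K, ℂ)) (x : K) : ‖row T x‖ ≤ ‖T‖ :=
  ContinuousLinearMap.opNorm_le_bound _ (norm_nonneg _) fun f =>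
    ((T f).norm_coe_le_norm x).trans (T.le_opNorm f)

lemma HKSpace.ext (h : HKSpace K ι) {f g : C(K, ℂ)} (hfg : ∀ m, f (ι m) = g (ι m)) : f = g := by
  apply ContinuousMap.coe_injective
  exact h.dense.equalizer f.continuous g.continuous (funext hfg)

lemma HKSpace.empty (h : HKSpace K ι) {A : Set K} (hA : IsOpen A) (hm : ∀ m, ι m ∉ A) : A = ∅ := by
  by_contra hne
  obtain ⟨x, hx, m, rfl⟩ := h.dense.inter_open_nonempty A hA (Set.nonempty_iff_ne_empty.2 hne)
  exact hm m hx

lemma HKSpace.clopen (h : HKSpace K ι) (n : ℕ) : IsClopen {ι n} := ⟨isClosed_singleton, h.iso n⟩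

/-- for a fixed functional all but countably many members of the family are regular -/
lemma rho_countable (h : HKSpace K ι) (φ : C(K, ℂ) →L[ℂ] ℂ) (A : ℕ → Set K)
    (hA : ∀ k, IsClopen (A k)) (hd : ∀ j k, j ≠ k → Disjoint (A j) (A k)) (𝒥 : Set (Set ℕ))
    (had : ∀ I ∈ 𝒥, ∀ J ∈ 𝒥, I ≠ J → (I ∩ J).Finite) (B : Set ℕ → Set K)
    (hB : ∀ I ∈ 𝒥, IsClopen (B I)) (hBA : ∀ I ∈ 𝒥, ∀ m, ι m ∈ B I ↔ ∃ k ∈ I, ι m ∈ A k) :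
    {I ∈ 𝒥 | φ (chi (B I)) ≠ ∑' j, I.indicator (fun j => φ (chi (A j))) j}.Countable := by
  classical
  have hseq := DisjSeq.chi hA hd
  have hsum : Summable fun j => ‖φ (chi (A j))‖ :=
    summable_of_sum_le (fun _ => norm_nonneg _) (fun s => hseq.sum_le φ s)
  have hsumI : ∀ I : Set ℕ, Summable (I.indicator fun j => φ (chi (A j))) := fun I =>
    (Summable.of_norm hsum).indicator I
  set ρ : Set ℕ → ℂ := fun I => φ (chi (B I)) - ∑' j, I.indicator (fun j => φ (chi (A j))) j with hρ
  have hfin : ∀ q : ℕ, {I ∈ 𝒥 | 1 / ((q : ℝ) + 1) ≤ ‖ρ I‖}.Finite := by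
    intro q
    set δ : ℝ := 1 / ((q : ℝ) + 1) with hδ
    have hδ0 : 0 < δ := by positivity
    by_contra hinf
    obtain ⟨p, hp⟩ := exists_nat_gt (‖φ‖ / (δ / 2))
    obtain ⟨t, ht, htc⟩ := (show Set.Infinite _ from hinf).exists_subset_card_eq p
    have htJ : ∀ I ∈ t, I ∈ 𝒥 := fun I hI => (ht hI).1
    -- a large finite set
    have htail := (tendsto_order.1 (tendsto_tsum_compl_atTop_zero fun j => ‖φ (chi (A j))‖)).2
      (δ / 2) (half_pos hδ0)
    obtain ⟨F0, hF0⟩ := eventually_atTop.1 htail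
    have hF1 : (⋃ I ∈ t, ⋃ J ∈ t.erase I, I ∩ J).Finite := by
      refine t.finite_toSet.biUnion fun I hI => (t.erase I).finite_toSet.biUnion fun J hJ => ?_
      have := Finset.mem_erase.1 hJ
      exact had I (htJ I hI) J (htJ J this.2) this.1.symm
    let F : Finset ℕ := F0 ∪ hF1.toFinset
    have hFt := hF0 F Finset.subset_union_left
    let W : Set K := ⋃ k ∈ F, A k
    have hW : IsClopen W := F.finite_toSet.isClopen_biUnion fun k _ => hA k
    let B' : Set ℕ → Set K := fun I => B I \ W
    have hB' : ∀ I ∈ t, IsClopen (B' I) := fun I hI => (hB I (htJ I hI)).diff hW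
    have huniq : ∀ x j k, x ∈ A j → x ∈ A k → j = k := fun x j k hj hk => by
      by_contra hjk
      exact Set.disjoint_left.1 (hd j k hjk) hj hk
    have hB'm : ∀ I ∈ t, ∀ m, ι m ∈ B' I ↔ ∃ k ∈ I, k ∉ F ∧ ι m ∈ A k := by
      intro I hI m
      simp only [B', W, Set.mem_sdiff, hBA I (htJ I hI), Set.mem_iUnion, not_exists]
      constructor
      · rintro ⟨⟨k, hk, hm⟩, h2⟩
        exact ⟨k, hk, fun hkF => h2 k hkF hm, hm⟩
      · rintro ⟨k, hk, hkF, hm⟩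
        refine ⟨⟨k, hk, hm⟩, fun j hj hmj => hkF ?_⟩
        rw [huniq _ _ _ hm hmj]; exact hj
    have hdis : ∀ I ∈ t, ∀ J ∈ t, I ≠ J → Disjoint (B' I) (B' J) := by
      intro I hI J hJ hIJ
      rw [Set.disjoint_iff_inter_eq_empty]
      refine h.empty ((hB' I hI).inter (hB' J hJ)).isOpen ?_
      rintro m ⟨h1, h2⟩
      obtain ⟨k, hk, hkF, hm⟩ := (hB'm I hI m).1 h1
      obtain ⟨j, hj, hjF, hmj⟩ := (hB'm J hJ m).1 h2
      have := huniq _ _ _ hm hmj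
      subst this
      apply hkF
      refine Finset.mem_union_right _ (hF1.mem_toFinset.2 ?_)
      simp only [Set.mem_iUnion]
      exact ⟨I, hI, J, Finset.mem_erase.2 ⟨hIJ.symm, hJ⟩, hk, hj⟩
    have hsplit : ∀ I ∈ t, chi (B I) = chi (B' I) + ∑ k ∈ F.filter (· ∈ I), chi (A k) := by
      intro I hI
      refine h.ext fun m => ?_
      rw [ContinuousMap.add_apply, ContinuousMap.sum_apply]
      by_cases hm : ∃ k ∈ I, ι m ∈ A k
      · obtain ⟨k, hk, hmk⟩ := hm
        rw [chi_mem (hB I (htJ I hI)) ((hBA I (htJ I hI) m).2 ⟨k, hk, hmk⟩)]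
        by_cases hkF : k ∈ F
        · rw [chi_notMem (hB' I hI), Finset.sum_eq_single_of_mem k (by simp [hkF, hk]),
            chi_mem (hA k) hmk, zero_add]
          · intro j hj hjk
            exact chi_notMem (hA j) fun hmj => hjk (huniq _ _ _ hmj hmk)
          · intro hmem
            obtain ⟨j, hj, hjF, hmj⟩ := (hB'm I hI m).1 hmem
            rw [huniq _ _ _ hmj hmk] at hjF
            exact hjF hkF
        · rw [chi_mem (hB' I hI) ((hB'm I hI m).2 ⟨k, hk, hkF, hmk⟩), Finset.sum_eq_zero, add_zero]
          intro j hj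
          refine chi_notMem (hA j) fun hmj => ?_
          rw [huniq _ _ _ hmj hmk] at hj
          exact hkF (Finset.mem_filter.1 hj).1
      · rw [chi_notMem (hB I (htJ I hI)) fun hmem => hm ((hBA I (htJ I hI) m).1 hmem),
          chi_notMem (hB' I hI) fun hmem => ?_, Finset.sum_eq_zero, add_zero]
        · intro j hj
          exact chi_notMem (hA j) fun hmj => hm ⟨j, (Finset.mem_filter.1 hj).2, hmj⟩
        · obtain ⟨k, hk, -, hmk⟩ := (hB'm I hI m).1 hmem
          exact hm ⟨k, hk, hmk⟩
    have hlow : ∀ I ∈ t, δ / 2 ≤ ‖φ (chi (B' I))‖ := by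
      intro I hI
      have h1 := (hsumI I).sum_add_tsum_subtype_compl F
      have h2 : ∑ k ∈ F.filter (· ∈ I), φ (chi (A k)) =
          ∑ k ∈ F, I.indicator (fun j => φ (chi (A j))) k := by
        rw [Finset.sum_filter]
        refine Finset.sum_congr rfl fun k _ => ?_
        simp [Set.indicator_apply]
      have h3 : φ (chi (B' I)) = ρ I +
          ∑' x : {x // x ∉ F}, I.indicator (fun j => φ (chi (A j))) x := by
        simp only [hρ]
        rw [hsplit I hI, map_add, map_sum, h2, ← h1]
        ring
      have h4 : ‖∑' x : {x // x ∉ F}, I.indicator (fun j => φ (chi (A j))) x‖ ≤ δ / 2 := by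
        have hs : Summable fun x : {x // x ∉ F} => ‖φ (chi (A x))‖ := hsum.subtype _
        have hs' : Summable fun x : {x // x ∉ F} => ‖I.indicator (fun j => φ (chi (A j))) x‖ :=
          Summable.of_nonneg_of_le (fun _ => norm_nonneg _)
            (fun x => norm_indicator_le_norm_self _ _) hs
        refine (norm_tsum_le_tsum_norm hs').trans ((hs'.tsum_le_tsum
          (fun x => norm_indicator_le_norm_self _ _) hs).trans hFt.le)
      have h5 := (ht hI).2
      have h6 : ‖ρ I‖ ≤ ‖φ (chi (B' I))‖ +
          ‖∑' x : {x // x ∉ F}, I.indicator (fun j => φ (chi (A j))) x‖ := by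
        have : ρ I = φ (chi (B' I)) - ∑' x : {x // x ∉ F}, I.indicator (fun j => φ (chi (A j))) x := by
          rw [h3]; ring
        rw [this]; exact norm_sub_le _ _
      linarith
    have hsumle := sum_norm_disj_le φ t B' (fun I => chi (B' I)) hdis
      (fun I hI x hx => chi_notMem (hB' I hI) hx) (fun I _ => chi_norm_le _)
    have h7 := Finset.card_nsmul_le_sum t (fun I => ‖φ (chi (B' I))‖) (δ / 2) hlow
    rw [htc, nsmul_eq_mul] at h7
    rw [div_lt_iff₀ (half_pos hδ0)] at hp
    linarith
  refine (Set.countable_iUnion fun q : ℕ => (hfin q).countable).mono ?_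
  rintro I ⟨hI, hne⟩
  have h1 : 0 < ‖ρ I‖ := norm_pos_iff.2 (sub_ne_zero.2 hne)
  obtain ⟨q, hq⟩ := exists_nat_one_div_lt h1
  exact Set.mem_iUnion.2 ⟨q, hI, hq.le⟩

theorem stepB (h : HKSpace K ι) (T : C(K, ℂ) →L[ℂ] C(K, ℂ)) (A : ℕ → Set K) (f : ℕ → C(K, ℂ))
    (n : ℕ → ℕ) (hs : DisjSeq A f) (h0 : ∀ k, f k (ι (n k)) = 0) {ε : ℝ} (hε : 0 < ε)
    (hT : ∀ k, ε ≤ ‖T (f k) (ι (n k))‖) : False := by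
  classical
  -- reduce to characteristic functions
  obtain ⟨ε', hε', hred⟩ := reduce_chi (K := K) (C := ‖T‖) hε
  have h1 : ∀ k, ∃ E, IsClopen E ∧ E ⊆ A k \ {ι (n k)} ∧ ε' ≤ ‖T (chi E) (ι (n k))‖ := by
    intro k
    refine hred (row T (ι (n k))) _ (f k) (row_norm_le _ _) ((hs.clopen k).diff (h.clopen _)) ?_
      (hs.norm k) (hT k)
    intro x hx
    by_cases hxA : x ∈ A k
    · have : x = ι (n k) := by
        by_contra hne
        exact hx ⟨hxA, hne⟩
      rw [this]; exact h0 k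
    · exact hs.supp k x hxA
  choose E hE hEA hTE using h1
  have hEd : ∀ j k, j ≠ k → Disjoint (E j) (E k) := fun j k hjk =>
    (hs.disj j k hjk).mono (fun x hx => (hEA j hx).1) (fun x hx => (hEA k hx).1)
  have hseq := DisjSeq.chi hE hEd
  -- thinning
  let a : ℕ → ℕ → ℝ := fun j k => ‖T (chi (E k)) (ι (n j))‖ + ‖chi (E k) (ι (n j))‖
  have ha : ∀ j k, 0 ≤ a j k := fun j k => by positivity
  let η : ℝ := min (ε' / 4) (1 / 2)
  have hη : 0 < η := by positivity
  obtain ⟨σ, hσ, hthin⟩ := thinning (C := ‖T‖ + 1) hη a ha (by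
    intro j s
    simp only [a, Finset.sum_add_distrib]
    refine add_le_add ((hseq.sum_le (row T (ι (n j))) s).trans (row_norm_le _ _)) ?_
    have := hseq.sum_le (row (ContinuousLinearMap.id ℂ _) (ι (n j))) s
    exact this.trans ((row_norm_le _ _).trans ContinuousLinearMap.norm_id_le))
  have hn : ∀ j k, ι (n (σ k)) ∉ E (σ j) := by
    intro j k hmem
    by_cases hjk : j = k
    · subst hjk; exact (hEA _ hmem).2 rfl
    · have h2 := hthin k {j} (by simpa using Ne.symm hjk)
      have h3 : chi (E (σ j)) (ι (n (σ k))) = 1 := chi_mem (hE _) hmem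
      simp only [Finset.sum_singleton, a, h3, norm_one] at h2
      have h4 : η ≤ 1 / 2 := min_le_right _ _
      have h5 := norm_nonneg (T (chi (E (σ j))) (ι (n (σ k))))
      linarith
  obtain ⟨𝒥, hJc, hJi, hJad, hJB⟩ := h.k3 (fun k => E (σ k)) (fun k => n (σ k)) (fun k => hE _)
    (fun j k hjk => hEd _ _ (hσ.ne hjk)) hn
  have hex : ∀ I : Set ℕ, ∃ B : Set K, I ∈ 𝒥 → IsClopen B ∧ ∀ m, ι m ∈ B ↔ ∃ k ∈ I, ι m ∈ E (σ k) := by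
    intro I
    by_cases hI : I ∈ 𝒥
    · obtain ⟨B, hB⟩ := (hJB I hI).1
      exact ⟨B, fun _ => hB⟩
    · exact ⟨∅, fun h => absurd h hI⟩
  choose B hB using hex
  have hcount : ∀ m, {I ∈ 𝒥 | row T (ι m) (chi (B I)) ≠
      ∑' j, I.indicator (fun j => row T (ι m) (chi (E (σ j)))) j}.Countable := fun m =>
    rho_countable h (row T (ι m)) (fun k => E (σ k)) (fun k => hE _)
      (fun j k hjk => hEd _ _ (hσ.ne hjk)) 𝒥 hJad B (fun I hI => (hB I hI).1)
      (fun I hI => (hB I hI).2)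
  obtain ⟨I, hI, hIr⟩ : ∃ I ∈ 𝒥, ∀ m, row T (ι m) (chi (B I)) =
      ∑' j, I.indicator (fun j => row T (ι m) (chi (E (σ j)))) j := by
    by_contra hcon
    push Not at hcon
    apply hJc
    refine (Set.countable_iUnion hcount).mono fun I hI => ?_
    obtain ⟨m, hm⟩ := hcon I hI
    exact Set.mem_iUnion.2 ⟨m, hI, hm⟩
  have hseq' := hseq.comp hσ
  have hsumm : ∀ x, Summable fun j => ‖T (chi (E (σ j))) x‖ := fun x =>
    summable_of_sum_le (fun _ => norm_nonneg _) (fun s => hseq'.sum_le (row T x) s)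
  have hη4 : η ≤ ε' / 4 := min_le_left _ _
  -- off-diagonal estimate
  have hoff : ∀ k, ‖T (chi (B I)) (ι (n (σ k))) -
      I.indicator (fun j => T (chi (E (σ j))) (ι (n (σ k)))) k‖ ≤ ε' / 4 := by
    intro k
    have e1 := hIr (n (σ k))
    simp only [row_apply] at e1
    have hsI : Summable (I.indicator fun j => T (chi (E (σ j))) (ι (n (σ k)))) :=
      (Summable.of_norm (hsumm _)).indicator I
    rw [e1, hsI.tsum_eq_add_tsum_ite k, add_sub_cancel_left]
    refine le_trans ?_ hη4
    have hle : ∀ j, ‖if j = k then (0 : ℂ) else I.indicator (fun j => T (chi (E (σ j))) (ι (n (σ k)))) j‖ ≤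
        if j = k then 0 else ‖T (chi (E (σ j))) (ι (n (σ k)))‖ := by
      intro j
      split_ifs
      · simp
      · exact norm_indicator_le_norm_self _ _
    have hb : ∀ s : Finset ℕ, ∑ j ∈ s, ‖if j = k then (0 : ℂ) else
        I.indicator (fun j => T (chi (E (σ j))) (ι (n (σ k)))) j‖ ≤ η := by
      intro s
      refine (Finset.sum_le_sum fun j _ => hle j).trans ?_
      refine le_trans ?_ (hthin k (s.erase k) (Finset.notMem_erase _ _))
      rw [Finset.sum_ite, Finset.sum_const_zero, zero_add, ← Finset.filter_ne']
      refine Finset.sum_le_sum fun j _ => ?_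
      simp only [a]
      linarith [norm_nonneg (chi (E (σ j)) (ι (n (σ k))))]
    have hs1 := summable_of_sum_le (fun j => norm_nonneg _) hb
    exact (norm_tsum_le_tsum_norm hs1).trans (hs1.tsum_le_of_sum_le hb)
  obtain ⟨D, hD, hD1, hD2⟩ := exists_clopen_sep (g := fun x => ‖T (chi (B I)) x‖) (by fun_prop)
    (show ε' / 4 < 3 * ε' / 4 by linarith)
  refine (hJB I hI).2 D hD ?_
  ext k
  have hk := hoff k
  simp only [Set.mem_ofPred_eq]
  constructor
  · intro hmem
    by_contra hkI
    rw [Set.indicator_of_notMem hkI, sub_zero] at hk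
    exact absurd (hD2 _ hmem) (not_lt.2 hk)
  · intro hkI
    apply hD1
    rw [Set.indicator_of_mem hkI] at hk
    have h2 := hTE (σ k)
    have h3 := norm_sub_norm_le (T (chi (E (σ k))) (ι (n (σ k)))) (T (chi (B I)) (ι (n (σ k))))
    rw [norm_sub_rev] at h3
    linarith

end stepB

section DDsec
variable {K : Type} [TopologicalSpace K] [CompactSpace K] [T2Space K] [TotallyDisconnectedSpace K]
  {ι : ℕ → K}

/-- `p` tends to zero along disjointly supported sequences -/
def DD (p : C(K, ℂ) → ℝ) : Prop :=
  ∀ A f, DisjSeq A f → ∀ ε > 0, ∀ᶠ k in atTop, p (f k) < ε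

lemma DD_of {p : C(K, ℂ) → ℝ}
    (h : ∀ A f, DisjSeq A f → ∀ ε > 0, (∀ k, ε ≤ p (f k)) → False) : DD p := by
  intro A f hf ε hε
  by_contra hcon
  obtain ⟨σ, hσ, hσ'⟩ := extraction_of_frequently_atTop (not_eventually.1 hcon)
  exact h _ _ (hf.comp hσ.injective) ε hε fun k => not_lt.1 (hσ' k)

lemma DD.mono {p q : C(K, ℂ) → ℝ} (hq : DD q) {C : ℝ} (hC : 0 ≤ C) (h : ∀ f, p f ≤ C * q f) :
    DD p := by
  intro A f hf ε hε
  filter_upwards [hq A f hf (ε / (C + 1)) (by positivity)] with k hk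
  have h1 := h (f k)
  rw [lt_div_iff₀ (by positivity)] at hk
  by_cases hqk : 0 ≤ q (f k) <;> nlinarith

lemma DD.add_le {p q r : C(K, ℂ) → ℝ} (hp : DD p) (hq : DD q) (h : ∀ f, r f ≤ p f + q f) :
    DD r := by
  intro A f hf ε hε
  filter_upwards [hp A f hf (ε / 2) (by positivity), hq A f hf (ε / 2) (by positivity)] with k h1 h2
  linarith [h (f k)]

/-- DD operators -/
def DDop (U : C(K, ℂ) →L[ℂ] C(K, ℂ)) : Prop := DD (fun f => ‖U f‖)

lemma DDop.add {U V : C(K, ℂ) →L[ℂ] C(K, ℂ)} (hU : DDop U) (hV : DDop V) : DDop (U + V) :=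
  DD.add_le hU hV fun f => norm_add_le _ _

lemma DDop.comp {U : C(K, ℂ) →L[ℂ] C(K, ℂ)} (hU : DDop U) (L : C(K, ℂ) →L[ℂ] C(K, ℂ)) :
    DDop (L.comp U) :=
  DD.mono hU (norm_nonneg L) fun f => L.le_opNorm _

lemma DDop.neg {U : C(K, ℂ) →L[ℂ] C(K, ℂ)} (hU : DDop U) : DDop (-U) :=
  DD.mono hU zero_le_one fun f => by simp

lemma DDop_zero : DDop (0 : C(K, ℂ) →L[ℂ] C(K, ℂ)) := by
  intro A f hf ε hε
  exact Eventually.of_forall fun _ => by simpa using hε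

lemma DD_functional (φ : C(K, ℂ) →L[ℂ] ℂ) : DD (fun f => ‖φ f‖) := by
  intro A f hf ε hε
  have hsum : Summable fun j => ‖φ (f j)‖ :=
    summable_of_sum_le (fun _ => norm_nonneg _) (fun s => hf.sum_le φ s)
  exact (tendsto_order.1 hsum.tendsto_atTop_zero).2 ε hε

lemma DDop_rank_one (φ : C(K, ℂ) →L[ℂ] ℂ) (v : C(K, ℂ)) : DDop (φ.smulRight v) :=
  DD.mono (DD_functional φ) (norm_nonneg v) fun f => by
    simp [norm_smul, mul_comm]

lemma DDop_sum {J : Type} (s : Finset J) (U : J → C(K, ℂ) →L[ℂ] C(K, ℂ)) (h : ∀ j ∈ s, DDop (U j)) :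
    DDop (∑ j ∈ s, U j) := by
  classical
  induction s using Finset.induction_on with
  | empty => simpa using DDop_zero
  | insert a s ha ih =>
    rw [Finset.sum_insert ha]
    exact (h a (Finset.mem_insert_self _ _)).add (ih fun j hj => h j (Finset.mem_insert_of_mem hj))

/-- multiplication by an indicator -/
noncomputable def mulP (A : Set K) : C(K, ℂ) →L[ℂ] C(K, ℂ) := ContinuousLinearMap.mul ℂ _ (chi A)

@[simp] lemma mulP_apply (A : Set K) (f : C(K, ℂ)) (x : K) : mulP A f x = chi A x * f x := rfl

lemma mulP_mem {A : Set K} (hA : IsClopen A) (f : C(K, ℂ)) {x : K} (hx : x ∈ A) :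
    mulP A f x = f x := by rw [mulP_apply, chi_mem hA hx, one_mul]

lemma mulP_notMem {A : Set K} (hA : IsClopen A) (f : C(K, ℂ)) {x : K} (hx : x ∉ A) :
    mulP A f x = 0 := by rw [mulP_apply, chi_notMem hA hx, zero_mul]

lemma mulP_norm_le (A : Set K) (f : C(K, ℂ)) : ‖mulP A f‖ ≤ ‖f‖ := by
  have : mulP A f = chi A * f := rfl
  rw [this]
  exact (norm_mul_le _ _).trans (mul_le_of_le_one_left (norm_nonneg _) (chi_norm_le A))

lemma mulP_self {A : Set K} (hA : IsClopen A) {f : C(K, ℂ)} (hf : ∀ x, x ∉ A → f x = 0) :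
    mulP A f = f := by
  ext x
  by_cases hx : x ∈ A
  · exact mulP_mem hA f hx
  · rw [mulP_notMem hA f hx, hf x hx]

section vv
variable {Y : Type*} [NormedAddCommGroup Y] [NormedSpace ℂ Y]

/-- variation -/
noncomputable def vr (φ : C(K, ℂ) →L[ℂ] Y) (A : Set K) : ℝ := ‖φ.comp (mulP A)‖

lemma vr_nonneg (φ : C(K, ℂ) →L[ℂ] Y) (A : Set K) : 0 ≤ vr φ A := norm_nonneg _

lemma vr_le (φ : C(K, ℂ) →L[ℂ] Y) {A : Set K} {c : ℝ} (hA : IsClopen A) (hc : 0 ≤ c)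
    (h : ∀ f : C(K, ℂ), (∀ x, x ∉ A → f x = 0) → ‖f‖ ≤ 1 → ‖φ f‖ ≤ c) : vr φ A ≤ c := by
  refine ContinuousLinearMap.opNorm_le_of_unit_norm (𝕜 := ℝ) (f := (φ.comp (mulP A)).restrictScalars ℝ) hc ?_
  intro f hf
  exact h _ (fun x hx => mulP_notMem hA f hx) ((mulP_norm_le A f).trans hf.le)

lemma le_vr (φ : C(K, ℂ) →L[ℂ] Y) {A : Set K} (hA : IsClopen A) {f : C(K, ℂ)}
    (hf : ∀ x, x ∉ A → f x = 0) (hn : ‖f‖ ≤ 1) : ‖φ f‖ ≤ vr φ A := by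
  have := (φ.comp (mulP A)).le_opNorm f
  rw [ContinuousLinearMap.comp_apply, mulP_self hA hf] at this
  exact this.trans (mul_le_of_le_one_right (norm_nonneg _) hn)

lemma vr_mono (φ : C(K, ℂ) →L[ℂ] Y) {A B : Set K} (hA : IsClopen A) (hB : IsClopen B)
    (hAB : A ⊆ B) : vr φ A ≤ vr φ B :=
  vr_le φ hA (vr_nonneg _ _) fun f hf hn => le_vr φ hB (fun x hx => hf x fun h => hx (hAB h)) hn

lemma vr_union (φ : C(K, ℂ) →L[ℂ] Y) {A B C : Set K} (hA : IsClopen A) (hB : IsClopen B)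
    (hC : IsClopen C) (h : A ⊆ B ∪ C) : vr φ A ≤ vr φ B + vr φ C := by
  refine vr_le φ hA (add_nonneg (vr_nonneg _ _) (vr_nonneg _ _)) fun f hf hn => ?_
  have e : f = mulP B f + (f - mulP B f) := by abel
  have h1 : ‖φ (mulP B f)‖ ≤ vr φ B :=
    le_vr φ hB (fun x hx => mulP_notMem hB f hx) ((mulP_norm_le _ _).trans hn)
  have h2 : ‖φ (f - mulP B f)‖ ≤ vr φ C := by
    refine le_vr φ hC (fun x hx => ?_) ?_
    · rw [ContinuousMap.sub_apply]
      by_cases hxB : x ∈ B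
      · rw [mulP_mem hB f hxB, sub_self]
      · rw [mulP_notMem hB f hxB, sub_zero]
        refine hf x fun hxA => ?_
        rcases h hxA with h | h
        exacts [hxB h, hx h]
    · rw [ContinuousMap.norm_le _ zero_le_one]
      intro x
      rw [ContinuousMap.sub_apply]
      by_cases hxB : x ∈ B
      · rw [mulP_mem hB f hxB, sub_self]; simp
      · rw [mulP_notMem hB f hxB, sub_zero]
        exact (f.norm_coe_le_norm x).trans hn
  calc ‖φ f‖ = ‖φ (mulP B f) + φ (f - mulP B f)‖ := by rw [← map_add, ← e]
    _ ≤ _ := (norm_add_le _ _).trans (add_le_add h1 h2)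

lemma vr_biUnion (φ : C(K, ℂ) →L[ℂ] Y) (s : Finset ℕ) (B : ℕ → Set K) (hB : ∀ j, IsClopen (B j))
    {A : Set K} (hA : IsClopen A) (h : A ⊆ ⋃ j ∈ s, B j) : vr φ A ≤ ∑ j ∈ s, vr φ (B j) := by
  classical
  induction s using Finset.induction_on generalizing A with
  | empty =>
    have : A = ∅ := by simpa using h
    simp only [Finset.sum_empty]
    refine vr_le φ hA le_rfl fun f hf _ => ?_
    have : f = 0 := by ext x; exact hf x (by simp [this])
    simp [this]
  | insert a s ha ih =>
    rw [Finset.sum_insert ha]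
    have h2 : IsClopen (⋃ j ∈ s, B j) := s.finite_toSet.isClopen_biUnion fun j _ => hB j
    refine (vr_union φ hA (hB a) h2 ?_).trans (add_le_add le_rfl (ih h2 subset_rfl))
    simpa [Set.biUnion_insert] using h

lemma exists_of_lt_vr (φ : C(K, ℂ) →L[ℂ] Y) {A : Set K} (hA : IsClopen A) {c : ℝ} (hc : 0 ≤ c)
    (h : c < vr φ A) : ∃ f : C(K, ℂ), (∀ x, x ∉ A → f x = 0) ∧ ‖f‖ ≤ 1 ∧ c < ‖φ f‖ := by
  by_contra hcon
  push Not at hcon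
  exact absurd (vr_le φ hA hc hcon) (not_le.2 h)

end vv

lemma DDop.exhaust {U : C(K, ℂ) →L[ℂ] C(K, ℂ)} (hU : DDop U) {A : ℕ → Set K}
    (hA : ∀ k, IsClopen (A k)) (hd : ∀ j k, j ≠ k → Disjoint (A j) (A k)) {ε : ℝ} (hε : 0 < ε) :
    ∃ k, vr U (A k) ≤ ε := by
  by_contra hcon
  push Not at hcon
  choose f hf1 hf2 hf3 using fun k => exists_of_lt_vr U (hA k) hε.le (hcon k)
  obtain ⟨k, hk⟩ := (hU A f ⟨hA, hd, hf1, hf2⟩ ε hε).exists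
  exact absurd hk (not_lt.2 (hf3 k).le)

/-- increasing sequences are almost stationary -/
lemma DDop.incr {U : C(K, ℂ) →L[ℂ] C(K, ℂ)} (hU : DDop U) {B : ℕ → Set K}
    (hB : ∀ k, IsClopen (B k)) (hm : Monotone B) {ε : ℝ} (hε : 0 < ε) :
    ∃ k, ∀ l, k ≤ l → vr U (B l \ B k) ≤ ε := by
  by_contra hcon
  push Not at hcon
  choose l hl hv using hcon
  let σ : ℕ → ℕ := fun i => l^[i] 0
  have hs : ∀ i, σ (i + 1) = l (σ i) := fun i => Function.iterate_succ_apply' l i 0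
  have hσ : Monotone σ := monotone_nat_of_le_succ fun i => by rw [hs]; exact hl _
  obtain ⟨k, hk⟩ := hU.exhaust (A := fun i => B (σ (i + 1)) \ B (σ i))
    (fun i => (hB _).diff (hB _)) (by
      have key : ∀ i j, i < j → Disjoint (B (σ (i + 1)) \ B (σ i)) (B (σ (j + 1)) \ B (σ j)) := by
        intro i j hij
        refine Set.disjoint_left.2 fun x hx hx' => hx'.2 (hm (hσ hij) hx.1)
      intro i j hij
      rcases lt_or_gt_of_ne hij with h | h
      exacts [key i j h, (key j i h).symm]) hε
  have := hv (σ k)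
  rw [← hs] at this
  linarith

lemma DDop.lemE {U : C(K, ℂ) →L[ℂ] C(K, ℂ)} (hU : DDop U) {A : ℕ → Set K}
    (hA : ∀ k, IsClopen (A k)) {ε : ℝ} (hε : 0 < ε) :
    ∃ (D : ℕ → Set K) (L : ℕ → ℕ), (∀ k, IsClopen (D k)) ∧ Antitone D ∧
      (∀ k, D k ⊆ ⋃ j ∈ Finset.Icc k (L k), A j) ∧ ∀ k, vr U (A k \ D k) ≤ ε := by
  have hB : ∀ i k, IsClopen (⋃ j ∈ Finset.Icc i k, A j) := fun i k =>
    (Finset.Icc i k).finite_toSet.isClopen_biUnion fun j _ => hA j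
  have hmono : ∀ i, Monotone fun k => ⋃ j ∈ Finset.Icc i k, A j := by
    intro i k l hkl
    exact Set.biUnion_subset_biUnion_left fun j hj => by
      simp only [Finset.coe_Icc, Finset.mem_Icc, Set.mem_ofPred_eq, Finset.mem_coe] at hj ⊢
      simp at hj ⊢
      exact ⟨hj.1, hj.2.trans hkl⟩
  choose L hL using fun i => hU.incr (hB i) (hmono i) (show 0 < ε / 2 * (1 / 2) ^ i by positivity)
  let C : ℕ → Set K := fun i => ⋃ j ∈ Finset.Icc i (L i), A j
  have hC : ∀ i, IsClopen (C i) := fun i => hB _ _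
  have hCA : ∀ i k, i ≤ k → vr U (A k \ C i) ≤ ε / 2 * (1 / 2) ^ i := by
    intro i k hik
    refine (vr_mono U ((hA k).diff (hC i)) ((hB i (max k (L i))).diff (hC i)) ?_).trans
      (hL i (max k (L i)) (le_max_right _ _))
    refine Set.sdiff_subset_sdiff_left ?_
    exact Set.subset_biUnion_of_mem (u := A) (by simp [hik])
  let D : ℕ → Set K := fun k => ⋂ i ∈ Finset.range (k + 1), C i
  have hD : ∀ k, IsClopen (D k) := fun k => (Finset.range (k+1)).finite_toSet.isClopen_biInter fun i _ => hC i
  refine ⟨D, L, hD, ?_, ?_, ?_⟩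
  · intro k l hkl
    refine Set.biInter_subset_biInter_left fun i hi => ?_
    simp at hi ⊢
    omega
  · intro k
    exact Set.biInter_subset_of_mem (t := C) (by simp)
  · intro k
    have h1 : A k \ D k ⊆ ⋃ i ∈ Finset.range (k + 1), A k \ C i := by
      rintro x ⟨hx, hxD⟩
      simp only [D, Set.mem_iInter, not_forall] at hxD
      obtain ⟨i, hi, hxi⟩ := hxD
      simp only [Set.mem_iUnion]
      exact ⟨i, hi, hx, hxi⟩
    refine (vr_biUnion U _ (fun i => A k \ C i) (fun i => (hA k).diff (hC i))
      ((hA k).diff (hD k)) h1).trans ?_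
    calc ∑ i ∈ Finset.range (k + 1), vr U (A k \ C i)
        ≤ ∑ i ∈ Finset.range (k + 1), ε / 2 * (1 / 2) ^ i :=
          Finset.sum_le_sum fun i hi => hCA i k (by simp at hi; omega)
      _ = ε / 2 * ∑ i ∈ Finset.range (k + 1), (1 / 2 : ℝ) ^ i := by rw [Finset.mul_sum]
      _ ≤ ε / 2 * 2 := by
          gcongr
          exact sum_geometric_two_le _
      _ = ε := by ring

/-- splitting off the large part of a function -/
lemma split_large (U : C(K, ℂ) →L[ℂ] C(K, ℂ)) (z : C(K, ℂ)) (hz : ‖z‖ ≤ 1) {t : ℝ} (ht : 0 < t)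
    {A : Set K} (hA : IsClopen A) (hzA : ∀ x, t ≤ ‖z x‖ → x ∈ A) : ‖U z‖ ≤ vr U A + ‖U‖ * t := by
  have e : z = mulP A z + (z - mulP A z) := by abel
  have h1 : ‖U (mulP A z)‖ ≤ vr U A :=
    le_vr U hA (fun x hx => mulP_notMem hA z hx) ((mulP_norm_le _ _).trans hz)
  have h2 : ‖z - mulP A z‖ ≤ t := by
    rw [ContinuousMap.norm_le _ ht.le]
    intro x
    rw [ContinuousMap.sub_apply]
    by_cases hx : x ∈ A
    · rw [mulP_mem hA z hx, sub_self, norm_zero]; exact ht.le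
    · rw [mulP_notMem hA z hx, sub_zero]
      by_contra hcon
      exact hx (hzA x (not_le.1 hcon).le)
  calc ‖U z‖ = ‖U (mulP A z) + U (z - mulP A z)‖ := by rw [← map_add, ← e]
    _ ≤ ‖U (mulP A z)‖ + ‖U (z - mulP A z)‖ := norm_add_le _ _
    _ ≤ _ := add_le_add h1 ((U.le_opNorm _).trans (by gcongr))

/-- (N) -/
lemma DDop.pointwise {U : C(K, ℂ) →L[ℂ] C(K, ℂ)} (hU : DDop U) {z : ℕ → C(K, ℂ)}
    (hz : ∀ k, ‖z k‖ ≤ 1) (hz0 : ∀ x, Tendsto (fun k => z k x) atTop (𝓝 0)) {ε : ℝ} (hε : 0 < ε) :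
    ∃ k, ‖U (z k)‖ < ε := by
  by_contra hcon
  push Not at hcon
  let t : ℝ := ε / (4 * (‖U‖ + 1))
  have ht : 0 < t := by positivity
  have hUt : ‖U‖ * t ≤ ε / 4 := by
    have : (‖U‖ + 1) * t = ε / 4 := by simp only [t]; field_simp
    nlinarith
  choose A hA hA1 hA2 using fun k => exists_clopen_sep (g := fun x => ‖z k x‖) (by fun_prop)
    (show t / 2 < t by linarith)
  obtain ⟨D, L, hD, hDm, hDA, hDv⟩ := hU.lemE hA (show 0 < ε / 4 by positivity)
  have hne : ∀ k, (D k).Nonempty := by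
    intro k
    by_contra hemp
    rw [Set.not_nonempty_iff_eq_empty] at hemp
    have h1 := hDv k
    rw [hemp, Set.sdiff_empty] at h1
    have h2 := split_large U (z k) (hz k) ht (hA k) (hA1 k)
    linarith [hcon k]
  obtain ⟨x, hx⟩ := IsCompact.nonempty_iInter_of_sequence_nonempty_isCompact_isClosed D
    (fun k => hDm (Nat.le_succ k)) hne (hD 0).isClosed.isCompact (fun k => (hD k).isClosed)
  have h1 := (hz0 x).norm
  rw [norm_zero] at h1
  obtain ⟨N, hN⟩ := eventually_atTop.1 ((tendsto_order.1 h1).2 (t / 2) (by linarith))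
  have h2 := hDA N (Set.mem_iInter.1 hx N)
  simp only [Set.mem_iUnion, Finset.mem_Icc] at h2
  obtain ⟨j, hj, hxj⟩ := h2
  exact absurd (hN j hj.1) (not_lt.2 (hA2 j x hxj).le)

lemma HKSpace.norm_le (h : HKSpace K ι) {f : C(K, ℂ)} {c : ℝ} (hf : ∀ m, ‖f (ι m)‖ ≤ c) :
    ‖f‖ ≤ c := by
  have hc : 0 ≤ c := (norm_nonneg _).trans (hf 0)
  rw [ContinuousMap.norm_le _ hc]
  intro x
  have hcl : IsClosed {x : K | ‖f x‖ ≤ c} := isClosed_le (by fun_prop) continuous_const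
  exact (hcl.closure_subset_iff.2 (by rintro _ ⟨m, rfl⟩; exact hf m)) (h.dense x)

/-- (UAC) -/
lemma DDop.uac (h : HKSpace K ι) {U : C(K, ℂ) →L[ℂ] C(K, ℂ)} (hU : DDop U) {ε : ℝ} (hε : 0 < ε) :
    ∃ (F : Finset ℕ) (δ : ℝ), 0 < δ ∧ ∀ A : Set K, IsClopen A →
      (∀ n ∈ F, vr (row U (ι n)) A ≤ δ) → vr U A ≤ ε := by
  classical
  by_contra hcon
  push Not at hcon
  have hrow : ∀ n A, IsClopen A → vr (row U (ι n)) A ≤ vr U A := fun n A hA =>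
    vr_le _ hA (vr_nonneg _ _) fun f hf hn =>
      ((U f).norm_coe_le_norm _).trans (le_vr U hA hf hn)
  have hex : ∀ (F : Finset ℕ) (δ : ℝ), 0 < δ → ∃ A n, IsClopen A ∧
      (∀ n ∈ F, vr (row U (ι n)) A ≤ δ) ∧ ε < vr (row U (ι n)) A := by
    intro F δ hδ
    obtain ⟨A, hA, h1, h2⟩ := hcon F δ hδ
    obtain ⟨f, hf, hn, hf'⟩ := exists_of_lt_vr U hA hε.le h2
    obtain ⟨n, hn'⟩ : ∃ n, ε < ‖U f (ι n)‖ := by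
      by_contra hc
      push Not at hc
      exact absurd (h.norm_le hc) (not_le.2 hf')
    exact ⟨A, n, hA, h1, hn'.trans_le (le_vr (row U (ι n)) hA hf hn)⟩
  obtain ⟨S, hS1, hS2⟩ := exists_seq_of_forall_finset_exists
    (α := Set K × ℕ × ℝ) (fun x => IsClopen x.1 ∧ ε < vr (row U (ι x.2.1)) x.1 ∧ 0 < x.2.2 ∧ x.2.2 ≤ 1)
    (fun x y => vr (row U (ι x.2.1)) y.1 ≤ y.2.2 ∧ y.2.2 ≤ 1 / 2 * x.2.2) (by
      intro s hs
      obtain ⟨δ, hδ, hδ1, hδs⟩ : ∃ δ : ℝ, 0 < δ ∧ δ ≤ 1 ∧ ∀ x ∈ s, δ ≤ 1 / 2 * x.2.2 := by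
        clear hcon hex
        induction s using Finset.induction_on with
        | empty => exact ⟨1, one_pos, le_rfl, by simp⟩
        | insert a s ha ih =>
          obtain ⟨δ, h1, h2, h3⟩ := ih fun x hx => hs x (Finset.mem_insert_of_mem hx)
          have ha' := (hs a (Finset.mem_insert_self _ _)).2.2.1
          refine ⟨min δ (1 / 2 * a.2.2), by positivity, (min_le_left _ _).trans h2, fun x hx => ?_⟩
          rcases Finset.mem_insert.1 hx with rfl | hx
          · exact min_le_right _ _
          · exact (min_le_left _ _).trans (h3 x hx)
      obtain ⟨A, n, hA, h1, h2⟩ := hex (s.image fun x => x.2.1) δ hδ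
      refine ⟨(A, n, δ), ⟨hA, h2, hδ, hδ1⟩, fun x hx => ⟨h1 _ (Finset.mem_image_of_mem _ hx), hδs x hx⟩⟩)
  let A : ℕ → Set K := fun k => (S k).1
  let n : ℕ → ℕ := fun k => (S k).2.1
  let d : ℕ → ℝ := fun k => (S k).2.2
  have hA : ∀ k, IsClopen (A k) := fun k => (hS1 k).1
  have hd0 : ∀ k, 0 < d k := fun k => (hS1 k).2.2.1
  have hd : ∀ k, d k ≤ (1 / 2) ^ k := by
    intro k
    induction k with
    | zero => simpa using (hS1 0).2.2.2
    | succ k ih =>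
      have := (hS2 k (k + 1) (Nat.lt_succ_self k)).2
      calc d (k + 1) ≤ 1 / 2 * d k := this
        _ ≤ 1 / 2 * (1 / 2) ^ k := by gcongr
        _ = (1 / 2) ^ (k + 1) := by ring
  obtain ⟨D, L, hD, hDm, hDA, hDv⟩ := hU.lemE hA (show 0 < ε / 4 by positivity)
  have hlow : ∀ k, 3 * ε / 4 ≤ vr (row U (ι (n k))) (D k) := by
    intro k
    have h1 := vr_union (row U (ι (n k))) (hA k) (hD k) ((hA k).diff (hD k))
      (fun x hx => by
        by_cases hxD : x ∈ D k
        exacts [Or.inl hxD, Or.inr ⟨hx, hxD⟩])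
    have h2 := hrow (n k) _ ((hA k).diff (hD k))
    have h3 := (hS1 k).2.1
    have h4 := hDv k
    simp only [A, n] at *
    linarith
  have hsum : Summable fun j : ℕ => (1 / 2 : ℝ) ^ j := summable_geometric_two
  have hup : ∀ i l, i < l → vr (row U (ι (n i))) (D l) ≤ 2 * (1 / 2) ^ l := by
    intro i l hil
    refine (vr_biUnion _ _ A hA (hD l) (hDA l)).trans ?_
    calc ∑ j ∈ Finset.Icc l (L l), vr (row U (ι (n i))) (A j)
        ≤ ∑ j ∈ Finset.Icc l (L l), (1 / 2 : ℝ) ^ j := by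
          refine Finset.sum_le_sum fun j hj => ?_
          exact (hS2 i j (hil.trans_le (Finset.mem_Icc.1 hj).1)).1.trans (hd j)
      _ ≤ ∑ j ∈ Finset.range (L l + 1), (1 / 2 : ℝ) ^ l * (1 / 2) ^ j := by
          rw [← Finset.sum_image (f := fun j => (1 / 2 : ℝ) ^ j) (g := fun j => l + j)
            (s := Finset.range (L l + 1)) (fun a _ b _ hab => by simpa using hab) |>.trans
            (Finset.sum_congr rfl fun j _ => pow_add _ _ _)]
          refine Finset.sum_le_sum_of_subset_of_nonneg ?_ (fun _ _ _ => by positivity)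
          intro j hj
          rw [Finset.mem_Icc] at hj
          exact Finset.mem_image.2 ⟨j - l, by simp; omega, by omega⟩
      _ = (1 / 2 : ℝ) ^ l * ∑ j ∈ Finset.range (L l + 1), (1 / 2) ^ j := by rw [Finset.mul_sum]
      _ ≤ (1 / 2 : ℝ) ^ l * 2 := by gcongr; exact sum_geometric_two_le _
      _ = _ := mul_comm _ _
  obtain ⟨N, hN⟩ := exists_pow_lt_of_lt_one (show 0 < ε / 8 by positivity) (show (1 / 2 : ℝ) < 1 by norm_num)
  let σ : ℕ → ℕ := fun i => N + i
  have hσ : Monotone σ := fun i j hij => by simp [σ, hij]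
  obtain ⟨k, hk⟩ := hU.exhaust (A := fun i => D (σ i) \ D (σ (i + 1)))
    (fun i => (hD _).diff (hD _)) (by
      have key : ∀ i j, i < j → Disjoint (D (σ i) \ D (σ (i + 1))) (D (σ j) \ D (σ (j + 1))) := by
        intro i j hij
        refine Set.disjoint_left.2 fun x hx hx' => hx.2 (hDm (hσ hij) hx'.1)
      intro i j hij
      rcases lt_or_gt_of_ne hij with h | h
      exacts [key i j h, (key j i h).symm]) (show 0 < ε / 4 by positivity)
  have h1 := vr_union (row U (ι (n (σ k)))) (hD (σ k)) (hD (σ (k + 1))) ((hD (σ k)).diff (hD (σ (k + 1))))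
      (fun x hx => by
        by_cases hxD : x ∈ D (σ (k + 1))
        exacts [Or.inl hxD, Or.inr ⟨hx, hxD⟩])
  have h2 := hlow (σ k)
  have h3 := hup (σ k) (σ (k + 1)) (by simp [σ])
  have h4 := hrow (n (σ k)) _ ((hD (σ k)).diff (hD (σ (k + 1))))
  have h5 : (1 / 2 : ℝ) ^ (σ (k + 1)) ≤ (1 / 2) ^ N :=
    pow_le_pow_of_le_one (by norm_num) (by norm_num) (by simp [σ])
  have h6 : (0 : ℝ) < (1 / 2) ^ N := by positivity
  linarith

end DDsec

section MazurSec
variable {K : Type} [TopologicalSpace K] [CompactSpace K] [T2Space K] [TotallyDisconnectedSpace K]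
  {ι : ℕ → K}

lemma exists_rot (z : ℂ) : ∃ c : ℂ, ‖c‖ = 1 ∧ c * z = (‖z‖ : ℂ) := by
  by_cases hz : z = 0
  · exact ⟨1, by simp, by simp [hz]⟩
  · have hn : (‖z‖ : ℂ) ≠ 0 := by simpa using hz
    refine ⟨‖z‖ / z, ?_, by field_simp⟩
    rw [norm_div, Complex.norm_real, norm_norm, div_self (by simpa using hz)]

lemma lemP (φ : C(K, ℂ) →L[ℂ] ℂ) {τ : ℝ} (hτ : 0 < τ) : ∃ h : C(K, ℂ), ‖h‖ ≤ 1 ∧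
    ∀ (r : K → ℝ) (u k : C(K, ℂ)), (∀ x, u x = (r x : ℂ)) → (∀ x, r x ≤ 1) → (∀ x, ‖k x‖ ≤ r x) →
      ‖φ k‖ ≤ (φ (h * u)).re + τ := by
  obtain ⟨h0, hh0, hφ⟩ := φ.exists_lt_apply_of_lt_opNorm (show ‖φ‖ - τ < ‖φ‖ by linarith)
  obtain ⟨c, hc, hc'⟩ := exists_rot (φ h0)
  have hh : ‖c • h0‖ ≤ 1 := by rw [norm_smul, hc, one_mul]; exact hh0.le
  refine ⟨c • h0, hh, fun r u k hu hr hk => ?_⟩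
  obtain ⟨d, hd, hd'⟩ := exists_rot (φ k)
  have h1 : ‖c • h0 - (c • h0) * u + d • k‖ ≤ 1 := by
    rw [ContinuousMap.norm_le _ zero_le_one]
    intro x
    have e : (c • h0 - (c • h0) * u + d • k) x = (c • h0) x * ((1 - r x : ℝ) : ℂ) + d * k x := by
      simp [hu x]; ring
    rw [e]
    have hx := ((c • h0).norm_coe_le_norm x).trans hh
    refine (norm_add_le _ _).trans ?_
    rw [norm_mul, norm_mul, hd, one_mul, Complex.norm_real, Real.norm_of_nonneg (by linarith [hr x])]
    nlinarith [hk x, hr x]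
  have h2 : (φ (c • h0 - (c • h0) * u + d • k)).re ≤ ‖φ‖ :=
    (Complex.re_le_norm _).trans ((φ.le_opNorm _).trans (mul_le_of_le_one_right (norm_nonneg _) h1))
  have h3 : (φ (c • h0)).re = ‖φ h0‖ := by
    rw [map_smul, smul_eq_mul, hc', Complex.ofReal_re]
  have h4 : (φ (d • k)).re = ‖φ k‖ := by
    rw [map_smul, smul_eq_mul, hd', Complex.ofReal_re]
  rw [map_add, map_sub, Complex.add_re, Complex.sub_re, h3, h4] at h2
  linarith

lemma convex_norm_le (U : C(K, ℂ) →L[ℂ] C(K, ℂ)) (x : K) (c : ℝ) :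
    Convex ℝ {f : C(K, ℂ) | ‖U f x‖ ≤ c} := by
  have := (convex_closedBall (0 : ℂ) c).linear_preimage ((row U x).restrictScalars ℝ).toLinearMap
  have e : {f : C(K, ℂ) | ‖U f x‖ ≤ c} =
      ((row U x).restrictScalars ℝ).toLinearMap ⁻¹' Metric.closedBall (0 : ℂ) c := by
    ext f
    simp
  rw [e]
  exact this

lemma mazur (h : HKSpace K ι) {U : C(K, ℂ) →L[ℂ] C(K, ℂ)} (hU : DDop U) {z : ℕ → C(K, ℂ)}
    (hz : ∀ k, ‖z k‖ ≤ 1) (hz0 : ∀ n, Tendsto (fun k => U (z k) (ι n)) atTop (𝓝 0)) {ε : ℝ}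
    (hε : 0 < ε) : ∃ w ∈ convexHull ℝ (Set.range z), ‖U w‖ ≤ ε := by
  obtain ⟨F, δ, hδ, hF⟩ := hU.uac h (show 0 < ε / 8 by positivity)
  let t : ℝ := ε / (8 * (‖U‖ + 1))
  have ht : 0 < t := by positivity
  have hUt : ‖U‖ * t ≤ ε / 8 := by
    have : (‖U‖ + 1) * t = ε / 8 := by simp only [t]; field_simp
    nlinarith
  let τ : ℝ := δ * t ^ 2 / (4 * (2 + F.card))
  have hτ : 0 < τ := by positivity
  have hτδ : (2 + F.card) * τ = t ^ 2 / 4 * δ := by simp only [τ]; field_simp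
  choose g hg hgP using fun n => lemP (row U (ι n)) hτ
  let q : ℕ → C(K, ℂ) → ℝ := fun n f => (row U (ι n) (g n * (f * star f))).re
  let Q : C(K, ℂ) → ℝ := fun f => ∑ n ∈ F, q n f
  have hqp : ∀ n f f', q n (f + f') + q n (f - f') = 2 * q n f + 2 * q n f' := by
    intro n f f'
    simp only [q]
    rw [← Complex.add_re, ← map_add]
    have : g n * ((f + f') * star (f + f')) + g n * ((f - f') * star (f - f'))
      = (2 : ℂ) • (g n * (f * star f)) + (2 : ℂ) • (g n * (f' * star f')) := by
      rw [star_add, star_sub, two_smul, two_smul]; ring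
    rw [this, map_add, map_smul, map_smul, Complex.add_re]
    simp
  have hqh : ∀ n f, q n ((2⁻¹ : ℂ) • f) = 1 / 4 * q n f := by
    intro n f
    simp only [q]
    have : g n * ((2⁻¹ : ℂ) • f * star ((2⁻¹ : ℂ) • f)) = ((1 / 4 : ℝ) : ℂ) • (g n * (f * star f)) := by
      ext x
      simp
      ring
    rw [this, map_smul, smul_eq_mul, Complex.re_ofReal_mul]
  have hQ : ∀ f f', Q ((2⁻¹ : ℂ) • (f - f')) = (Q f + Q f') / 2 - Q ((2⁻¹ : ℂ) • (f + f')) := by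
    intro f f'
    simp only [Q]
    rw [eq_sub_iff_add_eq, ← Finset.sum_add_distrib, ← Finset.sum_add_distrib, Finset.sum_div]
    refine Finset.sum_congr rfl fun n _ => ?_
    rw [hqh, hqh]
    linarith [hqp n f f']
  have hqb : ∀ n f, ‖f‖ ≤ 1 → |q n f| ≤ ‖row U (ι n)‖ := by
    intro n f hf
    refine (Complex.abs_re_le_norm _).trans (((row U (ι n)).le_opNorm _).trans
      (mul_le_of_le_one_right (norm_nonneg _) ?_))
    refine (norm_mul_le _ _).trans (mul_le_one₀ (hg n) (norm_nonneg _) ?_)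
    refine (norm_mul_le _ _).trans (mul_le_one₀ hf (norm_nonneg _) ?_)
    rwa [norm_star]
  let M : ℝ := ∑ n ∈ F, ‖row U (ι n)‖
  have hQb : ∀ f, ‖f‖ ≤ 1 → |Q f| ≤ M := fun f hf =>
    (Finset.abs_sum_le_sum_abs _ _).trans (Finset.sum_le_sum fun n _ => hqb n f hf)
  let C : ℕ → Set C(K, ℂ) := fun m => convexHull ℝ (z '' Set.Ici m)
  have hCm : ∀ m m', m ≤ m' → C m' ⊆ C m := fun m m' hm =>
    convexHull_mono (Set.image_mono (Set.Ici_subset_Ici.2 hm))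
  have hCb : ∀ m, ∀ w ∈ C m, ‖w‖ ≤ 1 := by
    intro m w hw
    have : C m ⊆ Metric.closedBall 0 1 := convexHull_min (by
      rintro _ ⟨i, _, rfl⟩
      simpa using hz i) (convex_closedBall _ _)
    simpa using this hw
  have hzC : ∀ m, z m ∈ C m := fun m => subset_convexHull _ _ ⟨m, Set.mem_Ici.2 le_rfl, rfl⟩
  let S : Set ℝ := {c | ∃ m, ∀ w ∈ C m, c ≤ Q w}
  have hSne : S.Nonempty := ⟨-M, 0, fun w hw => (abs_le.1 (hQb w (hCb 0 w hw))).1⟩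
  have hSb : BddAbove S := ⟨M, by
    rintro c ⟨m, hm⟩
    exact (hm _ (hzC m)).trans (abs_le.1 (hQb _ (hz m))).2⟩
  let d := sSup S
  obtain ⟨m, hm⟩ : ∃ m, ∀ w ∈ C m, d - τ ≤ Q w := by
    obtain ⟨c, ⟨m, hm⟩, hc⟩ := exists_lt_of_lt_csSup hSne (show d - τ < sSup S by simp only [d]; linarith)
    exact ⟨m, fun w hw => hc.le.trans (hm w hw)⟩
  have hm' : ∀ m', ∃ w' ∈ C m', Q w' < d + τ := by
    intro m'
    by_contra hcon
    push Not at hcon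
    have := le_csSup hSb (show d + τ ∈ S from ⟨m', hcon⟩)
    simp only [d] at this
    linarith
  have key : ∀ m', m ≤ m' → ∀ w ∈ C m, ∀ w' ∈ C m', Q w < d + τ → Q w' < d + τ → ‖U (w - w')‖ ≤ ε / 2 := by
    intro m' hmm w hw w' hw' hQw hQw'
    have hw'm := hCm m m' hmm hw'
    let y : C(K, ℂ) := (2⁻¹ : ℂ) • (w - w')
    have hmid : (2⁻¹ : ℂ) • (w + w') ∈ C m := by
      have := (convex_convexHull ℝ (z '' Set.Ici m)) hw hw'm (show (0:ℝ) ≤ 1/2 by norm_num)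
        (show (0:ℝ) ≤ 1/2 by norm_num) (by norm_num)
      convert this using 1
      ext x
      simp
    have hQy : Q y ≤ 2 * τ := by
      simp only [y]
      rw [hQ]
      linarith [hm _ hmid]
    have hy : ‖y‖ ≤ 1 := by
      simp only [y]
      rw [norm_smul]
      have := norm_sub_le w w'
      have h1 := hCb m w hw
      have h2 := hCb m w' hw'm
      norm_num
      linarith
    have hyx : ∀ x, ‖y x‖ ≤ 1 := fun x => (y.norm_coe_le_norm x).trans hy
    have hP : ∀ n (k : C(K, ℂ)), (∀ x, ‖k x‖ ≤ ‖y x‖ ^ 2) → ‖row U (ι n) k‖ ≤ q n y + τ := by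
      intro n k hk
      refine hgP n (fun x => ‖y x‖ ^ 2) (y * star y) k (fun x => ?_) (fun x => ?_) hk
      · simp only [ContinuousMap.mul_apply, ContinuousMap.star_apply]
        rw [Complex.star_def, Complex.mul_conj, Complex.normSq_eq_norm_sq]
      · have := hyx x
        have := norm_nonneg (y x)
        nlinarith
    have hq0 : ∀ n, 0 ≤ q n y + τ := fun n => (norm_nonneg _).trans (hP n 0 fun x => by
      simp only [ContinuousMap.zero_apply, norm_zero]; positivity)
    have hq1 : ∀ n ∈ F, q n y + τ ≤ (2 + F.card) * τ := by
      intro n hn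
      have h1 := Finset.single_le_sum (f := fun n => q n y + τ) (fun n _ => hq0 n) hn
      rw [Finset.sum_add_distrib] at h1
      simp only [Finset.sum_const, nsmul_eq_mul] at h1
      have : Q y = ∑ n ∈ F, q n y := rfl
      rw [← this] at h1
      linarith
    obtain ⟨A, hA, hA1, hA2⟩ := exists_clopen_sep (g := fun x => ‖y x‖) (by fun_prop)
      (show t / 2 < t by linarith)
    have hv : vr U A ≤ ε / 8 := by
      refine hF A hA fun n hn => vr_le _ hA hδ.le fun f hf hfn => ?_
      have h1 := hP n (((t ^ 2 / 4 : ℝ) : ℂ) • f) (by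
        intro x
        by_cases hx : x ∈ A
        · have h1 := hA2 x hx
          have h2 := (f.norm_coe_le_norm x).trans hfn
          rw [ContinuousMap.smul_apply, norm_smul, Complex.norm_real, Real.norm_of_nonneg (by positivity)]
          have h3 : (t / 2) ^ 2 ≤ ‖y x‖ ^ 2 := by gcongr
          have h4 : t ^ 2 / 4 * ‖f x‖ ≤ t ^ 2 / 4 * 1 := by gcongr
          linarith
        · rw [ContinuousMap.smul_apply, hf x hx, smul_zero, norm_zero]; positivity)
      rw [map_smul, norm_smul, Complex.norm_real, Real.norm_of_nonneg (by positivity)] at h1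
      have h2 := h1.trans (hq1 n hn)
      rw [hτδ] at h2
      exact le_of_mul_le_mul_left h2 (by positivity)
    have h1 := split_large U y hy ht hA hA1
    have h2 : U (w - w') = (2 : ℂ) • U y := by
      rw [← map_smul]
      simp only [y]
      rw [smul_smul]
      norm_num
    rw [h2, norm_smul]
    norm_num
    linarith
  obtain ⟨w, hw, hwQ⟩ := hm' m
  refine ⟨w, convexHull_mono (Set.image_subset_range _ _) hw, h.norm_le fun n => ?_⟩
  have h1 := (hz0 n).norm
  rw [norm_zero] at h1
  obtain ⟨N, hN⟩ := eventually_atTop.1 ((tendsto_order.1 h1).2 (ε / 2) (by positivity))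
  obtain ⟨w', hw', hwQ'⟩ := hm' (max m N)
  have h2 := key _ (le_max_left _ _) w hw w' hw' hwQ hwQ'
  have h3 : ‖U w' (ι n)‖ ≤ ε / 2 := by
    have : C (max m N) ⊆ {f : C(K, ℂ) | ‖U f (ι n)‖ ≤ ε / 2} := convexHull_min (by
      rintro _ ⟨i, hi, rfl⟩
      exact (hN i ((le_max_right _ _).trans hi)).le) (convex_norm_le U (ι n) (ε / 2))
    exact this hw'
  have h4 : U w (ι n) = U (w - w') (ι n) + U w' (ι n) := by
    rw [map_sub, ContinuousMap.sub_apply]; ring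
  rw [h4]
  refine (norm_add_le _ _).trans ?_
  linarith [(U (w - w')).norm_coe_le_norm (ι n)]

lemma DDop.separable (h : HKSpace K ι) {U : C(K, ℂ) →L[ℂ] C(K, ℂ)} (hU : DDop U) :
    TopologicalSpace.IsSeparable (Set.range U) := by
  let Φ : C(K, ℂ) → (ℕ → ℂ) := fun f n => U f (ι n)
  let S : Set (ℕ → ℂ) := Φ '' Metric.closedBall 0 1
  obtain ⟨t, htc, htd⟩ := TopologicalSpace.exists_countable_dense S
  have hch : ∀ s : S, ∃ f : C(K, ℂ), ‖f‖ ≤ 1 ∧ Φ f = s := by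
    rintro ⟨_, f, hf, rfl⟩
    exact ⟨f, by simpa using hf, rfl⟩
  choose c hc1 hc2 using hch
  let V : Submodule ℂ C(K, ℂ) := Submodule.span ℂ (U '' (c '' t))
  have hV : TopologicalSpace.IsSeparable (V : Set C(K, ℂ)) :=
    ((htc.image c).image U).isSeparable.span
  have hball : ∀ f : C(K, ℂ), ‖f‖ ≤ 1 → U f ∈ closure (V : Set C(K, ℂ)) := by
    intro f hf
    let s : S := ⟨Φ f, f, by simpa using hf, rfl⟩
    obtain ⟨x, hx, hxs⟩ := mem_closure_iff_seq_limit.1 (htd s)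
    rw [Metric.mem_closure_iff]
    intro ε hε
    obtain ⟨w, hw, hwε⟩ := mazur h hU (z := fun k => (2⁻¹ : ℂ) • (f - c (x k))) (fun k => by
        rw [norm_smul]
        have := norm_sub_le f (c (x k))
        have := hc1 (x k)
        norm_num
        linarith) (fun n => by
        have h1 : Tendsto (fun k => ((x k : ℕ → ℂ)) n) atTop (𝓝 (Φ f n)) :=
          ((continuous_apply n).tendsto _).comp ((continuous_subtype_val.tendsto s).comp hxs)
        have h2 := (h1.const_sub (Φ f n)).const_mul (2⁻¹ : ℂ)
        rw [sub_self, mul_zero] at h2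
        refine h2.congr fun k => ?_
        rw [← hc2 (x k)]
        simp [Φ]) (show 0 < ε / 4 by positivity)
    have hmem : U f - (2 : ℂ) • U w ∈ V := by
      have : convexHull ℝ (Set.range fun k => (2⁻¹ : ℂ) • (f - c (x k))) ⊆
          {w | U f - (2 : ℂ) • U w ∈ V} := by
        refine convexHull_min ?_ ?_
        · rintro _ ⟨k, rfl⟩
          have : U f - (2 : ℂ) • U ((2⁻¹ : ℂ) • (f - c (x k))) = U (c (x k)) := by
            rw [map_smul, smul_smul, map_sub]; norm_num
          simp only [Set.mem_ofPred_eq]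
          rw [this]
          exact Submodule.subset_span ⟨_, ⟨_, hx k, rfl⟩, rfl⟩
        · intro w1 h1 w2 h2 a b ha hb hab
          simp only [Set.mem_ofPred_eq] at h1 h2 ⊢
          have hab' : (a : ℂ) + b = 1 := by exact_mod_cast hab
          have : U f - (2 : ℂ) • U (a • w1 + b • w2)
              = (a : ℂ) • (U f - (2 : ℂ) • U w1) + (b : ℂ) • (U f - (2 : ℂ) • U w2) := by
            have e : a • w1 + b • w2 = (a : ℂ) • w1 + (b : ℂ) • w2 := rfl
            rw [e, map_add, map_smul, map_smul]
            have e2 : U f = (a : ℂ) • U f + (b : ℂ) • U f := by rw [← add_smul, hab', one_smul]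
            nth_rewrite 1 [e2]
            module
          rw [this]
          exact V.add_mem (V.smul_mem _ h1) (V.smul_mem _ h2)
      exact this hw
    refine ⟨_, hmem, ?_⟩
    rw [dist_eq_norm, sub_sub_cancel, norm_smul]
    norm_num
    linarith
  refine hV.closure.mono ?_
  rintro _ ⟨f, rfl⟩
  have h1 := hball (((‖f‖ + 1 : ℝ) : ℂ)⁻¹ • f) (by
    rw [norm_smul, norm_inv, Complex.norm_real, Real.norm_of_nonneg (by positivity), inv_mul_le_one₀ (by positivity)]
    linarith)
  have h2 : U f = ((‖f‖ + 1 : ℝ) : ℂ) • U (((‖f‖ + 1 : ℝ) : ℂ)⁻¹ • f) := by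
    rw [map_smul, smul_smul, mul_inv_cancel₀, one_smul]
    exact_mod_cast (show (‖f‖ + 1 : ℝ) ≠ 0 by positivity)
  rw [h2, ← Submodule.topologicalClosure_coe] at *
  exact V.topologicalClosure.smul_mem _ h1

lemma DDop.sq_compact (h : HKSpace K ι) {R : C(K, ℂ) →L[ℂ] C(K, ℂ)} (hR : DDop R)
    {f : ℕ → C(K, ℂ)} (hf : ∀ k, ‖f k‖ ≤ 1) :
    ∃ σ : ℕ → ℕ, StrictMono σ ∧ CauchySeq fun k => R (R (f (σ k))) := by
  have hcomp : IsCompact (Set.univ.pi fun _ : ℕ => Metric.closedBall (0 : ℂ) ‖R‖) :=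
    isCompact_univ_pi fun _ => isCompact_closedBall _ _
  obtain ⟨l, _, σ, hσ, hl⟩ := hcomp.tendsto_subseq (x := fun k n => R (f k) (ι n)) (fun k n _ => by
    rw [mem_closedBall_zero_iff]
    exact ((R (f k)).norm_coe_le_norm _).trans
      ((R.le_opNorm _).trans (mul_le_of_le_one_right (norm_nonneg _) (hf k))))
  refine ⟨σ, hσ, ?_⟩
  by_contra hcon
  rw [Metric.cauchySeq_iff] at hcon
  push Not at hcon
  obtain ⟨ε, hε, hcon⟩ := hcon
  choose p hp q hq hpq using hcon
  let z : ℕ → C(K, ℂ) := fun N => (2⁻¹ : ℂ) • (f (σ (p N)) - f (σ (q N)))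
  have hz : ∀ N, ‖z N‖ ≤ 1 := fun N => by
    simp only [z]
    rw [norm_smul]
    have := norm_sub_le (f (σ (p N))) (f (σ (q N)))
    have := hf (σ (p N))
    have := hf (σ (q N))
    norm_num
    linarith
  have hz0 : ∀ n, Tendsto (fun k => R (z k) (ι n)) atTop (𝓝 0) := by
    intro n
    have h1 : Tendsto (fun k => R (f (σ k)) (ι n)) atTop (𝓝 (l n)) :=
      ((continuous_apply n).tendsto _).comp hl
    have hp' : Tendsto p atTop atTop := tendsto_atTop_mono hp tendsto_id
    have hq' : Tendsto q atTop atTop := tendsto_atTop_mono hq tendsto_id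
    have h2 := ((h1.comp hp').sub (h1.comp hq')).const_mul (2⁻¹ : ℂ)
    rw [sub_self, mul_zero] at h2
    refine h2.congr fun k => ?_
    simp [z]
  have hzx : ∀ x, Tendsto (fun k => R (z k) x) atTop (𝓝 0) := by
    intro x
    by_contra hc
    rw [Metric.tendsto_nhds] at hc
    push Not at hc
    obtain ⟨ε1, hε1, hc⟩ := hc
    obtain ⟨s, hs, hs'⟩ := extraction_of_frequently_atTop hc
    choose c hc1 hc2 using fun k => exists_rot (R (z (s k)) x)
    obtain ⟨w, hw, hwε⟩ := mazur h hR (z := fun k => c k • z (s k)) (fun k => by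
        rw [norm_smul, hc1, one_mul]; exact hz _) (fun n => by
        rw [tendsto_zero_iff_norm_tendsto_zero]
        have := ((hz0 n).comp hs.tendsto_atTop).norm
        rw [norm_zero] at this
        refine this.congr fun k => ?_
        simp [hc1]) (show 0 < ε1 / 2 by positivity)
    have : convexHull ℝ (Set.range fun k => c k • z (s k)) ⊆ {f | ε1 ≤ (R f x).re} := by
      refine convexHull_min ?_ ?_
      · rintro _ ⟨k, rfl⟩
        have := hs' k
        rw [dist_zero_right] at this
        simp only [Set.mem_ofPred_eq, map_smul, ContinuousMap.smul_apply, smul_eq_mul, hc2,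
          Complex.ofReal_re]
        exact this
      · intro w1 h1 w2 h2 a b ha hb hab
        simp only [Set.mem_ofPred_eq] at h1 h2 ⊢
        have e : a • w1 + b • w2 = (a : ℂ) • w1 + (b : ℂ) • w2 := rfl
        rw [e, map_add, map_smul, map_smul]
        simp only [ContinuousMap.add_apply, ContinuousMap.smul_apply, smul_eq_mul, Complex.add_re,
          Complex.re_ofReal_mul]
        nlinarith
    have h1 : ε1 ≤ (R w x).re := this hw
    have h2 := ((R w).norm_coe_le_norm x).trans hwε
    have h3 := Complex.re_le_norm (R w x)
    linarith
  let c : ℝ := ‖R‖ + 1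
  have hc0 : 0 < c := by positivity
  obtain ⟨k, hk⟩ := hR.pointwise (z := fun k => ((c : ℂ))⁻¹ • R (z k)) (fun k => by
      rw [norm_smul, norm_inv, Complex.norm_real, Real.norm_of_nonneg hc0.le, inv_mul_le_one₀ hc0]
      have := R.le_opNorm (z k)
      have h2 := hz k
      have h3 := norm_nonneg R
      simp only [c]
      nlinarith) (fun x => by
      have := (hzx x).const_mul ((c : ℂ))⁻¹
      rw [mul_zero] at this
      exact this) (show 0 < ε / (2 * c) by positivity)
  have h1 : R (((c : ℂ))⁻¹ • R (z k)) = ((c : ℂ))⁻¹ • ((2⁻¹ : ℂ) • (R (R (f (σ (p k)))) - R (R (f (σ (q k)))))) := by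
    simp only [z, map_smul, map_sub]
  rw [h1, norm_smul, norm_smul, norm_inv, norm_inv, Complex.norm_real, Real.norm_of_nonneg hc0.le, ← dist_eq_norm] at hk
  have h2 := hpq k
  have h3 : ε / (2 * c) = c⁻¹ * (2⁻¹ * ε) := by field_simp
  rw [h3, mul_lt_mul_iff_right₀ (by positivity)] at hk
  norm_num at hk
  linarith

end MazurSec

section RieszSec
variable {X : Type*} [NormedAddCommGroup X] [NormedSpace ℂ X] [CompleteSpace X]

lemma riesz_bdd {R : X →L[ℂ] X}
    (hc : ∀ f : ℕ → X, (∀ k, ‖f k‖ ≤ 1) → ∃ σ : ℕ → ℕ, StrictMono σ ∧ CauchySeq fun k => R (R (f (σ k))))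
    (B : ℝ) (f : ℕ → X) (hf : ∀ k, ‖f k‖ ≤ B) :
    ∃ σ : ℕ → ℕ, StrictMono σ ∧ ∃ l, Tendsto (fun k => R (R (f (σ k)))) atTop (𝓝 l) := by
  have hB : 0 ≤ B := (norm_nonneg _).trans (hf 0)
  have hB1 : ((B + 1 : ℝ) : ℂ) ≠ 0 := by exact_mod_cast (show (B + 1 : ℝ) ≠ 0 by positivity)
  obtain ⟨σ, hσ, hs⟩ := hc (fun k => ((B + 1 : ℝ) : ℂ)⁻¹ • f k) (fun k => by
    rw [norm_smul, norm_inv, Complex.norm_real, Real.norm_of_nonneg (by positivity),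
      inv_mul_le_one₀ (by positivity)]
    linarith [hf k])
  obtain ⟨l, hl⟩ := cauchySeq_tendsto_of_complete hs
  refine ⟨σ, hσ, ((B + 1 : ℝ) : ℂ) • l, (hl.const_smul ((B + 1 : ℝ) : ℂ)).congr fun k => ?_⟩
  rw [map_smul, map_smul, smul_smul, mul_inv_cancel₀ hB1, one_smul]

lemma riesz_lift {R : X →L[ℂ] X}
    (hc : ∀ f : ℕ → X, (∀ k, ‖f k‖ ≤ 1) → ∃ σ : ℕ → ℕ, StrictMono σ ∧ CauchySeq fun k => R (R (f (σ k)))) :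
    ∃ C : ℝ, 0 ≤ C ∧ ∀ u, ∃ u', (1 + R) u' = (1 + R) u ∧ ‖u'‖ ≤ C * ‖(1 + R) u‖ := by
  by_contra hcon
  push Not at hcon
  have hk : ∀ k : ℕ, ∃ w : X, ‖w‖ = 1 ∧ ‖(1 + R) w‖ ≤ 1 / (k + 1 : ℝ) ∧
      ∀ p, (1 + R) p = (1 + R) w → 1 / 2 ≤ ‖p‖ := by
    intro k
    obtain ⟨u, hu⟩ := hcon (k + 1) (by positivity)
    have hAu : 0 < ‖(1 + R) u‖ := by
      rw [norm_pos_iff]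
      intro h0
      have := hu 0 (by rw [h0, map_zero])
      rw [h0] at this
      simp at this
    let S : Set ℝ := {s | ∃ u', (1 + R) u' = (1 + R) u ∧ ‖u'‖ = s}
    have hSne : S.Nonempty := ⟨_, u, rfl, rfl⟩
    have hSb : BddBelow S := ⟨0, by rintro _ ⟨u', _, rfl⟩; positivity⟩
    have hi : (k + 1) * ‖(1 + R) u‖ ≤ sInf S := le_csInf hSne (by
      rintro _ ⟨u', h', rfl⟩
      exact (hu u' h').le)
    have hi0 : 0 < sInf S := lt_of_lt_of_le (by positivity) hi
    obtain ⟨_, ⟨v, hv, rfl⟩, hv2⟩ := exists_lt_of_csInf_lt hSne (show sInf S < 2 * sInf S by linarith)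
    have hvi : sInf S ≤ ‖v‖ := csInf_le hSb ⟨v, hv, rfl⟩
    have hv0 : 0 < ‖v‖ := hi0.trans_le hvi
    have hvc : (‖v‖ : ℂ) ≠ 0 := by exact_mod_cast hv0.ne'
    refine ⟨(‖v‖ : ℂ)⁻¹ • v, ?_, ?_, ?_⟩
    · rw [norm_smul, norm_inv, Complex.norm_real, norm_norm, inv_mul_cancel₀ hv0.ne']
    · rw [map_smul, norm_smul, norm_inv, Complex.norm_real, norm_norm, hv, inv_mul_le_iff₀ hv0,
        mul_one_div, le_div_iff₀ (by positivity)]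
      linarith
    · intro p hp
      have h1 : sInf S ≤ ‖(‖v‖ : ℂ) • p‖ := csInf_le hSb ⟨_, by
        rw [map_smul, hp, map_smul, smul_smul, mul_inv_cancel₀ hvc, one_smul, hv], rfl⟩
      rw [norm_smul, Complex.norm_real, norm_norm] at h1
      nlinarith
  choose w hw1 hw2 hw3 using hk
  obtain ⟨σ, hσ, l, hl⟩ := riesz_bdd hc 1 w fun k => (hw1 k).le
  have hA0 : Tendsto (fun k => (1 + R) (w (σ k))) atTop (𝓝 0) := by
    refine squeeze_zero_norm (fun k => hw2 (σ k)) ?_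
    exact (tendsto_one_div_add_atTop_nhds_zero_nat (𝕜 := ℝ)).comp hσ.tendsto_atTop
  have hwl : Tendsto (fun k => w (σ k)) atTop (𝓝 l) := by
    have h1 := hl.add ((((1 - R : X →L[ℂ] X).continuous.tendsto 0).comp hA0))
    rw [map_zero, add_zero] at h1
    refine h1.congr fun k => ?_
    simp
    abel
  have hl0 : (1 + R) l = 0 := tendsto_nhds_unique (((1 + R).continuous.tendsto l).comp hwl) hA0
  have h1 := (hwl.sub_const l).norm
  rw [sub_self, norm_zero] at h1
  obtain ⟨k, hk⟩ := ((tendsto_order.1 h1).2 (1 / 2) (by norm_num)).exists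
  have := hw3 (σ k) (w (σ k) - l) (by rw [map_sub, hl0, sub_zero])
  linarith

lemma riesz_surj {R : X →L[ℂ] X}
    (hc : ∀ f : ℕ → X, (∀ k, ‖f k‖ ≤ 1) → ∃ σ : ℕ → ℕ, StrictMono σ ∧ CauchySeq fun k => R (R (f (σ k))))
    (hd : DenseRange ⇑(1 + R : X →L[ℂ] X)) : Function.Surjective ⇑(1 + R : X →L[ℂ] X) := by
  intro y
  obtain ⟨C, hC0, hC⟩ := riesz_lift hc
  obtain ⟨v, hv, hvy⟩ := mem_closure_iff_seq_limit.1 (hd y)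
  choose u hu using hv
  choose u' hu' hun using fun k => hC (u k)
  have hu'y : Tendsto (fun k => (1 + R) (u' k)) atTop (𝓝 y) := hvy.congr fun k => by rw [hu', hu]
  obtain ⟨B, hB⟩ := hvy.norm.bddAbove_range
  have hB' : ∀ k, ‖u' k‖ ≤ C * B := fun k => (hun k).trans (by
    rw [hu]
    exact mul_le_mul_of_nonneg_left (hB ⟨k, rfl⟩) hC0)
  obtain ⟨σ, hσ, l, hl⟩ := riesz_bdd hc _ u' hB'
  have hA := hu'y.comp hσ.tendsto_atTop
  have h1 := hl.add ((((1 - R : X →L[ℂ] X).continuous.tendsto y).comp hA))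
  have h2 : Tendsto (fun k => u' (σ k)) atTop (𝓝 (l + (1 - R) y)) := h1.congr fun k => by
    simp
    abel
  exact ⟨_, tendsto_nhds_unique (((1 + R).continuous.tendsto _).comp h2) hA⟩

lemma riesz_inj {R : X →L[ℂ] X}
    (hc : ∀ f : ℕ → X, (∀ k, ‖f k‖ ≤ 1) → ∃ σ : ℕ → ℕ, StrictMono σ ∧ CauchySeq fun k => R (R (f (σ k))))
    (hs : Function.Surjective ⇑(1 + R : X →L[ℂ] X)) : Function.Injective ⇑(1 + R : X →L[ℂ] X) := by
  rw [injective_iff_map_eq_zero]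
  intro a ha
  by_contra ha0
  let A : X →L[ℂ] X := 1 + R
  have hAR : ∀ j, Commute (A ^ j) R := fun j =>
    (show Commute A R from (Commute.one_left R).add_left (Commute.refl R)).pow_left j
  have hpow : ∀ j, ∃ x, (A ^ j) x = a := by
    intro j
    induction j with
    | zero => exact ⟨a, by simp⟩
    | succ j ih =>
      obtain ⟨x, hx⟩ := ih
      obtain ⟨x', hx'⟩ := hs x
      refine ⟨x', ?_⟩
      rw [pow_succ, mul_apply_eq_comp]
      change (A ^ j) ((1 + R) x') = a
      rw [hx', hx]
  have hmono : ∀ j l, j ≤ l → ∀ x, (A ^ j) x = 0 → (A ^ l) x = 0 := by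
    intro j l hjl x hx
    obtain ⟨m, rfl⟩ := Nat.exists_eq_add_of_le' hjl
    rw [pow_add, mul_apply_eq_comp, hx, map_zero]
  have hu : ∀ j, ∃ u : X, ‖u‖ ≤ 1 ∧ (A ^ (j + 1)) u = 0 ∧ ∀ y, (A ^ j) y = 0 → 1 / 2 ≤ ‖u - y‖ := by
    intro j
    let N : Submodule ℂ X := (A ^ (j + 1)).ker
    let F : Submodule ℂ N := ((A ^ j).comp N.subtypeL).ker
    have hF : IsClosed (F : Set N) := ContinuousLinearMap.isClosed_ker _
    obtain ⟨x, hx⟩ := hpow j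
    have hxN : x ∈ N := by
      rw [LinearMap.mem_ker]
      change (A ^ (j + 1)) x = 0
      rw [pow_succ', mul_apply_eq_comp, hx]
      exact ha
    obtain ⟨u, hu, hu'⟩ := riesz_lemma hF ⟨⟨x, hxN⟩, fun h => ha0 (by
      rw [← hx]; exact h)⟩ (show (1 / 2 : ℝ) < 1 by norm_num)
    have hu0 : (u : X) ≠ 0 := fun h => hu (by
      have : u = 0 := Subtype.ext h
      rw [this]; exact F.zero_mem)
    have hn : 0 < ‖(u : X)‖ := norm_pos_iff.2 hu0
    have hnc : (‖(u : X)‖ : ℂ) ≠ 0 := by exact_mod_cast hn.ne'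
    have huN : (A ^ (j + 1)) (u : X) = 0 := u.2
    refine ⟨(‖(u : X)‖ : ℂ)⁻¹ • (u : X), ?_, ?_, fun y hy => ?_⟩
    · rw [norm_smul, norm_inv, Complex.norm_real, norm_norm, inv_mul_cancel₀ hn.ne']
    · rw [map_smul, huN, smul_zero]
    · have hyN : (‖(u : X)‖ : ℂ) • y ∈ N := by
        rw [LinearMap.mem_ker]
        change (A ^ (j + 1)) _ = 0
        rw [map_smul, hmono j (j + 1) (Nat.le_succ j) y hy, smul_zero]
      have h1 := hu' ⟨_, hyN⟩ (by
        change (A ^ j) ((‖(u : X)‖ : ℂ) • y) = 0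
        rw [map_smul, hy, smul_zero])
      have h2 : ‖u - ⟨_, hyN⟩‖ = ‖(u : X) - (‖(u : X)‖ : ℂ) • y‖ := rfl
      have h3 : (u : X) - (‖(u : X)‖ : ℂ) • y = (‖(u : X)‖ : ℂ) • ((‖(u : X)‖ : ℂ)⁻¹ • (u : X) - y) := by
        rw [smul_sub, smul_smul, mul_inv_cancel₀ hnc, one_smul]
      rw [h2, h3, norm_smul, Complex.norm_real, norm_norm] at h1
      have h4 : ‖u‖ = ‖(u : X)‖ := rfl
      rw [h4, mul_comm] at h1
      exact le_of_mul_le_mul_left h1 hn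
  choose u hu1 hu2 hu3 using hu
  obtain ⟨σ, hσ, hcs⟩ := hc u hu1
  obtain ⟨N, hN⟩ := Metric.cauchySeq_iff.1 hcs (1 / 2) (by norm_num)
  have h1 := hN (N + 1) (Nat.le_succ N) N le_rfl
  have hlt : σ N < σ (N + 1) := hσ (Nat.lt_succ_self N)
  have hRk : ∀ j x, (A ^ j) x = 0 → (A ^ j) (R x) = 0 := by
    intro j x hx
    have := congrArg (fun L : X →L[ℂ] X => L x) (hAR j).eq
    simp only [mul_apply_eq_comp] at this
    rw [this, hx, map_zero]
  have h2 := hu3 (σ (N + 1)) ((1 - R) (A (u (σ (N + 1)))) + R (R (u (σ N)))) (by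
    have e1 : (A ^ σ (N + 1)) (A (u (σ (N + 1)))) = 0 := by
      rw [← mul_apply_eq_comp, ← pow_succ]; exact hu2 _
    have e2 : (A ^ σ (N + 1)) (u (σ N)) = 0 := hmono _ _ hlt _ (hu2 _)
    rw [map_add, sub_apply, map_sub, hRk _ _ e1, hRk _ _ (hRk _ _ e2),
      one_apply_eq_self, e1]
    simp)
  rw [dist_eq_norm] at h1
  have h3 : u (σ (N + 1)) - ((1 - R) (A (u (σ (N + 1)))) + R (R (u (σ N)))) =
      R (R (u (σ (N + 1)))) - R (R (u (σ N))) := by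
    simp [A]
    abel
  rw [h3] at h2
  linarith

/-- Riesz theory for operators with compact square. -/
lemma riesz_isUnit {R : X →L[ℂ] X}
    (hc : ∀ f : ℕ → X, (∀ k, ‖f k‖ ≤ 1) → ∃ σ : ℕ → ℕ, StrictMono σ ∧ CauchySeq fun k => R (R (f (σ k))))
    (hd : DenseRange ⇑(1 + R : X →L[ℂ] X)) : IsUnit (1 + R) := by
  have hs := riesz_surj hc hd
  rw [ContinuousLinearMap.isUnit_iff_bijective]
  exact ⟨riesz_inj hc hs, hs⟩

end RieszSec

section GSec
variable {K : Type} [TopologicalSpace K] [CompactSpace K] [T2Space K] [TotallyDisconnectedSpace K]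
  {ι : ℕ → K}

/-- the diagonal of an operator -/
noncomputable def gd (ι : ℕ → K) (T : C(K, ℂ) →L[ℂ] C(K, ℂ)) (n : ℕ) : ℂ := T (chi {ι n}) (ι n)

lemma gd_norm_le (T : C(K, ℂ) →L[ℂ] C(K, ℂ)) (n : ℕ) : ‖gd ι T n‖ ≤ ‖T‖ :=
  ((T (chi {ι n})).norm_coe_le_norm _).trans
    ((T.le_opNorm _).trans (mul_le_of_le_one_right (norm_nonneg _) (chi_norm_le _)))

/-- the off-diagonal functionals -/
noncomputable def psi (ι : ℕ → K) (T : C(K, ℂ) →L[ℂ] C(K, ℂ)) (n : ℕ) : C(K, ℂ) →L[ℂ] ℂ :=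
  row T (ι n) - gd ι T n • row (ContinuousLinearMap.id ℂ C(K, ℂ)) (ι n)

lemma psi_apply (T : C(K, ℂ) →L[ℂ] C(K, ℂ)) (n : ℕ) (f : C(K, ℂ)) :
    psi ι T n f = T f (ι n) - gd ι T n * f (ι n) := rfl

lemma psi_DD (h : HKSpace K ι) (T : C(K, ℂ) →L[ℂ] C(K, ℂ)) (A : ℕ → Set K) (f : ℕ → C(K, ℂ))
    (n : ℕ → ℕ) (hs : DisjSeq A f) {ε : ℝ} (hε : 0 < ε) (hT : ∀ k, ε ≤ ‖psi ι T (n k) (f k)‖) :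
    False := by
  classical
  have hc := fun k => h.clopen (n k)
  have hval : ∀ k x, (f k - f k (ι (n k)) • chi {ι (n k)}) x = if x = ι (n k) then 0 else f k x := by
    intro k x
    rw [ContinuousMap.sub_apply, ContinuousMap.smul_apply, chi_apply (hc k)]
    by_cases hx : x = ι (n k)
    · subst hx; simp
    · simp [hx]
  refine stepB h T A (fun k => f k - f k (ι (n k)) • chi {ι (n k)}) n
    ⟨hs.clopen, hs.disj, fun k x hx => ?_, fun k => ?_⟩ (fun k => ?_) hε fun k => ?_
  · rw [hval, hs.supp k x hx]; simp
  · rw [ContinuousMap.norm_le _ zero_le_one]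
    intro x
    rw [hval]
    split_ifs
    · simp
    · exact ((f k).norm_coe_le_norm x).trans (hs.norm k)
  · rw [hval]; simp
  · have := hT k
    rw [psi_apply] at this
    rw [map_sub, map_smul, ContinuousMap.sub_apply, ContinuousMap.smul_apply, smul_eq_mul, mul_comm]
    exact this

lemma lemL (h : HKSpace K ι) (T : C(K, ℂ) →L[ℂ] C(K, ℂ)) {ε : ℝ} (hε : 0 < ε) (x : K) :
    ∃ A : Set K, IsClopen A ∧ x ∈ A ∧ ∀ B, IsClopen B → B ⊆ A → x ∉ B → ∀ n, vr (psi ι T n) B ≤ ε := by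
  by_contra hcon
  push Not at hcon
  choose B hB hBA hxB n hn using fun (A : {A : Set K // IsClopen A ∧ x ∈ A}) => hcon A.1 A.2.1 A.2.2
  choose f hf1 hf2 hf3 using fun A => exists_of_lt_vr (psi ι T (n A)) (hB A) hε.le (hn A)
  let step : {A : Set K // IsClopen A ∧ x ∈ A} → {A : Set K // IsClopen A ∧ x ∈ A} :=
    fun A => ⟨A.1 \ B A, A.2.1.diff (hB A), A.2.2, hxB A⟩
  let S : ℕ → {A : Set K // IsClopen A ∧ x ∈ A} := fun k => step^[k] ⟨Set.univ, isClopen_univ, trivial⟩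
  have hS : ∀ k, S (k + 1) = step (S k) := fun k => Function.iterate_succ_apply' step k _
  have hSm : Antitone fun k => (S k).1 := antitone_nat_of_succ_le fun k => by
    rw [hS]; exact Set.sdiff_subset
  have hdis : ∀ j k, j < k → Disjoint (B (S j)) (B (S k)) := by
    intro j k hjk
    refine Set.disjoint_left.2 fun y hy hy' => ?_
    have h1 := hSm (Nat.succ_le_of_lt hjk) (hBA (S k) hy')
    simp only [Nat.succ_eq_add_one, hS] at h1
    exact h1.2 hy
  refine psi_DD h T (fun k => B (S k)) (fun k => f (S k)) (fun k => n (S k))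
    ⟨fun k => hB _, fun j k hjk => ?_, fun k => hf1 _, fun k => hf2 _⟩ hε fun k => (hf3 _).le
  rcases lt_or_gt_of_ne hjk with hlt | hlt
  exacts [hdis j k hlt, (hdis k j hlt).symm]

lemma lemL2 (h : HKSpace K ι) (T : C(K, ℂ) →L[ℂ] C(K, ℂ)) {ε : ℝ} (hε : 0 < ε) (x : K) :
    ∃ A : Set K, IsClopen A ∧ x ∈ A ∧ ∀ n (f : C(K, ℂ)), (∀ y, y ∉ A → f y = 0) → f x = 0 →
      ‖psi ι T n f‖ ≤ ε * ‖f‖ := by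
  obtain ⟨A, hA, hxA, hv⟩ := lemL h T hε x
  refine ⟨A, hA, hxA, fun n f hf hfx => ?_⟩
  refine le_of_forall_pos_le_add fun s hs => ?_
  let t : ℝ := s / (‖psi ι T n‖ + 1)
  have ht : 0 < t := by positivity
  have hUt : ‖psi ι T n‖ * t ≤ s := by
    have : (‖psi ι T n‖ + 1) * t = s := by simp only [t]; field_simp
    nlinarith
  obtain ⟨B, hB, hB1, hB2⟩ := exists_clopen_sep (g := fun x => ‖f x‖) (by fun_prop)
      (show t / 2 < t by linarith)
  have hBA : B ⊆ A := fun y hy => by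
    by_contra hyA
    have := hB2 y hy
    simp only [hf y hyA, norm_zero] at this
    linarith
  have hxB : x ∉ B := fun hy => by
    have := hB2 x hy
    simp only [hfx, norm_zero] at this
    linarith
  have h1 : ‖psi ι T n (mulP B f)‖ ≤ ε * ‖f‖ :=
    ((psi ι T n).comp (mulP B)).le_of_opNorm_le (hv B hB hBA hxB n) f
  have h2 : ‖f - mulP B f‖ ≤ t := by
    rw [ContinuousMap.norm_le _ ht.le]
    intro y
    rw [ContinuousMap.sub_apply]
    by_cases hy : y ∈ B
    · rw [mulP_mem hB f hy, sub_self, norm_zero]; exact ht.le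
    · rw [mulP_notMem hB f hy, sub_zero]
      by_contra hcon
      exact hy (hB1 y (not_le.1 hcon).le)
  have e : f = mulP B f + (f - mulP B f) := by abel
  calc ‖psi ι T n f‖ = ‖psi ι T n (mulP B f) + psi ι T n (f - mulP B f)‖ := by rw [← map_add, ← e]
    _ ≤ ‖psi ι T n (mulP B f)‖ + ‖psi ι T n (f - mulP B f)‖ := norm_add_le _ _
    _ ≤ _ := add_le_add h1 (((psi ι T n).le_opNorm _).trans ((by gcongr : _ ≤ ‖psi ι T n‖ * t).trans hUt))

lemma DDop.comp_mulP {U : C(K, ℂ) →L[ℂ] C(K, ℂ)} (hU : DDop U) {A : Set K} (hA : IsClopen A) :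
    DDop (U.comp (mulP A)) := by
  intro B f hf ε hε
  exact hU B (fun k => mulP A (f k)) ⟨hf.clopen, hf.disj, fun k x hx => by
    rw [mulP_apply, hf.supp k x hx, mul_zero], fun k => (mulP_norm_le _ _).trans (hf.norm k)⟩ ε hε

lemma DDop_cross (h : HKSpace K ι) (T : C(K, ℂ) →L[ℂ] C(K, ℂ)) {A B : Set K} (hA : IsClopen A)
    (hB : IsClopen B) (hAB : Disjoint A B) : DDop ((mulP A).comp (T.comp (mulP B))) := by
  refine DD_of fun C f hf ε hε hT => ?_
  have hex : ∀ k, ∃ n, ε / 2 ≤ ‖((mulP A).comp (T.comp (mulP B))) (f k) (ι n)‖ := by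
    intro k
    by_contra hcon
    push Not at hcon
    have := h.norm_le fun m => (hcon m).le
    linarith [hT k]
  choose n hn using hex
  have hnA : ∀ k, ι (n k) ∈ A := by
    intro k
    by_contra hk
    have := hn k
    rw [ContinuousLinearMap.comp_apply, mulP_notMem hA _ hk, norm_zero] at this
    linarith
  refine stepB h T C (fun k => mulP B (f k)) n ⟨hf.clopen, hf.disj, fun k x hx => by
    rw [mulP_apply, hf.supp k x hx, mul_zero], fun k => (mulP_norm_le _ _).trans (hf.norm k)⟩
    (fun k => mulP_notMem hB _ (Set.disjoint_left.1 hAB (hnA k))) (half_pos hε) fun k => ?_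
  have := hn k
  rwa [ContinuousLinearMap.comp_apply, mulP_mem hA _ (hnA k)] at this

lemma lemG (h : HKSpace K ι) (T : C(K, ℂ) →L[ℂ] C(K, ℂ)) {ε : ℝ} (hε : 0 < ε) :
    ∃ (P : Set K) (D : C(K, ℂ) →L[ℂ] C(K, ℂ)), P.Finite ∧ DDop (T - D) ∧
      ∀ f : C(K, ℂ), (∀ p ∈ P, f p = 0) → ∀ n, ‖D f (ι n) - gd ι T n * f (ι n)‖ ≤ ε * ‖f‖ := by
  suffices H : ∃ W : Set K, IsClopen W ∧ Set.univ ⊆ W ∧ ∃ (P : Set K) (D : C(K, ℂ) →L[ℂ] C(K, ℂ)),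
      P.Finite ∧ DDop ((mulP W).comp (T.comp (mulP W)) - D) ∧
      ∀ f : C(K, ℂ), (∀ p ∈ P, f p = 0) → ∀ n, ι n ∈ W →
        ‖D f (ι n) - gd ι T n * f (ι n)‖ ≤ ε * ‖f‖ by
    obtain ⟨W, hW, hWu, P, D, hP, hD, hest⟩ := H
    refine ⟨P, D, hP, ?_, fun f hf n => hest f hf n (hWu trivial)⟩
    have : (mulP W).comp (T.comp (mulP W)) = T := by
      ext f x
      rw [ContinuousLinearMap.comp_apply, mulP_mem hW _ (hWu trivial), ContinuousLinearMap.comp_apply,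
        mulP_self hW fun y hy => absurd (hWu trivial) hy]
    rwa [this] at hD
  refine isCompact_univ.induction_on (p := fun S => ∃ W : Set K, IsClopen W ∧ S ⊆ W ∧ ∃ (P : Set K) (D : C(K, ℂ) →L[ℂ] C(K, ℂ)),
      P.Finite ∧ DDop ((mulP W).comp (T.comp (mulP W)) - D) ∧
      ∀ f : C(K, ℂ), (∀ p ∈ P, f p = 0) → ∀ n, ι n ∈ W →
        ‖D f (ι n) - gd ι T n * f (ι n)‖ ≤ ε * ‖f‖) ?_ ?_ ?_ ?_
  · refine ⟨∅, isClopen_empty, subset_rfl, ∅, (mulP ∅).comp (T.comp (mulP ∅)), Set.finite_empty, ?_, ?_⟩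
    · rw [sub_self]; exact DDop_zero
    · intro f _ n hn; exact absurd hn (Set.notMem_empty _)
  · rintro S S' hS ⟨W, hW, hSW, H⟩
    exact ⟨W, hW, hS.trans hSW, H⟩
  · rintro S1 S2 ⟨W1, hW1, hS1, P1, D1, hP1, hD1, he1⟩ ⟨W2, hW2, hS2, P2, D2, hP2, hD2, he2⟩
    have hV : IsClopen (W2 \ W1) := hW2.diff hW1
    have hdisj : Disjoint W1 (W2 \ W1) := Set.disjoint_sdiff_right
    have hW : IsClopen (W1 ∪ W2) := hW1.union hW2
    refine ⟨W1 ∪ W2, hW, Set.union_subset_union hS1 hS2, P1 ∪ P2,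
      (mulP W1).comp (D1.comp (mulP W1)) + (mulP (W2 \ W1)).comp (D2.comp (mulP (W2 \ W1))),
      hP1.union hP2, ?_, ?_⟩
    · have hadd : mulP (W1 ∪ W2) = mulP W1 + mulP (W2 \ W1) := by
        ext f x
        simp only [add_apply, ContinuousMap.add_apply, mulP_apply,
          chi_apply hW, chi_apply hW1, chi_apply hV, Set.mem_union, Set.mem_sdiff]
        by_cases h1 : x ∈ W1 <;> by_cases h2 : x ∈ W2 <;> simp [h1, h2]
      have hid1 : ∀ f, mulP W1 (mulP W1 f) = mulP W1 f := fun f =>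
        mulP_self hW1 fun x hx => mulP_notMem hW1 f hx
      have hid2 : ∀ f, mulP W2 (mulP (W2 \ W1) f) = mulP (W2 \ W1) f := fun f =>
        mulP_self hW2 fun x hx => mulP_notMem hV f fun hx' => hx hx'.1
      have hid2' : ∀ f, mulP (W2 \ W1) (mulP W2 f) = mulP (W2 \ W1) f := fun f => by
        ext x
        by_cases hx : x ∈ W2 \ W1
        · rw [mulP_mem hV _ hx, mulP_mem hV _ hx, mulP_mem hW2 _ hx.1]
        · rw [mulP_notMem hV _ hx, mulP_notMem hV _ hx]
      have e : (mulP (W1 ∪ W2)).comp (T.comp (mulP (W1 ∪ W2))) -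
          ((mulP W1).comp (D1.comp (mulP W1)) + (mulP (W2 \ W1)).comp (D2.comp (mulP (W2 \ W1)))) =
          ((mulP W1).comp (((mulP W1).comp (T.comp (mulP W1)) - D1).comp (mulP W1)) +
          (mulP (W2 \ W1)).comp (((mulP W2).comp (T.comp (mulP W2)) - D2).comp (mulP (W2 \ W1)))) +
          ((mulP W1).comp (T.comp (mulP (W2 \ W1))) + (mulP (W2 \ W1)).comp (T.comp (mulP W1))) := by
        rw [hadd]
        refine ContinuousLinearMap.ext fun f => ?_
        simp only [sub_apply, add_apply, ContinuousLinearMap.comp_apply, map_sub, map_add, hid1, hid2, hid2']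
        abel
      rw [e]
      refine (DDop.add ?_ ?_).add (DDop.add ?_ ?_)
      · exact (hD1.comp_mulP hW1).comp _
      · exact (hD2.comp_mulP hV).comp _
      · exact DDop_cross h T hW1 hV hdisj
      · exact DDop_cross h T hV hW1 hdisj.symm
    · intro f hf n hn
      by_cases hn1 : ι n ∈ W1
      · have h1 := he1 (mulP W1 f) (fun p hp => by
          rw [mulP_apply, hf p (Or.inl hp), mul_zero]) n hn1
        rw [mulP_mem hW1 f hn1] at h1
        simp only [add_apply, ContinuousMap.add_apply, ContinuousLinearMap.comp_apply]
        rw [mulP_mem hW1 _ hn1, mulP_notMem hV _ (fun hx => hx.2 hn1), add_zero]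
        exact h1.trans (by gcongr; exact mulP_norm_le _ _)
      · have hnV : ι n ∈ W2 \ W1 := ⟨hn.resolve_left hn1, hn1⟩
        have h1 := he2 (mulP (W2 \ W1) f) (fun p hp => by
          rw [mulP_apply, hf p (Or.inr hp), mul_zero]) n hnV.1
        rw [mulP_mem hV f hnV] at h1
        simp only [add_apply, ContinuousMap.add_apply, ContinuousLinearMap.comp_apply]
        rw [mulP_notMem hW1 _ hn1, mulP_mem hV _ hnV, zero_add]
        exact h1.trans (by gcongr; exact mulP_norm_le _ _)
  · intro x _
    obtain ⟨A, hA, hxA, hest⟩ := lemL2 h T hε x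
    refine ⟨A, mem_nhdsWithin_of_mem_nhds (hA.isOpen.mem_nhds hxA), A, hA, subset_rfl, {x},
      (mulP A).comp (T.comp (mulP A)), Set.finite_singleton x, ?_, ?_⟩
    · rw [sub_self]; exact DDop_zero
    · intro f hf n hn
      have h1 := hest n (mulP A f) (fun y hy => mulP_notMem hA f hy) (by
        rw [mulP_apply, hf x rfl, mul_zero])
      rw [psi_apply, mulP_mem hA f hn] at h1
      rw [ContinuousLinearMap.comp_apply, mulP_mem hA _ hn, ContinuousLinearMap.comp_apply]
      exact h1.trans (by gcongr; exact mulP_norm_le _ _)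

end GSec

section HSec
variable {K : Type} [TopologicalSpace K] [CompactSpace K] [T2Space K] [TotallyDisconnectedSpace K]
  {ι : ℕ → K}

lemma isUnit_of_bdd_below {X : Type*} [NormedAddCommGroup X] [NormedSpace ℂ X] [CompleteSpace X]
    (G : X →L[ℂ] X) {c : ℝ} (hc : 0 ≤ c) (hb : ∀ f, ‖f‖ ≤ c * ‖G f‖)
    (hs : ∀ y, ∃ f, ‖y - G f‖ ≤ 1 / 2 * ‖y‖) : IsUnit G := by
  have hanti : AntilipschitzWith c.toNNReal G :=
    AddMonoidHomClass.antilipschitz_of_bound G fun x => by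
      rw [Real.coe_toNNReal c hc]; exact hb x
  have hcl : IsClosed (Set.range G) := hanti.isClosed_range G.uniformContinuous
  have hcl' : IsClosed ((G.range : Submodule ℂ X) : Set X) := by
    have e : ((G.range : Submodule ℂ X) : Set X) = Set.range G := by ext; simp
    rw [e]; exact hcl
  rw [ContinuousLinearMap.isUnit_iff_bijective]
  refine ⟨hanti.injective, fun y => ?_⟩
  by_contra hy
  obtain ⟨x, hx, hx'⟩ := riesz_lemma (F := G.range) hcl'
    ⟨y, fun hmem => hy (by simpa using hmem)⟩ (show (3 / 4 : ℝ) < 1 by norm_num)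
  obtain ⟨f, hf⟩ := hs x
  have h1 := hx' (G f) ⟨f, rfl⟩
  have h2 : x = 0 := by
    rw [← norm_le_zero_iff]; linarith
  exact hx (by rw [h2]; exact Submodule.zero_mem _)

lemma exists_unit (h : HKSpace K ι) (T : C(K, ℂ) →L[ℂ] C(K, ℂ)) {ε0 : ℝ} (hε0 : 0 < ε0)
    (hε1 : ε0 ≤ 1) (hg : ∀ n, 1 + ε0 ≤ ‖gd ι T n‖) {α : ℂ} (hα : ‖α‖ ≤ 1) :
    ∃ G : C(K, ℂ) →L[ℂ] C(K, ℂ), IsUnit G ∧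
      DDop (T - α • (1 : C(K, ℂ) →L[ℂ] C(K, ℂ)) - G) := by
  classical
  set ε : ℝ := ε0 / 48 with hεdef
  have hε : 0 < ε := by positivity
  obtain ⟨P, D, hP, hD, hest⟩ := lemG h T hε
  obtain ⟨V, hV, hVd⟩ := hP.t2_separation
  choose C hC hC1 hC2 using fun p : K => exists_clopen_between (F := {p}) (U := V p)
    isClosed_singleton (hV p).2 (Set.singleton_subset_iff.2 (hV p).1)
  have hpC : ∀ p, p ∈ C p := fun p => hC1 p rfl
  have hCd : ∀ p ∈ P, ∀ q ∈ P, p ≠ q → ∀ x, x ∈ C p → x ∉ C q := by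
    intro p hp q hq hpq x hx hx'
    exact Set.disjoint_left.1 (hVd hp hq hpq) (hC2 p hx) (hC2 q hx')
  have hgα : ∀ n, ε0 ≤ ‖gd ι T n - α‖ := by
    intro n
    have := norm_sub_norm_le (gd ι T n) α
    linarith [hg n]
  let δ : K → C(K, ℂ) →L[ℂ] ℂ := fun p => row (ContinuousLinearMap.id ℂ C(K, ℂ)) p
  let F : C(K, ℂ) →L[ℂ] C(K, ℂ) := ∑ p ∈ hP.toFinset, (δ p).smulRight (chi (C p))
  have hFx : ∀ f x, F f x = ∑ p ∈ hP.toFinset, f p * chi (C p) x := by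
    intro f x
    simp only [F, sum_apply, ContinuousMap.sum_apply, δ]
    rfl
  have hF1 : ∀ f x q, q ∈ P → x ∈ C q → F f x = f q := by
    intro f x q hq hx
    rw [hFx, Finset.sum_eq_single q]
    · rw [chi_mem (hC q) hx, mul_one]
    · intro p hp hpq
      rw [chi_notMem (hC p) (hCd q hq p (by simpa using hp) (Ne.symm hpq) x hx), mul_zero]
    · intro hq'; exact absurd (by simpa using hq) hq'
  have hF0 : ∀ f x, (∀ q ∈ P, x ∉ C q) → F f x = 0 := by
    intro f x hx
    rw [hFx]
    refine Finset.sum_eq_zero fun p hp => ?_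
    rw [chi_notMem (hC p) (hx p (by simpa using hp)), mul_zero]
  have hFP : ∀ f, ∀ q ∈ P, F f q = f q := fun f q hq => hF1 f q q hq (hpC q)
  have hFb : ∀ f (c : ℝ), 0 ≤ c → (∀ p ∈ P, ‖f p‖ ≤ c) → ‖F f‖ ≤ c := by
    intro f c hc hf
    rw [ContinuousMap.norm_le _ hc]
    intro x
    by_cases hx : ∃ q ∈ P, x ∈ C q
    · obtain ⟨q, hq, hx⟩ := hx
      rw [hF1 f x q hq hx]; exact hf q hq
    · push Not at hx
      rw [hF0 f x hx, norm_zero]; exact hc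
  have hFn : ∀ f, ‖F f‖ ≤ ‖f‖ := fun f => hFb f _ (norm_nonneg _) fun p _ => f.norm_coe_le_norm p
  have hFz : ∀ f : C(K, ℂ), (∀ p ∈ P, f p = 0) → F f = 0 := by
    intro f hf
    rw [← norm_le_zero_iff]
    exact hFb f 0 le_rfl fun p hp => by rw [hf p hp, norm_zero]
  have hEz : ∀ f : C(K, ℂ), ∀ p ∈ P, (f - F f) p = 0 := by
    intro f p hp
    rw [ContinuousMap.sub_apply, hFP f p hp, sub_self]
  have hEF : ∀ f, F f - F (F f) = 0 := by
    intro f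
    rw [← map_sub]; exact hFz _ (hEz f)
  have est1 : ∀ f : C(K, ℂ), (∀ p ∈ P, f p = 0) → ∀ p ∈ P, ‖D f p‖ ≤ ε * ‖f‖ := by
    intro f hf p hp
    refine le_of_forall_pos_le_add fun s hs => ?_
    let t : ℝ := s / (1 + ‖T‖)
    have ht : 0 < t := by positivity
    have hUt : t + ‖T‖ * t = s := by simp only [t]; field_simp
    have ho1 : IsOpen {y : K | ‖f y‖ < t} := isOpen_lt (by fun_prop) continuous_const
    have ho2 : IsOpen {y : K | ‖D f y - D f p‖ < t} := isOpen_lt (by fun_prop) continuous_const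
    have ho : IsOpen {y : K | ‖f y‖ < t ∧ ‖D f y - D f p‖ < t} := ho1.inter ho2
    obtain ⟨_, ⟨hy1, hy2⟩, n, rfl⟩ := h.dense.exists_mem_open ho ⟨p, by simp [hf p hp, ht]⟩ |> fun ⟨n, hn⟩ =>
      (⟨ι n, hn, n, rfl⟩ : ∃ y, y ∈ {y : K | ‖f y‖ < t ∧ ‖D f y - D f p‖ < t} ∧ ∃ n, ι n = y)
    have h1 := hest f hf n
    have e : D f p = -(D f (ι n) - D f p) + (D f (ι n) - gd ι T n * f (ι n)) + gd ι T n * f (ι n) := by ring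
    rw [e]
    refine (norm_add₃_le).trans ?_
    rw [norm_neg, norm_mul]
    have h2 : ‖gd ι T n‖ * ‖f (ι n)‖ ≤ ‖T‖ * t :=
      mul_le_mul (gd_norm_le T n) hy1.le (norm_nonneg _) (norm_nonneg _)
    linarith
  let L : C(K, ℂ) →L[ℂ] C(K, ℂ) := (1 - F).comp (D - α • (1 : C(K, ℂ) →L[ℂ] C(K, ℂ)))
  have hL : ∀ f, L f = (D f - α • f) - F (D f - α • f) := fun f => rfl
  have hLz : ∀ f, ∀ p ∈ P, L f p = 0 := fun f p hp => by rw [hL]; exact hEz _ p hp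
  have est2 : ∀ f : C(K, ℂ), (∀ p ∈ P, f p = 0) → ∀ n,
      ‖L f (ι n) - (gd ι T n - α) * f (ι n)‖ ≤ 2 * ε * ‖f‖ := by
    intro f hf n
    have h1 := hest f hf n
    have h2 : ‖F (D f - α • f)‖ ≤ ε * ‖f‖ := hFb _ _ (by positivity) fun p hp => by
      rw [ContinuousMap.sub_apply, ContinuousMap.smul_apply, hf p hp, smul_zero, sub_zero]
      exact est1 f hf p hp
    have h3 := (F (D f - α • f)).norm_coe_le_norm (ι n)
    have e : L f (ι n) - (gd ι T n - α) * f (ι n) =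
      (D f (ι n) - gd ι T n * f (ι n)) - F (D f - α • f) (ι n) := by
      rw [hL, ContinuousMap.sub_apply, ContinuousMap.sub_apply, ContinuousMap.smul_apply, smul_eq_mul]; ring
    rw [e]
    refine (norm_sub_le _ _).trans ?_
    linarith
  have hbelow : ∀ f : C(K, ℂ), (∀ p ∈ P, f p = 0) → ε0 / 2 * ‖f‖ ≤ ‖L f‖ := by
    intro f hf
    have h1 : ‖f‖ ≤ (‖L f‖ + 2 * ε * ‖f‖) / ε0 := h.norm_le fun n => by
      rw [le_div_iff₀ hε0]
      have h2 := est2 f hf n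
      have h3 := norm_sub_norm_le ((gd ι T n - α) * f (ι n)) (L f (ι n))
      rw [norm_sub_rev, norm_mul] at h3
      have h4 := (L f).norm_coe_le_norm (ι n)
      have h5 : ε0 * ‖f (ι n)‖ ≤ ‖gd ι T n - α‖ * ‖f (ι n)‖ := by gcongr; exact hgα n
      linarith
    rw [le_div_iff₀ hε0] at h1
    have := norm_nonneg f
    rw [hεdef] at h1
    nlinarith
  have happrox : ∀ y : C(K, ℂ), (∀ p ∈ P, y p = 0) → ∃ f : C(K, ℂ), (∀ p ∈ P, f p = 0) ∧
      ‖y - L f‖ ≤ 1 / 4 * ‖y‖ := by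
    intro y hy
    rcases eq_or_ne y 0 with rfl | hy0
    · exact ⟨0, fun _ _ => rfl, by simp⟩
    have hyn : 0 < ‖y‖ := norm_pos_iff.2 hy0
    obtain ⟨W, hW, hW1, hW2⟩ := exists_clopen_sep (g := fun x => ‖y x‖) (by fun_prop)
      (show ‖y‖ / 16 < ‖y‖ / 8 by linarith)
    have hPW : ∀ p ∈ P, p ∉ W := fun p hp hpW => by
      have := hW2 p hpW
      simp only [hy p hp, norm_zero] at this
      linarith
    have hw := hest (chi W) (fun p hp => chi_notMem hW (hPW p hp))
    let w := D (chi W)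
    have hwn : ∀ n, ι n ∈ W → ‖w (ι n) - gd ι T n‖ ≤ ε := by
      intro n hn
      have := hw n
      rw [chi_mem hW hn, mul_one] at this
      exact this.trans (mul_le_of_le_one_right hε.le (chi_norm_le W))
    let v : C(K, ℂ) := chi W * (w - ContinuousMap.const K α) + (1 - chi W)
    have hvW : ∀ x ∈ W, v x = w x - α := fun x hx => by simp [v, chi_mem hW hx]
    have hvW' : ∀ x, x ∉ W → v x = 1 := fun x hx => by simp [v, chi_notMem hW hx]
    have hvb : ∀ x, ε0 / 2 ≤ ‖v x‖ := by
      have hcl : IsClosed {x : K | ε0 / 2 ≤ ‖v x‖} := isClosed_le continuous_const (by fun_prop)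
      intro x
      refine (hcl.closure_subset_iff.2 ?_) (h.dense x)
      rintro _ ⟨n, rfl⟩
      change ε0 / 2 ≤ ‖v (ι n)‖
      by_cases hn : ι n ∈ W
      · rw [hvW _ hn]
        have h1 := norm_sub_norm_le (gd ι T n - α) (gd ι T n - w (ι n))
        have h2 := hwn n hn
        rw [norm_sub_rev] at h2
        have h3 : gd ι T n - α - (gd ι T n - w (ι n)) = w (ι n) - α := by ring
        rw [h3] at h1
        linarith [hgα n]
      · rw [hvW' _ hn, norm_one]; linarith
    have hv0 : ∀ x, v x ≠ 0 := fun x hx => by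
      have := hvb x
      rw [hx, norm_zero] at this
      linarith
    let f : C(K, ℂ) := ⟨fun x => chi W x * y x * (v x)⁻¹, by
      exact ((chi W).continuous.mul y.continuous).mul (v.continuous.inv₀ hv0)⟩
    have hfx : ∀ x, f x = chi W x * y x * (v x)⁻¹ := fun x => rfl
    have hfP : ∀ p ∈ P, f p = 0 := fun p hp => by rw [hfx, hy p hp]; simp
    have hfn : ‖f‖ ≤ 2 / ε0 * ‖y‖ := by
      rw [ContinuousMap.norm_le _ (by positivity)]
      intro x
      rw [hfx, norm_mul, norm_mul, norm_inv]
      have h1 := ((chi W).norm_coe_le_norm x).trans (chi_norm_le W)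
      have h2 := y.norm_coe_le_norm x
      have h3 : ‖v x‖⁻¹ ≤ 2 / ε0 := by
        rw [← inv_div]
        exact inv_anti₀ (by positivity) (hvb x)
      calc ‖chi W x‖ * ‖y x‖ * ‖v x‖⁻¹ ≤ 1 * ‖y‖ * (2 / ε0) := by gcongr
        _ = _ := by ring
    have hεf : ε * ‖f‖ ≤ ‖y‖ / 24 := by
      calc ε * ‖f‖ ≤ ε * (2 / ε0 * ‖y‖) := by gcongr
        _ = ‖y‖ / 24 := by rw [hεdef]; field_simp; norm_num
    refine ⟨f, hfP, h.norm_le fun n => ?_⟩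
    have h1 := est2 f hfP n
    rw [ContinuousMap.sub_apply]
    by_cases hn : ι n ∈ W
    · have e1 : y (ι n) = (w (ι n) - α) * f (ι n) := by
        have := hv0 (ι n)
        rw [← hvW _ hn, hfx, chi_mem hW hn]
        field_simp
      have e2 : y (ι n) - L f (ι n) = (w (ι n) - gd ι T n) * f (ι n)
          - (L f (ι n) - (gd ι T n - α) * f (ι n)) := by rw [e1]; ring
      rw [e2]
      refine (norm_sub_le _ _).trans ?_
      rw [norm_mul]
      have h2 : ‖w (ι n) - gd ι T n‖ * ‖f (ι n)‖ ≤ ε * ‖f‖ :=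
        mul_le_mul (hwn n hn) (f.norm_coe_le_norm _) (norm_nonneg _) hε.le
      linarith
    · have e1 : f (ι n) = 0 := by rw [hfx, chi_notMem hW hn]; simp
      rw [e1, mul_zero, sub_zero] at h1
      refine (norm_sub_le _ _).trans ?_
      have h2 : ‖y (ι n)‖ ≤ ‖y‖ / 8 := by
        by_contra hcon
        exact hn (hW1 _ (not_le.1 hcon).le)
      linarith
  let G : C(K, ℂ) →L[ℂ] C(K, ℂ) := L.comp (1 - F) + F
  have hG : ∀ f, G f = L (f - F f) + F f := fun f => rfl
  refine ⟨G, ?_, ?_⟩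
  · refine isUnit_of_bdd_below G (c := 4 / ε0 + 1) (by positivity) (fun f => ?_) (fun y => ?_)
    · have hFG : F (G f) = F f := by
        rw [hG, map_add, hFz _ (hLz _), zero_add]
        exact (sub_eq_zero.1 (hEF f)).symm
      have h1 : ‖F f‖ ≤ ‖G f‖ := by rw [← hFG]; exact hFn _
      have h2 : L (f - F f) = G f - F f := by rw [hG]; abel
      have h3 := hbelow (f - F f) (hEz f)
      have h4 : ‖L (f - F f)‖ ≤ 2 * ‖G f‖ := by
        rw [h2]; refine (norm_sub_le _ _).trans ?_; linarith
      have h5 : ‖f - F f‖ ≤ 4 / ε0 * ‖G f‖ := by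
        rw [div_mul_eq_mul_div, le_div_iff₀ hε0]; linarith
      calc ‖f‖ = ‖(f - F f) + F f‖ := by rw [sub_add_cancel]
        _ ≤ ‖f - F f‖ + ‖F f‖ := norm_add_le _ _
        _ ≤ _ := by linarith
    · obtain ⟨f, hfP, hf⟩ := happrox (y - F y) (hEz y)
      refine ⟨f + F y, ?_⟩
      have e : y - G (f + F y) = (y - F y) - L f := by
        rw [hG, map_add, hFz f hfP, zero_add, ← sub_eq_zero.1 (hEF y), add_sub_cancel_right]
        abel
      rw [e]
      have h1 := norm_sub_le y (F y)
      have h2 := hFn y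
      linarith
  · have e : T - α • (1 : C(K, ℂ) →L[ℂ] C(K, ℂ)) - G = (T - D) +
      (F.comp (D - α • (1 : C(K, ℂ) →L[ℂ] C(K, ℂ))) + L.comp F + -F) := by
      refine ContinuousLinearMap.ext fun f => ?_
      simp only [sub_apply, add_apply, neg_apply, ContinuousLinearMap.comp_apply, hG, hL, map_sub,
        smul_apply, one_apply_eq_self, smul_sub]
      abel
    rw [e]
    refine hD.add ((DDop.add ?_ ?_).add (DDop.neg ?_))
    · have : F.comp (D - α • (1 : C(K, ℂ) →L[ℂ] C(K, ℂ))) = ∑ p ∈ hP.toFinset,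
          ((δ p).comp (D - α • (1 : C(K, ℂ) →L[ℂ] C(K, ℂ)))).smulRight (chi (C p)) := by
        refine ContinuousLinearMap.ext fun f => ?_
        simp only [F, ContinuousLinearMap.comp_apply, sum_apply]
        rfl
      rw [this]
      exact DDop_sum _ _ fun p _ => DDop_rank_one _ _
    · exact (DDop_sum _ _ fun p _ => DDop_rank_one _ _).comp L
    · exact DDop_sum _ _ fun p _ => DDop_rank_one _ _

end HSec

section JSec
variable {X : Type} [NormedAddCommGroup X] [NormedSpace ℂ X] [CompleteSpace X]

lemma functional_pow (T : X →L[ℂ] X) (θ : X →L[ℂ] ℂ) {lam : ℂ} (h : ∀ f, θ (T f) = lam * θ f)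
    (k : ℕ) (f : X) : θ ((T ^ k) f) = lam ^ k * θ f := by
  induction k generalizing f with
  | zero => simp
  | succ k ih =>
    rw [pow_succ, mul_apply_eq_comp, ih, h, pow_succ]
    ring

lemma J_of_functional (T : X →L[ℂ] X) (θ : X →L[ℂ] ℂ) (hθ : θ ≠ 0) {lam : ℂ} (hl : ‖lam‖ ≤ 1)
    (h : ∀ f, θ (T f) = lam * θ f) (x : X) : interior (JSet T x) = ∅ := by
  have hsub : ∃ c : ℝ, ∀ y ∈ JSet T x, ‖θ y‖ = c := by
    rcases hl.lt_or_eq with hl | hl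
    · refine ⟨0, ?_⟩
      rintro y ⟨k, hk, u, hu, hy⟩
      have h1 : Tendsto (fun n => θ ((T ^ k n) (u n))) atTop (𝓝 (θ y)) :=
        (θ.continuous.tendsto y).comp hy
      have h2 : Tendsto (fun n => lam ^ k n * θ (u n)) atTop (𝓝 (0 * θ x)) :=
        ((tendsto_pow_atTop_nhds_zero_of_norm_lt_one hl).comp hk.tendsto_atTop).mul
          ((θ.continuous.tendsto x).comp hu)
      simp only [functional_pow T θ h] at h1
      rw [tendsto_nhds_unique h1 h2, zero_mul, norm_zero]
    · refine ⟨‖θ x‖, ?_⟩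
      rintro y ⟨k, hk, u, hu, hy⟩
      have h1 : Tendsto (fun n => ‖θ ((T ^ k n) (u n))‖) atTop (𝓝 ‖θ y‖) :=
        ((θ.continuous.tendsto y).comp hy).norm
      have h2 : Tendsto (fun n => ‖θ (u n)‖) atTop (𝓝 ‖θ x‖) :=
        ((θ.continuous.tendsto x).comp hu).norm
      simp only [functional_pow T θ h, norm_mul, norm_pow, hl, one_pow, one_mul] at h1
      exact tendsto_nhds_unique h1 h2
  obtain ⟨c, hc⟩ := hsub
  have hsurj : Function.Surjective θ := by
    obtain ⟨v, hv⟩ : ∃ v, θ v ≠ 0 := by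
      by_contra hcon
      push Not at hcon
      exact hθ (ContinuousLinearMap.ext hcon)
    intro z
    exact ⟨(z / θ v) • v, by rw [map_smul, smul_eq_mul, div_mul_cancel₀ _ hv]⟩
  have ho := (θ.isOpenMap hsurj) _ (isOpen_interior (s := JSet T x))
  have hsp : θ '' interior (JSet T x) ⊆ interior (Metric.sphere (0 : ℂ) c) := by
    refine ho.subset_interior_iff.2 ?_
    rintro _ ⟨y, hy, rfl⟩
    rw [mem_sphere_zero_iff_norm]
    exact hc y (interior_subset hy)
  rw [interior_sphere'] at hsp
  exact Set.image_eq_empty.1 (Set.subset_eq_empty hsp rfl)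

lemma pow_tendsto_zero_of_radius {A : Type*} [NormedRing A] [NormedAlgebra ℂ A] [CompleteSpace A]
    (S : A) (hS : spectralRadius ℂ S < 1) : Tendsto (fun n => ‖S ^ n‖) atTop (𝓝 0) := by
  obtain ⟨r, hr1, hr2⟩ := ENNReal.lt_iff_exists_nnreal_btwn.1 hS
  have h1 := (tendsto_order.1 (spectrum.pow_nnnorm_pow_one_div_tendsto_nhds_spectralRadius S)).2 _ hr1
  have hr : (r : ℝ) < 1 := by exact_mod_cast hr2
  refine squeeze_zero' (Eventually.of_forall fun _ => norm_nonneg _) ?_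
    (tendsto_pow_atTop_nhds_zero_of_lt_one r.2 hr)
  filter_upwards [h1, eventually_gt_atTop 0] with n hn hn0
  have h2 : ((‖S ^ n‖₊ : ENNReal) ^ (1 / n : ℝ)) ^ n ≤ (r : ENNReal) ^ n := by
    gcongr
  rw [← ENNReal.rpow_natCast, ← ENNReal.rpow_mul, one_div,
    inv_mul_cancel₀ (by exact_mod_cast hn0.ne'), ENNReal.rpow_one] at h2
  exact_mod_cast h2

lemma J_of_units (T : X →L[ℂ] X) (hT : ∀ α : ℂ, ‖α‖ ≤ 1 → IsUnit (T - α • (1 : X →L[ℂ] X)))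
    (x : X) (hx : x ≠ 0) : interior (JSet T x) = ∅ := by
  have : Nontrivial X := ⟨x, 0, hx⟩
  obtain ⟨V, hV⟩ : IsUnit T := by simpa using hT 0 (by simp)
  have hσ : ∀ z ∈ spectrum ℂ (↑V⁻¹ : X →L[ℂ] X), ‖z‖₊ < 1 := by
    intro z hz
    by_contra hcon
    push Not at hcon
    have hz0 : z ≠ 0 := by
      rintro rfl; simp at hcon
    have h1 : z⁻¹ ∈ spectrum ℂ (V : X →L[ℂ] X) := by
      have := (spectrum.inv_mem_iff (r := Units.mk0 z hz0) (a := V⁻¹)).1 hz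
      simpa using this
    rw [spectrum.mem_iff, hV] at h1
    apply h1
    have h2 := (hT z⁻¹ (by
      rw [norm_inv]; exact inv_le_one_of_one_le₀ (by exact_mod_cast hcon))).neg
    rw [neg_sub] at h2
    rwa [Algebra.algebraMap_eq_smul_one]
  have hr : spectralRadius ℂ (↑V⁻¹ : X →L[ℂ] X) < 1 := by
    have := spectrum.spectralRadius_lt_of_forall_lt (↑V⁻¹ : X →L[ℂ] X) hσ
    simpa using this
  have hlim := pow_tendsto_zero_of_radius _ hr
  have he : JSet T x = ∅ := by
    refine Set.eq_empty_iff_forall_notMem.2 ?_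
    rintro y ⟨k, hk, u, hu, hy⟩
    apply hx
    have h1 : Tendsto (fun n => ‖(↑V⁻¹ : X →L[ℂ] X) ^ k n‖ * ‖(T ^ k n) (u n)‖) atTop (𝓝 (0 * ‖y‖)) :=
      (hlim.comp hk.tendsto_atTop).mul hy.norm
    rw [zero_mul] at h1
    refine tendsto_nhds_unique hu (squeeze_zero_norm (fun n => ?_) h1)
    have e : u n = ((↑V⁻¹ : X →L[ℂ] X) ^ k n) ((T ^ k n) (u n)) := by
      rw [← mul_apply_eq_comp, ← hV, ← Units.val_pow_eq_pow_val, ← Units.val_pow_eq_pow_val,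
        inv_pow, Units.inv_mul, one_apply_eq_self]
    conv_lhs => rw [e]
    exact ContinuousLinearMap.le_opNorm _ _
  rw [he, interior_empty]

lemma exists_functional_of_notMem (U : X →L[ℂ] X) (f : X) (hf : f ∉ closure (Set.range U)) :
    ∃ θ : X →L[ℂ] ℂ, θ f ≠ 0 ∧ ∀ g, θ (U g) = 0 := by
  let S : Submodule ℂ X := U.range.topologicalClosure
  have hS : (S : Set X) = closure (Set.range U) := by
    rw [Submodule.topologicalClosure_coe]
    congr 1
  have hSc : IsClosed (S : Set X) := by rw [hS]; exact isClosed_closure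
  have hfS : S.mkQL f ≠ 0 := by
    intro e
    have : f ∈ S := (Submodule.Quotient.mk_eq_zero S).1 e
    apply hf
    rw [← hS]; exact this
  obtain ⟨φ, -, hφ⟩ := exists_dual_vector ℂ (S.mkQL f) (norm_ne_zero_iff.2 hfS)
  refine ⟨φ.comp S.mkQL, ?_, fun g => ?_⟩
  · rw [ContinuousLinearMap.comp_apply, hφ]
    exact Complex.ofReal_ne_zero.2 (norm_ne_zero_iff.2 hfS)
  · have hg : U g ∈ S := by
      rw [← SetLike.mem_coe, hS]; exact subset_closure ⟨g, rfl⟩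
    have : S.mkQL (U g) = 0 := (Submodule.Quotient.mk_eq_zero S).2 hg
    rw [ContinuousLinearMap.comp_apply, this, map_zero]

end JSec

section HSec
variable {K : Type} [TopologicalSpace K] [CompactSpace K] [T2Space K] [TotallyDisconnectedSpace K]
  {ι : ℕ → K}

lemma countable_of_separable {J Y : Type*} [PseudoMetricSpace Y] (𝒥 : Set J) (φ : J → Y) {S : Set Y}
    (hS : TopologicalSpace.IsSeparable S) (hφ : ∀ I ∈ 𝒥, φ I ∈ S)
    (hd : ∀ I ∈ 𝒥, ∀ J ∈ 𝒥, I ≠ J → 1 ≤ dist (φ I) (φ J)) : 𝒥.Countable := by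
  obtain ⟨c, hc, hSc⟩ := hS
  have hex : ∀ I, ∃ y, I ∈ 𝒥 → y ∈ c ∧ dist (φ I) y < 1 / 2 := by
    intro I
    by_cases hI : I ∈ 𝒥
    · obtain ⟨y, hy, hy'⟩ := Metric.mem_closure_iff.1 (hSc (hφ I hI)) (1 / 2) (by norm_num)
      exact ⟨y, fun _ => ⟨hy, hy'⟩⟩
    · exact ⟨φ I, fun h => absurd h hI⟩
  choose y hy using hex
  refine Set.MapsTo.countable_of_injOn (f := y) (t := c) (fun I hI => (hy I hI).1) ?_ hc
  intro I hI J hJ hIJ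
  by_contra hne
  have h1 := hd I hI J hJ hne
  have h2 := (hy I hI).2
  have h3 := (hy J hJ).2
  have h4 := dist_triangle_right (φ I) (φ J) (y I)
  rw [hIJ] at h2 h4
  linarith

/-- clopens subordinate to an infinite set of isolated points are nonseparably many. -/
lemma HKSpace.clopens (h : HKSpace K ι) (m : ℕ → ℕ) (hm : Function.Injective m)
    {S : Set C(K, ℂ)} (hS : TopologicalSpace.IsSeparable S) :
    ∃ (B : Set K) (I : Set ℕ), IsClopen B ∧ I.Infinite ∧ chi B ∉ S ∧
      ∀ j, ι j ∈ B ↔ ∃ k ∈ I, j = m (2 * k) := by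
  obtain ⟨𝒥, h1, h2, h3, h4⟩ := h.k3 (fun k => {ι (m (2 * k))}) (fun k => m (2 * k + 1))
    (fun k => h.clopen _)
    (fun j k hjk => Set.disjoint_singleton.2 fun e => hjk (by have := hm (h.inj e); omega))
    (fun j k e => by have := hm (h.inj e); omega)
  have h4' : ∀ I, ∃ B, I ∈ 𝒥 → IsClopen B ∧ ∀ j, ι j ∈ B ↔ ∃ k ∈ I, j = m (2 * k) := by
    intro I
    by_cases hI : I ∈ 𝒥
    · obtain ⟨B, hB, hB'⟩ := (h4 I hI).1
      refine ⟨B, fun _ => ⟨hB, fun j => (hB' j).trans ?_⟩⟩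
      simp only [Set.mem_singleton_iff, h.inj.eq_iff]
    · exact ⟨∅, fun h => absurd h hI⟩
  choose B hB using h4'
  by_contra hcon
  push Not at hcon
  apply h1
  refine countable_of_separable 𝒥 (fun I => chi (B I)) hS ?_ ?_
  · intro I hI
    by_contra hIS
    obtain ⟨j, hj⟩ := hcon (B I) I (hB I hI).1 (h2 I hI) hIS
    have := (hB I hI).2 j
    rcases hj with ⟨a, b⟩ | ⟨a, b⟩
    · obtain ⟨k, hk, e⟩ := this.1 a
      exact b k hk e
    · exact a (this.2 b)
  · intro I hI J hJ hIJ
    have key : ∀ I ∈ 𝒥, ∀ J ∈ 𝒥, (∃ k ∈ I, k ∉ J) → 1 ≤ dist (chi (B I)) (chi (B J)) := by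
      rintro I hI J hJ ⟨k, hk, hk'⟩
      have a1 : ι (m (2 * k)) ∈ B I := ((hB I hI).2 _).2 ⟨k, hk, rfl⟩
      have a2 : ι (m (2 * k)) ∉ B J := fun hmem => by
        obtain ⟨l, hl, e⟩ := ((hB J hJ).2 _).1 hmem
        have := hm e
        exact hk' (by rwa [show k = l by omega])
      have := ContinuousMap.dist_apply_le_dist (f := chi (B I)) (g := chi (B J)) (ι (m (2 * k)))
      rw [chi_mem (hB I hI).1 a1, chi_notMem (hB J hJ).1 a2] at this
      simpa using this
    by_cases hs : ∃ k ∈ I, k ∉ J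
    · exact key I hI J hJ hs
    · rw [dist_comm]
      refine key J hJ I hI ?_
      by_contra hs'
      push Not at hs hs'
      exact hIJ (Set.Subset.antisymm hs hs')

lemma HKSpace.not_separable (h : HKSpace K ι) : ¬ TopologicalSpace.SeparableSpace C(K, ℂ) := by
  intro hs
  obtain ⟨B, I, _, _, hB, _⟩ := h.clopens id Function.injective_id
    (TopologicalSpace.isSeparable_univ_iff.2 hs)
  exact hB trivial

/-- eigenfunctional from a cluster value of the diagonal. -/
lemma HKSpace.cluster (h : HKSpace K ι) (T : C(K, ℂ) →L[ℂ] C(K, ℂ)) (m : ℕ → ℕ) (hm : StrictMono m)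
    {lam : ℂ} (hg : Tendsto (fun k => gd ι T (m k)) atTop (𝓝 lam)) :
    ∃ θ : C(K, ℂ) →L[ℂ] ℂ, θ ≠ 0 ∧ ∀ f, θ (T f) = lam * θ f := by
  obtain ⟨M, I, hM, hI, -, hMI⟩ := h.clopens m hm.injective
    (S := ∅) Set.countable_empty.isSeparable
  let W : C(K, ℂ) →L[ℂ] C(K, ℂ) := T - lam • (1 : C(K, ℂ) →L[ℂ] C(K, ℂ))
  let U : C(K, ℂ) →L[ℂ] C(K, ℂ) := (mulP M).comp W
  have hU : DDop U := by
    refine DD_of fun A f hf ε hε hT => ?_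
    have hex : ∀ k, ∃ n, ε / 2 ≤ ‖U (f k) (ι n)‖ := by
      intro k
      by_contra hcon
      push Not at hcon
      have := h.norm_le fun m => (hcon m).le
      linarith [hT k]
    choose n hn using hex
    have hnM : ∀ k, ι (n k) ∈ M := by
      intro k
      by_contra hk
      have := hn k
      rw [show U (f k) (ι (n k)) = 0 from mulP_notMem hM _ hk, norm_zero] at this
      linarith
    have hval : ∀ k, U (f k) (ι (n k)) = psi ι T (n k) (f k) + (gd ι T (n k) - lam) * f k (ι (n k)) := by
      intro k
      rw [show U (f k) (ι (n k)) = W (f k) (ι (n k)) from mulP_mem hM _ (hnM k), psi_apply]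
      change T (f k) (ι (n k)) - lam * f k (ι (n k)) = _
      ring
    -- the second term is eventually small
    have hsmall : ∀ᶠ k in atTop, ‖(gd ι T (n k) - lam) * f k (ι (n k))‖ < ε / 4 := by
      have hbad : {j | ι j ∈ M ∧ ε / 4 ≤ ‖gd ι T j - lam‖}.Finite := by
        obtain ⟨N, hN⟩ := eventually_atTop.1 ((tendsto_order.1
          (tendsto_iff_norm_sub_tendsto_zero.1 hg)).2 (ε / 4) (by positivity))
        refine ((Set.finite_lt_nat N).image m).subset ?_
        rintro j ⟨hj, hj'⟩
        obtain ⟨k, -, rfl⟩ := (hMI j).1 hj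
        refine ⟨2 * k, ?_, rfl⟩
        by_contra hk
        exact absurd (hN (2 * k) (not_lt.1 hk)) (not_lt.2 hj')
      have hfin : {k | ε / 4 ≤ ‖(gd ι T (n k) - lam) * f k (ι (n k))‖}.Finite := by
        refine Set.Finite.of_finite_image (f := n) (hbad.subset ?_) ?_
        · rintro _ ⟨k, hk, rfl⟩
          refine ⟨hnM k, le_trans hk ?_⟩
          rw [norm_mul]
          exact mul_le_of_le_one_right (norm_nonneg _)
            (((f k).norm_coe_le_norm _).trans (hf.norm k))
        · intro k hk l hl hkl
          by_contra hne
          have hmem : ∀ k, ε / 4 ≤ ‖(gd ι T (n k) - lam) * f k (ι (n k))‖ → ι (n k) ∈ A k := by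
            intro k hk
            by_contra hk'
            rw [hf.supp k _ hk', mul_zero, norm_zero] at hk
            linarith
          have h1 := hmem k hk
          have h2 := hmem l hl
          rw [← hkl] at h2
          exact Set.disjoint_left.1 (hf.disj k l hne) h1 h2
      have := hfin.eventually_cofinite_notMem
      rw [Nat.cofinite_eq_atTop] at this
      filter_upwards [this] with k hk
      exact not_le.1 hk
    obtain ⟨N, hN⟩ := eventually_atTop.1 hsmall
    refine psi_DD h T (A ∘ (· + N)) (f ∘ (· + N)) (n ∘ (· + N)) (hf.comp (add_left_injective N))
      (ε := ε / 4) (by positivity) fun k => ?_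
    have h1 := hn (k + N)
    rw [hval] at h1
    have h2 := norm_add_le (psi ι T (n (k + N)) (f (k + N)))
      ((gd ι T (n (k + N)) - lam) * f (k + N) (ι (n (k + N))))
    have h3 := hN (k + N) (Nat.le_add_left _ _)
    simp only [Function.comp_apply]
    linarith
  have hsep := (hU.separable h).closure
  obtain ⟨B, I', hB, -, hBS, hBI⟩ := h.clopens (fun k => m (2 * Nat.nth (· ∈ I) k))
    (fun a b hab => by
      have h1 := hm.injective hab
      refine Nat.nth_injective (p := (· ∈ I)) hI ?_
      omega) hsep
  obtain ⟨θ, hθ, hθ0⟩ := exists_functional_of_notMem U (chi B) hBS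
  have hMB : mulP M (chi B) = chi B := by
    refine h.ext fun j => ?_
    by_cases hj : ι j ∈ M
    · exact mulP_mem hM _ hj
    · rw [mulP_notMem hM _ hj, chi_notMem hB]
      intro hjB
      obtain ⟨k, -, rfl⟩ := (hBI j).1 hjB
      exact hj ((hMI _).2 ⟨_, Nat.nth_mem_of_infinite hI _, rfl⟩)
  refine ⟨θ.comp (mulP M), fun e => hθ ?_, fun f => ?_⟩
  · have := DFunLike.congr_fun e (chi B)
    simpa [hMB] using this
  · have h1 := hθ0 f
    have h2 : U f = mulP M (T f) - lam • mulP M f := by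
      change mulP M (T f - lam • f) = _
      rw [map_sub, map_smul]
    rw [h2, map_sub, map_smul, smul_eq_mul, sub_eq_zero] at h1
    exact h1

lemma HKSpace.main (h : HKSpace K ι) (T : C(K, ℂ) →L[ℂ] C(K, ℂ)) (x : C(K, ℂ)) (hx : x ≠ 0) :
    interior (JSet T x) = ∅ := by
  classical
  by_cases hcase : ∀ ε > 0, {n | ‖gd ι T n‖ < 1 + ε}.Infinite
  · have hfr : ∀ j : ℕ, ∃ᶠ n in atTop, ‖gd ι T n‖ < 1 + 1 / ((j : ℝ) + 1) := fun j =>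
      Nat.frequently_atTop_iff_infinite.2 (hcase _ (by positivity))
    obtain ⟨m, hm, hm'⟩ := extraction_forall_of_frequently hfr
    obtain ⟨lam, -, σ, hσ, hlam⟩ := (isCompact_closedBall (0 : ℂ) ‖T‖).tendsto_subseq
      (x := fun k => gd ι T (m k)) (fun k => by
        rw [mem_closedBall_zero_iff]; exact gd_norm_le T _)
    have hl : ‖lam‖ ≤ 1 := by
      have h1 : Tendsto (fun k : ℕ => 1 + 1 / (((σ k : ℕ) : ℝ) + 1)) atTop (𝓝 (1 + 0)) :=
        tendsto_const_nhds.add (tendsto_one_div_add_atTop_nhds_zero_nat.comp hσ.tendsto_atTop)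
      rw [add_zero] at h1
      exact le_of_tendsto_of_tendsto' hlam.norm h1 fun k => (hm' _).le
    obtain ⟨θ, hθ, hθT⟩ := h.cluster T (m ∘ σ) (hm.comp hσ) hlam
    exact J_of_functional T θ hθ hl hθT x
  · push Not at hcase
    obtain ⟨ε1, hε1, hfin⟩ := hcase
    set ε0 : ℝ := min ε1 1 with hε0
    have hεpos : 0 < ε0 := lt_min hε1 one_pos
    have hEfin : {n | ‖gd ι T n‖ < 1 + ε1}.Finite := by simpa using hfin
    let E := hEfin.toFinset
    let Q : C(K, ℂ) →L[ℂ] C(K, ℂ) := ∑ n ∈ E,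
      ((2 - gd ι T n) • row (ContinuousLinearMap.id ℂ C(K, ℂ)) (ι n)).smulRight (chi {ι n})
    have hQ : DDop Q := DDop_sum _ _ fun n _ => DDop_rank_one _ _
    have hQx : ∀ f x, Q f x = ∑ n ∈ E, ((2 - gd ι T n) * f (ι n)) * chi {ι n} x := by
      intro f x
      simp only [Q, sum_apply, ContinuousMap.sum_apply]
      rfl
    have hgd : ∀ n, gd ι (T + Q) n = if n ∈ E then 2 else gd ι T n := by
      intro n
      have e : gd ι (T + Q) n = gd ι T n + Q (chi {ι n}) (ι n) := rfl
      rw [e, hQx]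
      have hterm : ∀ j, chi {ι j} (ι n) = if j = n then 1 else 0 := by
        intro j
        rw [chi_apply (h.clopen j)]
        simp [h.inj.eq_iff, eq_comm]
      simp only [hterm, mul_ite, mul_one, mul_zero, Finset.sum_ite_eq']
      split_ifs
      · ring
      · ring
    have hbound : ∀ n, 1 + ε0 ≤ ‖gd ι (T + Q) n‖ := by
      intro n
      rw [hgd]
      have a1 : ε0 ≤ ε1 := min_le_left _ _
      have a2 : ε0 ≤ 1 := min_le_right _ _
      split_ifs with hn
      · rw [Complex.norm_ofNat]; linarith
      · have : ¬ ‖gd ι T n‖ < 1 + ε1 := by simpa [E] using hn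
        linarith
    by_cases hdense : ∀ α : ℂ, ‖α‖ ≤ 1 →
        DenseRange ⇑(T - α • (1 : C(K, ℂ) →L[ℂ] C(K, ℂ)))
    · refine J_of_units T (fun α hα => ?_) x hx
      obtain ⟨_, ⟨G, rfl⟩, hG⟩ := exists_unit h (T + Q) hεpos (min_le_right _ _) hbound hα
      have hR0 : DDop (T - α • (1 : C(K, ℂ) →L[ℂ] C(K, ℂ)) - (G : C(K, ℂ) →L[ℂ] C(K, ℂ))) := by
        have := hG.add hQ.neg
        convert this using 1
        abel
      set W : C(K, ℂ) →L[ℂ] C(K, ℂ) := T - α • (1 : C(K, ℂ) →L[ℂ] C(K, ℂ)) with hW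

      let R : C(K, ℂ) →L[ℂ] C(K, ℂ) := (↑G⁻¹ : C(K, ℂ) →L[ℂ] C(K, ℂ)).comp (W - (G : C(K, ℂ) →L[ℂ] C(K, ℂ)))
      have hR : DDop R := hR0.comp _
      have e1 : 1 + R = (↑G⁻¹ : C(K, ℂ) →L[ℂ] C(K, ℂ)) * W := by
        change 1 + (↑G⁻¹ : C(K, ℂ) →L[ℂ] C(K, ℂ)) * (W - (G : C(K, ℂ) →L[ℂ] C(K, ℂ))) = _
        rw [mul_sub, Units.inv_mul]; abel
      have e2 : W = G * (1 + R) := by rw [e1, Units.mul_inv_cancel_left]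
      have hGs : Function.Surjective (↑G⁻¹ : C(K, ℂ) →L[ℂ] C(K, ℂ)) :=
        ((ContinuousLinearMap.isUnit_iff_bijective).1 (Units.isUnit _)).2
      have hd : DenseRange ⇑(1 + R : C(K, ℂ) →L[ℂ] C(K, ℂ)) := by
        rw [e1]
        exact hGs.denseRange.comp (hdense α hα) (ContinuousLinearMap.continuous _)
      rw [e2]
      exact G.isUnit.mul (riesz_isUnit (fun f hf => hR.sq_compact h hf) hd)
    · push Not at hdense
      obtain ⟨α, hα, hd⟩ := hdense
      obtain ⟨f, hf⟩ : ∃ f, f ∉ closure (Set.range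
          ⇑(T - α • (1 : C(K, ℂ) →L[ℂ] C(K, ℂ)))) := by
        by_contra hcon
        push Not at hcon
        exact hd hcon
      obtain ⟨θ, hθ, hθ0⟩ := exists_functional_of_notMem
        (T - α • (1 : C(K, ℂ) →L[ℂ] C(K, ℂ))) f hf
      refine J_of_functional T θ (fun e => hθ (by rw [e]; rfl)) hα (fun g => ?_) x
      have h1 : θ (T g - α • g) = 0 := hθ0 g
      rw [map_sub, map_smul, smul_eq_mul, sub_eq_zero] at h1
      exact h1

end HSec

theorem stmt_2 :
    ∃ (X : Type) (_ : NormedAddCommGroup X) (_ : NormedSpace ℂ X),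
      CompleteSpace X ∧ ¬ TopologicalSpace.SeparableSpace X ∧
      (∀ (T : X →L[ℂ] X) (x : X), x ≠ 0 → interior (JSet T x) = ∅) ∧
      ¬ ∃ (T : X →L[ℂ] X) (x : X), x ≠ 0 ∧ JSet T x = Set.univ := by
  obtain ⟨K, _, _, _, _, ι, h⟩ := hk_space
  refine ⟨C(K, ℂ), inferInstance, inferInstance, inferInstance, h.not_separable,
    fun T x hx => h.main T x hx, ?_⟩
  rintro ⟨T, x, hx, hJ⟩
  have := h.main T x hx
  rw [hJ, interior_univ] at this
  exact Set.notMem_empty x (this ▸ Set.mem_univ x)
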